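/- Let u be a C² function on B_1 with |u| ≤ 1 solving 𝓛u = Vu pointwise in B_1, where V satisfies the Hardy-type growth bound |V(z,t)| ≤ C₀ ψ/ρ² on B_1 for some C₀ > 0. If for every real k > 0 one has ∫_{B_r} u² ψ = O(e^{−k(log r)²}) as r → 0⁺, then u ≡ 0 in B_1. -/

import Mathlib

open MeasureTheory Real Set Filter Asymptotics

noncomputable section

/-- The underlying space ℝ^m × ℝ^k. -/
abbrev E (m k : ℕ) : Type :=
  EuclideanSpace ℝ (Fin m) × EuclideanSpace ℝ (Fin k)

namespace BG

variable {m k : ℕ}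

/-- The Baouendi–Grushin gauge ρ. -/
def rho (γ : ℝ) (p : E m k) : ℝ :=
  (‖p.1‖ ^ (2 * (γ + 1)) + (γ + 1) ^ 2 * ‖p.2‖ ^ 2) ^ (1 / (2 * (γ + 1)))

/-- The angle function ψ = |z|^{2γ}/ρ^{2γ}. -/
def psi (γ : ℝ) (p : E m k) : ℝ :=
  ‖p.1‖ ^ (2 * γ) / rho γ p ^ (2 * γ)

/-- The gauge ball B_r = {ρ < r}. -/
def ball (γ r : ℝ) : Set (E m k) := {p | rho γ p < r}

/-- The Baouendi–Grushin vector fields as direction fields: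
X_i = ∂_{z_i} for i < m, X_{m+j} = |z|^γ ∂_{t_j}. -/
def Xvec (γ : ℝ) (p : E m k) (i : Fin (m + k)) : E m k :=
  if h : (i : ℕ) < m then (EuclideanSpace.single ⟨(i : ℕ), h⟩ 1, 0)
  else (0, EuclideanSpace.single ⟨(i : ℕ) - m, by have := i.isLt; omega⟩ (‖p.1‖ ^ γ))

/-- Derivative along the i-th Baouendi–Grushin vector field. -/
def Xd (γ : ℝ) (i : Fin (m + k)) (f : E m k → ℝ) (p : E m k) : ℝ :=
  fderiv ℝ f p (Xvec γ p i)

/-- The quadratic form ⟨A Xu, Xu⟩. -/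
def quadA (γ : ℝ) (A : E m k → Matrix (Fin (m + k)) (Fin (m + k)) ℝ)
    (u : E m k → ℝ) (p : E m k) : ℝ :=
  ∑ i, ∑ j, A p i j * Xd γ i u p * Xd γ j u p

/-- μ = ⟨A Xρ, Xρ⟩. -/
def mu (γ : ℝ) (A : E m k → Matrix (Fin (m + k)) (Fin (m + k)) ℝ) (p : E m k) : ℝ :=
  quadA γ A (rho γ) p

/-- The operator 𝓛 u = Σ_{i,j} X_i(a_{ij} X_j u). -/
def Lop (γ : ℝ) (A : E m k → Matrix (Fin (m + k)) (Fin (m + k)) ℝ)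
    (u : E m k → ℝ) (p : E m k) : ℝ :=
  ∑ i, ∑ j, Xd γ i (fun q => A q i j * Xd γ j u q) p

/-- The vector field F = (ρ/μ) Σ a_{ij} X_iρ X_j, as a first order operator. -/
def Fop (γ : ℝ) (A : E m k → Matrix (Fin (m + k)) (Fin (m + k)) ℝ)
    (v : E m k → ℝ) (p : E m k) : ℝ :=
  rho γ p / mu γ A p * ∑ i, ∑ j, A p i j * Xd γ i (rho γ) p * Xd γ j v p

/-- The Baouendi–Grushin operator 𝓑_γ = Δ_z + |z|^{2γ} Δ_t = Σ_i X_i X_i. -/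
def Bop (γ : ℝ) (u : E m k → ℝ) (p : E m k) : ℝ :=
  ∑ i : Fin (m + k), Xd γ i (Xd γ i u) p

/-- The generator of anisotropic dilations Z = Σ z_i ∂_{z_i} + (γ+1) Σ t_j ∂_{t_j},
as a first order operator: the derivative in the direction (z, (γ+1) t). -/
def Zd (γ : ℝ) (v : E m k → ℝ) (p : E m k) : ℝ :=
  fderiv ℝ v p (p.1, (γ + 1) • p.2)

/-- The Euclidean divergence of a vector field on ℝ^m × ℝ^k. -/
def divV (V : E m k → E m k) (p : E m k) : ℝ :=
  (∑ i : Fin m, (fderiv ℝ V p (EuclideanSpace.single i 1, 0)).1 i) +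
    ∑ j : Fin k,
      (fderiv ℝ V p ((0 : EuclideanSpace ℝ (Fin m)), EuclideanSpace.single j 1)).2 j

/-- Uniform ellipticity: λ|η|² ≤ ⟨Aη,η⟩ ≤ λ⁻¹|η|². -/
def Elliptic (lam : ℝ) (A : E m k → Matrix (Fin (m + k)) (Fin (m + k)) ℝ) : Prop :=
  ∀ (p : E m k) (η : Fin (m + k) → ℝ),
    lam * ∑ i, η i ^ 2 ≤ ∑ i, ∑ j, A p i j * η i * η j ∧
      ∑ i, ∑ j, A p i j * η i * η j ≤ lam⁻¹ * ∑ i, η i ^ 2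

/-- Symmetry of the matrix A. -/
def Symm (A : E m k → Matrix (Fin (m + k)) (Fin (m + k)) ℝ) : Prop :=
  ∀ p i j, A p i j = A p j i

/-- The entries of A are C¹. -/
def C1coeff (A : E m k → Matrix (Fin (m + k)) (Fin (m + k)) ℝ) : Prop :=
  ∀ i j, ContDiff ℝ 1 fun p => A p i j

/-- The structural hypothesis (H) on B = A - I, in B_1. -/
def HypH (γ Λ : ℝ) (A : E m k → Matrix (Fin (m + k)) (Fin (m + k)) ℝ) : Prop :=
  ∀ p ∈ ball (m := m) (k := k) γ 1,
    (∀ i j : Fin (m + k),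
        |(A p - 1) i j| ≤
          if (i : ℕ) < m ∧ (j : ℕ) < m then Λ * rho γ p
          else Λ * psi γ p ^ ((1 : ℝ) / 2 + 1 / (2 * γ)) * rho γ p) ∧
      ∀ l i j : Fin (m + k),
        |Xd γ l (fun q => (A q - 1) i j) p| ≤
          if (l : ℕ) < m ∧ (i : ℕ) < m ∧ (j : ℕ) < m then Λ
          else if m ≤ (l : ℕ) ∧ (m ≤ (i : ℕ) ∨ m ≤ (j : ℕ)) then
            Λ * psi γ p ^ ((1 : ℝ) + 1 / (2 * γ))
          else Λ * psi γ p ^ ((1 : ℝ) / 2)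

end BG

section

set_option linter.unusedSectionVars false
set_option linter.unusedSimpArgs false

namespace UCP

section general
variable {H : Type*} [NormedAddCommGroup H] [NormedSpace ℝ H] [FiniteDimensional ℝ H]

/-- Divergence of a vector field, as the trace of its derivative. -/
def divg (W : H → H) (p : H) : ℝ := LinearMap.trace ℝ H (fderiv ℝ W p : H →ₗ[ℝ] H)

lemma HasFDerivAt.divg_eq {W : H → H} {W' : H →L[ℝ] H} {p : H} (h : HasFDerivAt W W' p) :
    divg W p = LinearMap.trace ℝ H (W' : H →ₗ[ℝ] H) := by
  rw [divg, h.fderiv]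

lemma divg_add {W W' : H → H} {p : H} (h : DifferentiableAt ℝ W p) (h' : DifferentiableAt ℝ W' p) :
    divg (fun q => W q + W' q) p = divg W p + divg W' p := by
  rw [HasFDerivAt.divg_eq (h.hasFDerivAt.fun_add h'.hasFDerivAt)]
  simp [divg]

lemma divg_smul {f : H → ℝ} {W : H → H} {p : H} (hf : DifferentiableAt ℝ f p)
    (h : DifferentiableAt ℝ W p) :
    divg (fun q => f q • W q) p = f p * divg W p + fderiv ℝ f p (W p) := by
  rw [HasFDerivAt.divg_eq (hf.hasFDerivAt.fun_smul h.hasFDerivAt)]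
  have : (((f p • fderiv ℝ W p + (fderiv ℝ f p).smulRight (W p) : H →L[ℝ] H)) : H →ₗ[ℝ] H)
    = f p • (fderiv ℝ W p : H →ₗ[ℝ] H) + (fderiv ℝ f p : H →ₗ[ℝ] ℝ).smulRight (W p) := rfl
  rw [this, map_add, map_smul, LinearMap.trace_smulRight]
  simp [divg]

lemma divg_congr {W W' : H → H} {p : H} (h : W =ᶠ[nhds p] W') : divg W p = divg W' p := by
  rw [divg, divg, h.fderiv_eq]

lemma trace_eq_sum_coord {ι : Type*} [Fintype ι] [DecidableEq ι] (b : Module.Basis ι ℝ H)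
    (T : H →ₗ[ℝ] H) : LinearMap.trace ℝ H T = ∑ i, b.repr (T (b i)) i := by
  rw [LinearMap.trace_eq_matrix_trace ℝ b, Matrix.trace]
  simp [LinearMap.toMatrix_apply]

variable [MeasurableSpace H] [BorelSpace H] (μ : Measure H) [μ.IsAddHaarMeasure]

lemma integral_fderiv_eq_zero {f : H → ℝ} (hf : ContDiff ℝ 1 f) (hc : HasCompactSupport f) (v : H) :
    ∫ x, fderiv ℝ f x v ∂μ = 0 := by
  have h1 : Continuous (fun x => fderiv ℝ f x v) :=
    (hf.continuous_fderiv one_ne_zero).clm_apply continuous_const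
  have h2 : HasCompactSupport (fun x => fderiv ℝ f x v) := hc.fderiv_apply ℝ v
  have := integral_mul_fderiv_eq_neg_fderiv_mul_of_integrable (μ := μ) (𝕜 := ℝ)
    (f := fun _ => (1:ℝ)) (g := f) (v := v) (by simp)
    (by simpa using h1.integrable_of_hasCompactSupport h2)
    (by simpa using hf.continuous.integrable_of_hasCompactSupport hc)
    (by intro x _; fun_prop) (by intro x _; exact hf.differentiable one_ne_zero x)
  simpa using this

lemma continuous_divg {W : H → H} (hW : ContDiff ℝ 1 W) : Continuous (divg W) := by
  have : Continuous (fun T : H →L[ℝ] H => LinearMap.trace ℝ H (T : H →ₗ[ℝ] H)) := by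
    let L : (H →L[ℝ] H) →ₗ[ℝ] ℝ :=
      (LinearMap.trace ℝ H).comp (ContinuousLinearMap.coeLM ℝ)
    exact L.continuous_of_finiteDimensional
  exact this.comp (hW.continuous_fderiv one_ne_zero)

lemma continuousOn_divg {W : H → H} {U : Set H} (hU : IsOpen U) (hW : ContDiffOn ℝ 1 W U) :
    ContinuousOn (divg W) U := by
  have : Continuous (fun T : H →L[ℝ] H => LinearMap.trace ℝ H (T : H →ₗ[ℝ] H)) := by
    let L : (H →L[ℝ] H) →ₗ[ℝ] ℝ :=
      (LinearMap.trace ℝ H).comp (ContinuousLinearMap.coeLM ℝ)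
    exact L.continuous_of_finiteDimensional
  exact this.comp_continuousOn (hW.continuousOn_fderiv_of_isOpen hU le_rfl)

lemma integral_divg {W : H → H} (hW : ContDiff ℝ 1 W) (hc : HasCompactSupport W) :
    ∫ x, divg W x ∂μ = 0 := by
  classical
  let b := Module.finBasis ℝ H
  let c : Fin (Module.finrank ℝ H) → H →L[ℝ] ℝ := fun i =>
    LinearMap.toContinuousLinearMap (b.coord i)
  have key : ∀ x, divg W x = ∑ i, fderiv ℝ (fun y => c i (W y)) x (b i) := by
    intro x
    rw [divg, trace_eq_sum_coord b]
    refine Finset.sum_congr rfl fun i _ => ?_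
    have := ((c i).hasFDerivAt.comp x (hW.differentiable one_ne_zero x).hasFDerivAt).fderiv
    rw [show (fun y => c i (W y)) = (c i) ∘ W from rfl, this]
    rfl
  have hC : ∀ i, ContDiff ℝ 1 (fun y => c i (W y)) := fun i => (c i).contDiff.comp hW
  have hS : ∀ i, HasCompactSupport (fun y => c i (W y)) := fun i =>
    hc.comp_left (g := c i) (map_zero _)
  simp_rw [key]
  rw [integral_finsetSum]
  · exact Finset.sum_eq_zero fun i _ => integral_fderiv_eq_zero μ (hC i) (hS i) _
  · intro i _
    exact (((hC i).continuous_fderiv one_ne_zero).clm_apply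
      continuous_const).integrable_of_hasCompactSupport ((hS i).fderiv_apply ℝ _)

section ext
variable {G : Type*} [NormedAddCommGroup G] [NormedSpace ℝ G]

lemma indicator_eventuallyEq {f : H → G} {U K : Set H} (hU : IsOpen U) (hK : IsCompact K)
    (hKU : K ⊆ U) (h0 : ∀ p ∈ U, p ∉ K → f p = 0) (p : H) :
    (p ∈ U ∧ U.indicator f =ᶠ[nhds p] f) ∨ U.indicator f =ᶠ[nhds p] fun _ => 0 := by
  by_cases hp : p ∈ U
  · left
    refine ⟨hp, ?_⟩
    filter_upwards [hU.mem_nhds hp] with q hq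
    simp [hq]
  · right
    have : Kᶜ ∈ nhds p := hK.isClosed.isOpen_compl.mem_nhds (fun h => hp (hKU h))
    filter_upwards [this] with q hq
    by_cases hqU : q ∈ U
    · simp [hqU, h0 q hqU hq]
    · simp [hqU]

lemma contDiff_indicator {f : H → G} {U K : Set H} (hU : IsOpen U) (hK : IsCompact K)
    (hKU : K ⊆ U) (h0 : ∀ p ∈ U, p ∉ K → f p = 0) {n : ℕ∞} (hf : ContDiffOn ℝ n f U) :
    ContDiff ℝ n (U.indicator f) := by
  rw [contDiff_iff_contDiffAt]
  intro p
  rcases indicator_eventuallyEq hU hK hKU h0 p with ⟨hp, h⟩ | h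
  · exact (hf.contDiffAt (hU.mem_nhds hp)).congr_of_eventuallyEq h
  · exact contDiffAt_const.congr_of_eventuallyEq h

lemma continuous_indicator' {f : H → G} {U K : Set H} (hU : IsOpen U) (hK : IsCompact K)
    (hKU : K ⊆ U) (h0 : ∀ p ∈ U, p ∉ K → f p = 0) (hf : ContinuousOn f U) :
    Continuous (U.indicator f) := by
  rw [continuous_iff_continuousAt]
  intro p
  rcases indicator_eventuallyEq hU hK hKU h0 p with ⟨hp, h⟩ | h
  · exact (hf.continuousAt (hU.mem_nhds hp)).congr h.symm
  · exact continuousAt_const.congr h.symm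

lemma hasCompactSupport_indicator {f : H → G} {U K : Set H} (hK : IsCompact K)
    (h0 : ∀ p ∈ U, p ∉ K → f p = 0) : HasCompactSupport (U.indicator f) := by
  refine HasCompactSupport.intro hK fun p hp => ?_
  by_cases hqU : p ∈ U
  · simp [hqU, h0 p hqU hp]
  · simp [hqU]

lemma integrableOn_of_compact {f : H → G} {U K : Set H} (hU : IsOpen U) (hK : IsCompact K)
    (hKU : K ⊆ U) (h0 : ∀ p ∈ U, p ∉ K → f p = 0) (hf : ContinuousOn f U) :
    IntegrableOn f U μ := by
  rw [← integrable_indicator_iff hU.measurableSet]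
  exact (continuous_indicator' hU hK hKU h0 hf).integrable_of_hasCompactSupport
    (hasCompactSupport_indicator hK h0)
end ext

/-- Divergence theorem for fields with compact support inside an open set. -/
lemma setIntegral_divg {W : H → H} {U K : Set H} (hU : IsOpen U) (hK : IsCompact K)
    (hKU : K ⊆ U) (h0 : ∀ p ∈ U, p ∉ K → W p = 0) (hW : ContDiffOn ℝ 1 W U) :
    ∫ p in U, divg W p ∂μ = 0 := by
  rw [← integral_indicator hU.measurableSet]
  have := integral_divg μ (contDiff_indicator (n := 1) hU hK hKU h0 hW)
    (hasCompactSupport_indicator hK h0)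
  rw [← this]
  congr 1
  ext p
  rcases indicator_eventuallyEq hU hK hKU h0 p with ⟨hp, h⟩ | h
  · rw [divg_congr h]; simp [hp]
  · have h2 : divg (U.indicator W) p = 0 := by
      rw [divg_congr h]; simp [divg]
    rw [h2]
    by_cases hp : p ∈ U
    · have h3 : W =ᶠ[nhds p] fun _ => 0 := by
        filter_upwards [h, hU.mem_nhds hp] with q hq hqU
        simpa [hqU] using hq
      rw [indicator_of_mem hp, divg_congr h3]; simp [divg]
    · simp [hp]

end general
end UCP

end

section

set_option linter.unusedSectionVars false
set_option linter.unusedSimpArgs false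
namespace UCP

set_option maxHeartbeats 4000000 in
/-- The algebraic inequality behind the Carleman estimate (coefficient of `Ψ`). -/
lemma alg_E {c C0 α L e B τ δ g w x D : ℝ} (hL : 1 ≤ L) (hC0 : 0 ≤ C0)
    (hα : 10 * (C0 + |c| + 1) ≤ α) (he : 0 ≤ e) (heL : e * L ≤ 1 / 200)
    (hB : |B - 1| ≤ e) (hτ : |τ| ≤ e) (hδ : |δ| ≤ e) (hg : |g| ≤ e) (hw : |w| ≤ C0) :
    α ^ 2 * L * x ^ 2 ≤
      2 * (2 * α * L) * D ^ 2 + 2 * α * (2 * α * L) * B ^ 2 * x ^ 2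
      - x * D * (w + 2 * α * B - (2 * α * L) * (τ + δ) - 2 * e)
      + x ^ 2 * (2 * e * w - 2 * e * (2 * α * L) ^ 2 * B - 2 * e * c
        - 1 / 2 * (2 * α * L) ^ 2 * (B * δ + τ * B + g) + 2 * e * B * (2 * α * L)) := by
  have hc0 := abs_nonneg c
  have hα10 : 10 ≤ α := by linarith
  have he1 : e ≤ 1 / 200 := by nlinarith
  rw [abs_le] at hB hτ hδ hg hw
  have hB1 : 199 / 200 ≤ B := by linarith
  have hB2 : B ≤ 201 / 200 := by linarith
  set P := 2 * α * L with hP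
  have hP1 : 20 ≤ P := by nlinarith
  have heP : e * P ≤ α / 100 := by rw [hP]; nlinarith
  have heP0 : 0 ≤ e * P := by positivity
  have heP2 : e * P ^ 2 ≤ α ^ 2 * L / 50 := by
    have : e * P ^ 2 = 4 * α ^ 2 * L * (e * L) := by rw [hP]; ring
    rw [this]
    have h4 : 0 ≤ 4 * α ^ 2 * L := by positivity
    nlinarith
  have heP20 : 0 ≤ e * P ^ 2 := by positivity
  -- cross coefficient
  set c1 := w + 2 * α * B - P * (τ + δ) - 2 * e with hc1
  have hPτ : |P * (τ + δ)| ≤ α / 50 := by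
    rw [abs_mul, abs_of_nonneg (by linarith : (0:ℝ) ≤ P)]
    have : |τ + δ| ≤ 2 * e := by rw [abs_le]; constructor <;> linarith
    nlinarith
  rw [abs_le] at hPτ
  have hc1a : |c1| ≤ 4 * α := by
    rw [abs_le]; constructor
    · rw [hc1]; nlinarith
    · rw [hc1]; nlinarith
  have hcross : x * D * c1 ≤ 2 * P * D ^ 2 + α ^ 2 * L / 10 * x ^ 2 := by
    have h1 : x * D * c1 ≤ |x| * |D| * (4 * α) := by
      calc x * D * c1 ≤ |x * D * c1| := le_abs_self _
        _ = |x| * |D| * |c1| := by rw [abs_mul, abs_mul]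
        _ ≤ _ := by gcongr
    have h2 : |x| * |D| * (4 * α) ≤ 2 * α * |D| ^ 2 + 2 * α * |x| ^ 2 := by
      nlinarith [sq_nonneg (|x| - |D|)]
    rw [sq_abs, sq_abs] at h2
    have h3 : 2 * α * D ^ 2 ≤ P * D ^ 2 := by
      have : 2 * α ≤ P := by rw [hP]; nlinarith
      nlinarith [sq_nonneg D]
    have h5 : |x| * |D| * (4 * α) ≤ 4 * α * L * |D| ^ 2 + α / L * |x| ^ 2 := by
      have hL0 : 0 < L := by linarith
      have : 4 * α * L * |D| ^ 2 + α / L * |x| ^ 2 - |x| * |D| * (4 * α)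
        = α / L * (|x| - 2 * L * |D|) ^ 2 := by field_simp; ring
      have : 0 ≤ α / L * (|x| - 2 * L * |D|) ^ 2 := by positivity
      linarith
    rw [sq_abs, sq_abs] at h5
    have h6 : α / L ≤ α ^ 2 * L / 10 := by
      rw [div_le_iff₀ (by linarith)]
      have : 1 ≤ L * L := by nlinarith
      have h10 : 10 * α ≤ α ^ 2 := by nlinarith
      have : α ^ 2 * 1 ≤ α ^ 2 * (L * L) := by gcongr
      nlinarith
    have h7 : α / L * x ^ 2 ≤ α ^ 2 * L / 10 * x ^ 2 := by gcongr
    have h8 : 2 * P * D ^ 2 = 4 * α * L * D ^ 2 := by rw [hP]; ring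
    linarith
  -- coefficient of x^2
  have hx2 : α ^ 2 * L + α ^ 2 * L / 10 ≤ 2 * α * P * B ^ 2 + (2 * e * w - 2 * e * P ^ 2 * B
        - 2 * e * c - 1 / 2 * P ^ 2 * (B * δ + τ * B + g) + 2 * e * B * P) := by
    have hαL : α ≤ α ^ 2 * L / 10 := by
      have : 10 * α ≤ α ^ 2 := by nlinarith
      nlinarith
    have a1 : α ^ 2 * L * 3 ≤ 2 * α * P * B ^ 2 := by
      have : 2 * α * P * B ^ 2 = 4 * (α ^ 2 * L) * B ^ 2 := by rw [hP]; ring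
      rw [this]
      have : 3 / 4 ≤ B ^ 2 := by nlinarith
      have h0 : 0 ≤ α ^ 2 * L := by positivity
      nlinarith
    have a2 : -(C0 / 100) ≤ 2 * e * w := by
      nlinarith
    have a3 : 2 * e * c ≤ |c| / 100 := by
      have := le_abs_self c
      nlinarith
    have a4 : 2 * e * P ^ 2 * B ≤ 3 * (e * P ^ 2) := by nlinarith
    have a5 : 1 / 2 * P ^ 2 * (B * δ + τ * B + g) ≤ 2 * (e * P ^ 2) := by
      have : B * δ + τ * B + g ≤ 4 * e := by nlinarith
      have hP2 : 0 ≤ P ^ 2 := by positivity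
      nlinarith
    have a6 : 0 ≤ 2 * e * B * P := by
      have : 0 ≤ 2 * (e * P) * B := by positivity
      linarith
    nlinarith
  have hx2' := mul_le_mul_of_nonneg_right hx2 (sq_nonneg x)
  clear_value P c1
  linarith

set_option maxHeartbeats 1000000 in
/-- The full algebraic inequality for the divergence of the field. -/
lemma alg_div {c C0 α s e B τ δ g V x y a R Ψ daF Nv : ℝ} (hs : s ≤ -1) (hC0 : 0 ≤ C0)
    (hα : 10 * (C0 + |c| + 1) ≤ α) (he : 0 ≤ e) (heL : e * (-s) ≤ 1 / 200)
    (hΨ : 0 < Ψ) (ha : 0 ≤ a)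
    (hB : |B - 1| ≤ e) (hτ : |τ| ≤ e * Ψ) (hδ : |δ| ≤ e) (hg : |g| ≤ e) (hV : |V| ≤ C0 * Ψ)
    (hR : |R| ≤ e * a)
    (hN : Nv = V * x + 2 * (2 * α * s) * Ψ * y + 2 * α * B * x * Ψ
      + (2 * α * s) * x * ((-2 * Ψ + τ) + Ψ * ((2 * c + 2) + δ)) - (2 * α * s) ^ 2 * x * Ψ * B) :
    α ^ 2 * (-s) * Ψ * x ^ 2 ≤
      (2 * e * x - y - c * x) * Nv + (2 * e * Ψ * y * x + 2 * e * a - (1 / 2 * daF + a + R) - c * a)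
      + (1 / 2 * a - 1 / 2 * (2 * α * s) ^ 2 * Ψ * B * x ^ 2 - 2 * e * (2 * α * s) * Ψ * x ^ 2)
          * ((2 * c + 2) + δ)
      + (1 / 2 * daF - (2 * α * s) * (2 * α * B) * Ψ * B * x ^ 2
          - 1 / 2 * (2 * α * s) ^ 2 * ((-2 * Ψ + τ) * B + Ψ * g) * x ^ 2
          - (2 * α * s) ^ 2 * Ψ * B * x * y
          - 2 * (e * B * (2 * α * s) * Ψ * x ^ 2 + e * (2 * α * B) * Ψ * x ^ 2
            + e * (2 * α * s) * (-2 * Ψ + τ) * x ^ 2 + 2 * e * (2 * α * s) * Ψ * x * y)) := by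
  obtain ⟨τ', rfl⟩ : ∃ τ', τ = Ψ * τ' := ⟨τ / Ψ, by field_simp⟩
  obtain ⟨w, rfl⟩ : ∃ w, V = Ψ * w := ⟨V / Ψ, by field_simp⟩
  rw [abs_mul, abs_of_pos hΨ] at hτ hV
  have hτ' : |τ'| ≤ e := by nlinarith
  have hw : |w| ≤ C0 := by nlinarith
  have key := alg_E (x := x) (D := y + c * x) (L := -s) (by linarith) hC0 hα he heL hB hτ' hδ hg hw
  have key2 := mul_le_mul_of_nonneg_left key hΨ.le
  have hA : 0 ≤ 2 * e * a - R + 1 / 2 * δ * a := by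
    rw [abs_le] at hR hδ
    nlinarith [mul_nonneg he ha]
  subst hN
  linarith [key2, hA]

end UCP

end

section

set_option linter.unusedSectionVars false
set_option linter.unusedSimpArgs false
namespace UCP

variable {H : Type*} [NormedAddCommGroup H] [NormedSpace ℝ H] [FiniteDimensional ℝ H]

/-- The geometric data needed for the Carleman estimate. -/
structure Geo (U : Set H) (A : H → (H →L[ℝ] ℝ) →L[ℝ] H) (σ Ψ : H → ℝ) (F : H → H)
    (K Q : ℝ) : Prop where
  isOpen : IsOpen U
  K_nonneg : 0 ≤ K
  A_C1 : ContDiffOn ℝ 1 A U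
  Ψ_C1 : ContDiffOn ℝ 1 Ψ U
  F_C1 : ContDiffOn ℝ 1 F U
  σ_C2 : ContDiffOn ℝ 2 σ U
  symm : ∀ p ∈ U, ∀ ξ η : H →L[ℝ] ℝ, ξ (A p η) = η (A p ξ)
  psd : ∀ p ∈ U, ∀ ξ : H →L[ℝ] ℝ, 0 ≤ ξ (A p ξ)
  Ψ_pos : ∀ p ∈ U, 0 < Ψ p
  Aσ : ∀ p ∈ U, A p (fderiv ℝ σ p) = Ψ p • F p
  hB : ∀ p ∈ U, |fderiv ℝ σ p (F p) - 1| ≤ K * exp (σ p)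
  hdiv : ∀ p ∈ U, |divg F p - Q| ≤ K * exp (σ p)
  hΨ : ∀ p ∈ U, |fderiv ℝ Ψ p (F p) + 2 * Ψ p| ≤ K * exp (σ p) * Ψ p
  hBF : ∀ p ∈ U, |fderiv ℝ (fun q => fderiv ℝ σ q (F q)) p (F p)| ≤ K * exp (σ p)
  hR : ∀ p ∈ U, ∀ ξ : H →L[ℝ] ℝ, |ξ (fderiv ℝ F p (A p ξ)) - 1 / 2 * ξ (fderiv ℝ A p (F p) ξ)
    - ξ (A p ξ)| ≤ K * exp (σ p) * ξ (A p ξ)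

variable {U : Set H} {A : H → (H →L[ℝ] ℝ) →L[ℝ] H} {σ Ψ : H → ℝ} {F : H → H} {K Q : ℝ}

namespace Geo

lemma dσ_C1 (G : Geo U A σ Ψ F K Q) : ContDiffOn ℝ 1 (fderiv ℝ σ) U :=
  G.σ_C2.fderiv_of_isOpen G.isOpen (by norm_num)

lemma B_C1 (G : Geo U A σ Ψ F K Q) : ContDiffOn ℝ 1 (fun q => fderiv ℝ σ q (F q)) U :=
  G.dσ_C1.clm_apply G.F_C1

lemma diffAt_A (G : Geo U A σ Ψ F K Q) {p} (hp : p ∈ U) : DifferentiableAt ℝ A p :=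
  (G.A_C1.differentiableOn one_ne_zero).differentiableAt (G.isOpen.mem_nhds hp)
lemma diffAt_Ψ (G : Geo U A σ Ψ F K Q) {p} (hp : p ∈ U) : DifferentiableAt ℝ Ψ p :=
  (G.Ψ_C1.differentiableOn one_ne_zero).differentiableAt (G.isOpen.mem_nhds hp)
lemma diffAt_F (G : Geo U A σ Ψ F K Q) {p} (hp : p ∈ U) : DifferentiableAt ℝ F p :=
  (G.F_C1.differentiableOn one_ne_zero).differentiableAt (G.isOpen.mem_nhds hp)
lemma diffAt_σ (G : Geo U A σ Ψ F K Q) {p} (hp : p ∈ U) : DifferentiableAt ℝ σ p :=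
  (G.σ_C2.differentiableOn two_ne_zero).differentiableAt (G.isOpen.mem_nhds hp)
lemma diffAt_B (G : Geo U A σ Ψ F K Q) {p} (hp : p ∈ U) :
    DifferentiableAt ℝ (fun q => fderiv ℝ σ q (F q)) p :=
  (G.B_C1.differentiableOn one_ne_zero).differentiableAt (G.isOpen.mem_nhds hp)

end Geo

/-- The gradient field `A du`. -/
def gradA (A : H → (H →L[ℝ] ℝ) →L[ℝ] H) (u : H → ℝ) (p : H) : H := A p (fderiv ℝ u p)

lemma Geo.gradA_C1 (G : Geo U A σ Ψ F K Q) {u : H → ℝ} (hu : ContDiffOn ℝ 2 u U) :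
    ContDiffOn ℝ 1 (gradA A u) U :=
  G.A_C1.clm_apply (hu.fderiv_of_isOpen G.isOpen (by norm_num))

/-- The conjugated function. -/
def conj (α : ℝ) (σ u : H → ℝ) (p : H) : ℝ := exp (α * σ p ^ 2) * u p

lemma Geo.conj_C2 (G : Geo U A σ Ψ F K Q) {u : H → ℝ} (hu : ContDiffOn ℝ 2 u U) (α : ℝ) :
    ContDiffOn ℝ 2 (conj α σ u) U :=
  ((contDiffOn_const.mul (G.σ_C2.pow 2)).exp).mul hu

lemma Geo.fderiv_conj (G : Geo U A σ Ψ F K Q) {u : H → ℝ} (hu : ContDiffOn ℝ 2 u U) (α : ℝ)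
    {p : H} (hp : p ∈ U) : fderiv ℝ (conj α σ u) p =
      exp (α * σ p ^ 2) • fderiv ℝ u p + (2 * α * σ p * conj α σ u p) • fderiv ℝ σ p := by
  have h1 := (G.diffAt_σ hp).hasFDerivAt
  have h2 := ((hu.differentiableOn two_ne_zero).differentiableAt (G.isOpen.mem_nhds hp)).hasFDerivAt
  have h3 := (((h1.pow 2).const_mul α).exp).mul h2
  have : conj α σ u = fun y => rexp (α * σ y ^ 2) * u y := rfl
  rw [this]
  refine h3.fderiv.trans ?_
  ext w
  simp [conj]
  ring

lemma Geo.gradA_conj (G : Geo U A σ Ψ F K Q) {u : H → ℝ} (hu : ContDiffOn ℝ 2 u U) (α : ℝ)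
    {p : H} (hp : p ∈ U) : gradA A (conj α σ u) p =
      exp (α * σ p ^ 2) • gradA A u p + (2 * α * σ p * conj α σ u p * Ψ p) • F p := by
  rw [gradA, G.fderiv_conj hu α hp, map_add, map_smul, map_smul, G.Aσ p hp, smul_smul]; rfl

lemma Geo.divg_conj (G : Geo U A σ Ψ F K Q) {u V : H → ℝ} (hu : ContDiffOn ℝ 2 u U) (α : ℝ)
    (heq : ∀ p ∈ U, divg (gradA A u) p = V p * u p)
    {p : H} (hp : p ∈ U) : divg (gradA A (conj α σ u)) p =
      V p * conj α σ u p + 2 * (2 * α * σ p) * Ψ p * fderiv ℝ (conj α σ u) p (F p)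
      + 2 * α * fderiv ℝ σ p (F p) * conj α σ u p * Ψ p
      + (2 * α * σ p) * conj α σ u p * (fderiv ℝ Ψ p (F p) + Ψ p * divg F p)
      - (2 * α * σ p) ^ 2 * conj α σ u p * Ψ p * fderiv ℝ σ p (F p) := by
  have hn := G.isOpen.mem_nhds hp
  have h1 := (G.diffAt_σ hp).hasFDerivAt
  have hv := ((G.conj_C2 hu α).differentiableOn two_ne_zero).differentiableAt hn |>.hasFDerivAt
  have hΨ := (G.diffAt_Ψ hp).hasFDerivAt
  have he := ((h1.pow 2).const_mul α).exp
  have hf := ((h1.const_mul (2 * α)).mul hv).mul hΨ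
  have hgu := ((G.gradA_C1 hu).differentiableOn one_ne_zero).differentiableAt hn
  have hF := G.diffAt_F hp
  have hc : gradA A (conj α σ u) =ᶠ[nhds p] fun q =>
      exp (α * σ q ^ 2) • gradA A u q + (2 * α * σ q * conj α σ u q * Ψ q) • F q := by
    filter_upwards [hn] with q hq using G.gradA_conj hu α hq
  have e1 := divg_smul he.differentiableAt hgu
  have e2 := divg_smul hf.differentiableAt hF
  rw [he.fderiv] at e1
  rw [hf.fderiv] at e2
  have e0 : divg (fun q => exp (α * σ q ^ 2) • gradA A u q
      + (2 * α * σ q * conj α σ u q * Ψ q) • F q) p = _ :=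
    (divg_add (he.differentiableAt.smul hgu) (hf.differentiableAt.smul hF)).trans
      (congrArg₂ (fun x y : ℝ => x + y) e1 e2)
  rw [divg_congr hc, e0]
  have e3 : fderiv ℝ σ p (gradA A u p) = Ψ p * fderiv ℝ u p (F p) := by
    rw [gradA, G.symm p hp, G.Aσ p hp, map_smul, smul_eq_mul]
  have e4 := congrArg (fun T : H →L[ℝ] ℝ => T (F p)) (G.fderiv_conj hu α hp)
  rw [heq p hp]
  simp [e3] at e4 ⊢
  rw [show V p * conj α σ u p = exp (α * σ p ^ 2) * V p * u p by unfold conj; ring]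
  linear_combination (-2 * α * σ p * Ψ p) * e4

/-- The Carleman field. -/
def carF (A : H → (H →L[ℝ] ℝ) →L[ℝ] H) (σ Ψ : H → ℝ) (F : H → H) (K c α : ℝ) (v : H → ℝ)
    (p : H) : H :=
  (2 * (K * exp (σ p)) * v p - fderiv ℝ v p (F p) - c * v p) • gradA A v p +
  (1 / 2 * fderiv ℝ v p (gradA A v p) - 1 / 2 * (2 * α * σ p) ^ 2 * Ψ p * fderiv ℝ σ p (F p) * v p ^ 2
    - 2 * (K * exp (σ p)) * (2 * α * σ p) * Ψ p * v p ^ 2) • F p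

lemma Geo.carF_C1 (G : Geo U A σ Ψ F K Q) {v : H → ℝ} (hv : ContDiffOn ℝ 2 v U) (c α : ℝ) :
    ContDiffOn ℝ 1 (carF A σ Ψ F K c α v) U := by
  have h1 := G.gradA_C1 hv
  have h2 : ContDiffOn ℝ 1 (fderiv ℝ v) U := hv.fderiv_of_isOpen G.isOpen (by norm_num)
  have h3 := G.F_C1
  have h4 := G.Ψ_C1
  have h5 := G.B_C1
  have h6 : ContDiffOn ℝ 1 σ U := G.σ_C2.of_le (by norm_num)
  have h7 : ContDiffOn ℝ 1 v U := hv.of_le (by norm_num)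
  have h8 := h2.clm_apply h3
  have h9 := h2.clm_apply h1
  unfold carF
  fun_prop

set_option maxHeartbeats 1000000 in
/-- Pointwise lower bound for the divergence of the Carleman field. -/
lemma Geo.divg_carF (G : Geo U A σ Ψ F K Q) {u V : H → ℝ} (hu : ContDiffOn ℝ 2 u U) {α c C0 : ℝ}
    (heq : ∀ p ∈ U, divg (gradA A u) p = V p * u p) (hC0 : 0 ≤ C0)
    (hV : ∀ p ∈ U, |V p| ≤ C0 * Ψ p) (hc : Q = 2 * c + 2) (hα : 10 * (C0 + |c| + 1) ≤ α)
    {p : H} (hp : p ∈ U) (hs : σ p ≤ -1) (hK : K * exp (σ p) * (-σ p) ≤ 1 / 200) :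
    α ^ 2 * (-σ p) * Ψ p * conj α σ u p ^ 2 ≤ divg (carF A σ Ψ F K c α (conj α σ u)) p := by
  have hn := G.isOpen.mem_nhds hp
  have hv2 := G.conj_C2 hu α
  have hN := G.divg_conj hu α heq hp
  set v := conj α σ u with hv
  have dσ := (G.diffAt_σ hp).hasFDerivAt
  have dv := (hv2.differentiableOn two_ne_zero).differentiableAt hn |>.hasFDerivAt
  have dΨ := (G.diffAt_Ψ hp).hasFDerivAt
  have dB := (G.diffAt_B hp).hasFDerivAt
  have dF := (G.diffAt_F hp).hasFDerivAt
  have dA := (G.diffAt_A hp).hasFDerivAt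
  have hfv : ContDiffOn ℝ 1 (fderiv ℝ v) U := hv2.fderiv_of_isOpen G.isOpen (by norm_num)
  have dfv := (hfv.differentiableOn one_ne_zero).differentiableAt hn |>.hasFDerivAt
  have dg : HasFDerivAt (gradA A v) _ p := dA.clm_apply dfv
  have dFv := dfv.clm_apply dF
  have da := dfv.clm_apply dg
  have de := (dσ.exp).const_mul K
  have sym : ∀ w w', fderiv ℝ (fderiv ℝ v) p w w' = fderiv ℝ (fderiv ℝ v) p w' w := by
    have h := (hv2.contDiffAt hn).isSymmSndFDerivAt (by simp)
    exact fun w w' => h w w'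
  have df1 := (((de.const_mul 2).mul dv).sub dFv).sub (dv.const_mul c)
  have df3 := ((da.const_mul (1/2)).sub (((((dσ.const_mul (2 * α)).pow 2).const_mul (1/2)).mul dΨ).mul dB |>.mul
    (dv.pow 2))).sub ((((de.const_mul 2).mul (dσ.const_mul (2 * α))).mul dΨ).mul (dv.pow 2))
  have e1 := divg_smul df1.differentiableAt dg.differentiableAt
  have e2 := divg_smul df3.differentiableAt dF.differentiableAt
  rw [df1.fderiv] at e1
  rw [df3.fderiv] at e2
  have e0 : divg (carF A σ Ψ F K c α v) p = _ :=
    (divg_add (df1.differentiableAt.smul dg.differentiableAt)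
      (df3.differentiableAt.smul dF.differentiableAt)).trans
      (congrArg₂ (fun x y : ℝ => x + y) e1 e2)
  have ΨFv : fderiv ℝ σ p (gradA A v p) = Ψ p * fderiv ℝ v p (F p) := by
    rw [gradA, G.symm p hp, G.Aσ p hp, map_smul, smul_eq_mul]
  have s1 := sym (F p) (A p (fderiv ℝ v p))
  have s2 := G.symm p hp (fderiv ℝ v p) (fderiv ℝ (fderiv ℝ v) p (F p))
  have key := alg_div (c := c) (C0 := C0) (α := α) (s := σ p) (e := K * exp (σ p))
    (B := fderiv ℝ σ p (F p)) (τ := fderiv ℝ Ψ p (F p) + 2 * Ψ p) (δ := divg F p - Q)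
    (g := fderiv ℝ (fun q => fderiv ℝ σ q (F q)) p (F p)) (V := V p) (x := v p)
    (y := fderiv ℝ v p (F p)) (a := fderiv ℝ v p (gradA A v p))
    (R := fderiv ℝ v p (fderiv ℝ F p (A p (fderiv ℝ v p)))
      - 1 / 2 * fderiv ℝ v p (fderiv ℝ A p (F p) (fderiv ℝ v p)) - fderiv ℝ v p (A p (fderiv ℝ v p)))
    (Ψ := Ψ p) (daF := 2 * fderiv ℝ (fderiv ℝ v) p (F p) (A p (fderiv ℝ v p)) +
      fderiv ℝ v p (fderiv ℝ A p (F p) (fderiv ℝ v p)))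
    (Nv := divg (gradA A v) p) hs hC0 hα
    (mul_nonneg G.K_nonneg (exp_pos _).le) hK (G.Ψ_pos p hp) (G.psd p hp _)
    (G.hB p hp) (G.hΨ p hp) (G.hdiv p hp) (G.hBF p hp) (hV p hp) (G.hR p hp _)
    (by rw [hN, hc]; ring)
  refine key.trans (le_of_eq ?_)
  rw [e0]
  simp
  simp only [gradA] at ΨFv ⊢
  rw [ΨFv, s1, s2, hc]
  rw [s1]
  ring

end UCP

end

section

set_option linter.unusedSectionVars false
set_option linter.unusedSimpArgs false
namespace UCP

variable {H : Type*} [NormedAddCommGroup H] [NormedSpace ℝ H] [FiniteDimensional ℝ H]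
variable {U : Set H} {A : H → (H →L[ℝ] ℝ) →L[ℝ] H} {σ Ψ : H → ℝ} {F : H → H} {K Q : ℝ}

/-- Cauchy-Schwarz for the form. -/
lemma Geo.cs (G : Geo U A σ Ψ F K Q) {p : H} (hp : p ∈ U) (ξ η : H →L[ℝ] ℝ) :
    ξ (A p η) ^ 2 ≤ ξ (A p ξ) * η (A p η) := by
  have h : ∀ t : ℝ, 0 ≤ η (A p η) * (t * t) + (2 * ξ (A p η)) * t + ξ (A p ξ) := by
    intro t
    have := G.psd p hp (ξ + t • η)
    simp only [map_add, map_smul, add_apply, smul_apply,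
      smul_eq_mul] at this
    rw [G.symm p hp η ξ] at this
    linarith
  have := discrim_le_zero h
  rw [discrim] at this
  linarith

lemma Geo.F_sq (G : Geo U A σ Ψ F K Q) {p : H} (hp : p ∈ U) (ξ : H →L[ℝ] ℝ) :
    Ψ p * ξ (F p) ^ 2 ≤ fderiv ℝ σ p (F p) * ξ (A p ξ) := by
  have h := G.cs hp ξ (fderiv ℝ σ p)
  rw [G.Aσ p hp] at h
  simp only [map_smul, smul_eq_mul] at h
  have hΨ := G.Ψ_pos p hp
  have : Ψ p * (Ψ p * ξ (F p) ^ 2) ≤ Ψ p * (fderiv ℝ σ p (F p) * ξ (A p ξ)) := by nlinarith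
  exact le_of_mul_le_mul_left this hΨ

lemma alg_bounds {Ψ E P B e c x y u a au : ℝ} (hΨ : 0 < Ψ) (hE : 0 < E) (hx : x = E * u)
    (hau : 0 ≤ au) (hB : |B - 1| ≤ e) (he0 : 0 ≤ e) (he : e ≤ 1 / 200) (hy : Ψ * y ^ 2 ≤ B * a)
    (ha0 : 0 ≤ a) (ha : a ≤ 2 * E ^ 2 * (au + P ^ 2 * (Ψ * B) * u ^ 2)) :
    |1 / 2 * a - 1 / 2 * P ^ 2 * Ψ * B * x ^ 2 - 2 * e * P * Ψ * x ^ 2|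
      ≤ 20 * ((1 + P ^ 2) * E ^ 2 * (au + Ψ * u ^ 2)) ∧
    |(2 * e * x - y - c * x) * P * x * Ψ| ≤
      25 * (1 + |c|) * ((1 + P ^ 2) * E ^ 2 * (au + Ψ * u ^ 2)) ∧
    |(2 * e * x - y - c * x) * Ψ * y| ≤
      50 * (1 + |c|) * ((1 + P ^ 2) * E ^ 2 * (au + Ψ * u ^ 2)) := by
  set T := (1 + P ^ 2) * E ^ 2 * (au + Ψ * u ^ 2) with hT
  have hB' := abs_le.1 hB
  have hB1 : 0 ≤ B := by linarith
  have hB2 : B ≤ 2 := by linarith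
  have q1 : 0 ≤ E ^ 2 * au := by positivity
  have q2 : 0 ≤ E ^ 2 * (Ψ * u ^ 2) := by positivity
  have q3 : 0 ≤ P ^ 2 * (E ^ 2 * au) := by positivity
  have q4 : 0 ≤ P ^ 2 * (E ^ 2 * (Ψ * u ^ 2)) := by positivity
  have hTe : T = E ^ 2 * au + E ^ 2 * (Ψ * u ^ 2) + P ^ 2 * (E ^ 2 * au)
      + P ^ 2 * (E ^ 2 * (Ψ * u ^ 2)) := by rw [hT]; ring
  have hT0 : 0 ≤ T := by linarith
  have x1 : Ψ * x ^ 2 = E ^ 2 * (Ψ * u ^ 2) := by rw [hx]; ring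
  have x2 : Ψ * x ^ 2 ≤ T := by linarith
  have x0 : 0 ≤ Ψ * x ^ 2 := by positivity
  have x3 : P ^ 2 * (Ψ * x ^ 2) ≤ T := by rw [x1]; linarith
  have x30 : 0 ≤ P ^ 2 * (Ψ * x ^ 2) := by positivity
  have a1 : a ≤ 4 * T := by
    have e1 : B * (P ^ 2 * (E ^ 2 * (Ψ * u ^ 2))) ≤ 2 * (P ^ 2 * (E ^ 2 * (Ψ * u ^ 2))) :=
      mul_le_mul_of_nonneg_right hB2 q4
    linarith
  have y1 : Ψ * y ^ 2 ≤ 8 * T := by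
    have : B * a ≤ 2 * a := mul_le_mul_of_nonneg_right hB2 ha0
    linarith
  have y0 : 0 ≤ Ψ * y ^ 2 := by positivity
  have hΨP : |P| * (Ψ * x ^ 2) ≤ T := by
    have : |P| ≤ (1 + P ^ 2) / 2 := by
      rw [← sq_abs P]; nlinarith [sq_nonneg (|P| - 1)]
    have := mul_le_mul_of_nonneg_right this x0
    linarith
  have hΨP0 : 0 ≤ |P| * (Ψ * x ^ 2) := by positivity
  have hxy : |x| * |y| * Ψ ≤ 5 * T := by
    have : 2 * (|x| * |y|) ≤ x ^ 2 + y ^ 2 := by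
      rw [← sq_abs x, ← sq_abs y]; nlinarith [sq_nonneg (|x| - |y|)]
    have := mul_le_mul_of_nonneg_right this hΨ.le
    linarith
  have hPxy : |P| * |x| * |y| * Ψ ≤ 5 * T := by
    have : 2 * (|P| * |x| * |y|) ≤ P ^ 2 * x ^ 2 + y ^ 2 := by
      rw [← sq_abs x, ← sq_abs y, ← sq_abs P]; nlinarith [sq_nonneg (|P| * |x| - |y|)]
    have := mul_le_mul_of_nonneg_right this hΨ.le
    linarith
  have hc := abs_nonneg c
  have hce : |2 * e - c| ≤ 1 + |c| := by
    have := abs_sub (2 * e) c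
    rw [abs_of_nonneg (by linarith : 0 ≤ 2 * e)] at this
    linarith
  refine ⟨?_, ?_, ?_⟩
  · have e1 : |2 * e * P * Ψ * x ^ 2| ≤ T := by
      rw [show 2 * e * P * Ψ * x ^ 2 = (2 * e) * (P * (Ψ * x ^ 2)) by ring, abs_mul, abs_mul P,
        abs_of_nonneg x0, abs_of_nonneg (by linarith : 0 ≤ 2 * e)]
      have := mul_le_mul (by linarith : 2 * e ≤ 1) hΨP hΨP0 zero_le_one
      linarith
    have e2 : P ^ 2 * Ψ * B * x ^ 2 ≤ 2 * T := by
      have := mul_le_mul_of_nonneg_right hB2 x30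
      linarith
    have e3 : 0 ≤ P ^ 2 * Ψ * B * x ^ 2 := by positivity
    rw [abs_le] at e1 ⊢
    constructor <;> linarith
  · have e1 : |(2 * e * x - y - c * x) * P * x * Ψ| ≤
        |2 * e - c| * (|P| * (Ψ * x ^ 2)) + |P| * |x| * |y| * Ψ := by
      rw [show (2 * e * x - y - c * x) * P * x * Ψ = (2 * e - c) * (P * (Ψ * x ^ 2))
        - P * x * y * Ψ by ring]
      refine (abs_sub _ _).trans (le_of_eq ?_)
      rw [abs_mul, abs_mul P, abs_of_nonneg x0, abs_mul (P * x * y), abs_mul (P * x), abs_mul P x,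
        abs_of_pos hΨ]
    have e2 := mul_le_mul hce hΨP hΨP0 (by linarith)
    have := mul_nonneg hc hT0
    linarith
  · have e1 : |(2 * e * x - y - c * x) * Ψ * y| ≤ |2 * e - c| * (|x| * |y| * Ψ) + Ψ * y ^ 2 := by
      rw [show (2 * e * x - y - c * x) * Ψ * y = (2 * e - c) * (x * y * Ψ) - Ψ * y ^ 2 by ring]
      refine (abs_sub _ _).trans (le_of_eq ?_)
      rw [abs_mul, abs_of_nonneg y0, abs_mul (x * y), abs_mul x, abs_of_pos hΨ]
    have e2 := mul_le_mul hce hxy (by positivity) (by linarith)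
    have := mul_nonneg hc hT0
    linarith

/-- energy density -/
def enA (A : H → (H →L[ℝ] ℝ) →L[ℝ] H) (u : H → ℝ) (p : H) : ℝ := fderiv ℝ u p (gradA A u p)

/-- the dominating density in the Carleman estimate -/
def domT (A : H → (H →L[ℝ] ℝ) →L[ℝ] H) (σ Ψ : H → ℝ) (α : ℝ) (u : H → ℝ) (p : H) : ℝ :=
  (1 + (2 * α * σ p) ^ 2) * exp (α * σ p ^ 2) ^ 2 * (enA A u p + Ψ p * u p ^ 2)

lemma Geo.en_conj (G : Geo U A σ Ψ F K Q) {u : H → ℝ} (hu : ContDiffOn ℝ 2 u U) (α : ℝ)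
    {p : H} (hp : p ∈ U) : enA A (conj α σ u) p ≤ 2 * exp (α * σ p ^ 2) ^ 2 *
      (enA A u p + (2 * α * σ p) ^ 2 * (Ψ p * fderiv ℝ σ p (F p)) * u p ^ 2) := by
  set E := exp (α * σ p ^ 2)
  have h := G.psd p hp (fderiv ℝ u p - (2 * α * σ p * u p) • fderiv ℝ σ p)
  rw [enA, G.gradA_conj hu α hp, G.fderiv_conj hu α hp]
  have e3 : fderiv ℝ σ p (gradA A u p) = Ψ p * fderiv ℝ u p (F p) := by
    rw [gradA, G.symm p hp, G.Aσ p hp, map_smul, smul_eq_mul]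
  simp only [map_sub, map_smul, G.Aσ p hp] at h
  change 0 ≤ (fderiv ℝ u p - (2 * α * σ p * u p) • fderiv ℝ σ p) (gradA A u p) - _ at h
  have hc : conj α σ u p = E * u p := rfl
  simp [e3, enA, hc] at h ⊢
  have hE : 0 ≤ E ^ 2 := by positivity
  have h2 := mul_le_mul_of_nonneg_left h hE
  linarith

lemma Geo.car_bounds (G : Geo U A σ Ψ F K Q) {u : H → ℝ} (hu : ContDiffOn ℝ 2 u U) (α c : ℝ)
    {p : H} (hp : p ∈ U) (he : K * exp (σ p) ≤ 1 / 200) :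
    let v := conj α σ u
    let f1 := 2 * (K * exp (σ p)) * v p - fderiv ℝ v p (F p) - c * v p
    let f3 := 1 / 2 * fderiv ℝ v p (gradA A v p)
      - 1 / 2 * (2 * α * σ p) ^ 2 * Ψ p * fderiv ℝ σ p (F p) * v p ^ 2
      - 2 * (K * exp (σ p)) * (2 * α * σ p) * Ψ p * v p ^ 2
    |f3| ≤ 20 * domT A σ Ψ α u p ∧
    |f1 * (2 * α * σ p) * v p * Ψ p| ≤ 25 * (1 + |c|) * domT A σ Ψ α u p ∧
    |f1 * Ψ p * fderiv ℝ v p (F p)| ≤ 50 * (1 + |c|) * domT A σ Ψ α u p :=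
  alg_bounds (G.Ψ_pos p hp) (exp_pos _) rfl (G.psd p hp _) (G.hB p hp)
    (mul_nonneg G.K_nonneg (exp_pos _).le) he (G.F_sq hp _) (G.psd p hp _) (G.en_conj hu α hp)

lemma Geo.carF_dσ (G : Geo U A σ Ψ F K Q) {u : H → ℝ} (hu : ContDiffOn ℝ 2 u U) (α c : ℝ)
    {p : H} (hp : p ∈ U) (he : K * exp (σ p) ≤ 1 / 200) :
    |fderiv ℝ σ p (carF A σ Ψ F K c α (conj α σ u) p)| ≤ 100 * (1 + |c|) * domT A σ Ψ α u p := by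
  obtain ⟨h1, h2, h3⟩ := G.car_bounds hu α c hp he
  have hT : 0 ≤ domT A σ Ψ α u p := by linarith [abs_nonneg (1 / 2 * fderiv ℝ (conj α σ u) p (gradA A (conj α σ u) p)
      - 1 / 2 * (2 * α * σ p) ^ 2 * Ψ p * fderiv ℝ σ p (F p) * conj α σ u p ^ 2
      - 2 * (K * exp (σ p)) * (2 * α * σ p) * Ψ p * conj α σ u p ^ 2)]
  have e3 : fderiv ℝ σ p (gradA A (conj α σ u) p) = Ψ p * fderiv ℝ (conj α σ u) p (F p) := by
    rw [gradA, G.symm p hp, G.Aσ p hp, map_smul, smul_eq_mul]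
  rw [carF, map_add, map_smul, map_smul, e3, smul_eq_mul, smul_eq_mul]
  refine (abs_add_le _ _).trans ?_
  rw [← mul_assoc, abs_mul (_ - _ - _) (fderiv ℝ σ p (F p))]
  have hB := abs_le.1 (G.hB p hp)
  have hB2 : |fderiv ℝ σ p (F p)| ≤ 2 := by rw [abs_le]; constructor <;> linarith
  have h4 := mul_le_mul h1 hB2 (abs_nonneg _) (by linarith)
  have := mul_nonneg (abs_nonneg c) hT
  linarith

end UCP

end

section

set_option linter.unusedSectionVars false
set_option linter.unusedSimpArgs false
namespace UCP

variable {H : Type*} [NormedAddCommGroup H] [NormedSpace ℝ H] [FiniteDimensional ℝ H]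
variable [MeasurableSpace H] [BorelSpace H] {μ : Measure H} [μ.IsAddHaarMeasure]
variable {U : Set H} {A : H → (H →L[ℝ] ℝ) →L[ℝ] H} {σ Ψ : H → ℝ} {F : H → H} {K Q : ℝ}
variable {u : H → ℝ} {χ : ℕ → H → ℝ} {S1 : ℝ}

lemma int_add3 {f g h : H → ℝ} (hf : IntegrableOn f U μ) (hg : IntegrableOn g U μ)
    (hh : IntegrableOn h U μ) : ∫ p in U, f p + g p + h p ∂μ =
      (∫ p in U, f p ∂μ) + (∫ p in U, g p ∂μ) + ∫ p in U, h p ∂μ := by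
  have e1 := integral_add (hf.add hg) hh
  have e2 := integral_add hf hg
  exact e1.trans (by rw [← e2]; rfl)

/-- level shells -/
def shell (U : Set H) (σ : H → ℝ) (a b : ℝ) : Set H := U ∩ {p | a ≤ σ p ∧ σ p ≤ b}

lemma meas_shell (hU : IsOpen U) (hσ : ContinuousOn σ U) (a b : ℝ) :
    MeasurableSet (shell U σ a b) := by
  have h : shell U σ a b = U \ (U ∩ σ ⁻¹' (Icc a b)ᶜ) := by
    ext p; simp only [shell, mem_inter_iff, mem_ofPred_eq, Set.mem_sdiff, mem_preimage, mem_compl_iff, mem_Icc]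
    tauto
  rw [h]
  exact hU.measurableSet.diff
    (hσ.isOpen_inter_preimage hU isClosed_Icc.isOpen_compl).measurableSet

/-- Data for cutting off near the degenerate set. -/
structure Cut (μ : Measure H) (U : Set H) (A : H → (H →L[ℝ] ℝ) →L[ℝ] H) (σ Ψ : H → ℝ) (F : H → H)
    (u : H → ℝ) (χ : ℕ → H → ℝ) (S1 : ℝ) : Prop where
  C1 : ∀ n, ContDiffOn ℝ 1 (χ n) U
  nonneg : ∀ n, ∀ p ∈ U, 0 ≤ χ n p
  le_one : ∀ n, ∀ p ∈ U, χ n p ≤ 1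
  lim : ∀ p ∈ U, ∀ᶠ n in atTop, χ n p = 1 ∧ fderiv ℝ (χ n) p = 0
  compact : ∀ n, ∀ s S : ℝ, S < S1 → ∃ C, IsCompact C ∧ C ⊆ U ∧ ∀ p ∈ U, s ≤ σ p → σ p ≤ S →
    p ∉ C → χ n p = 0 ∧ fderiv ℝ (χ n) p = 0
  bdd : ∀ s S : ℝ, S < S1 → ∃ M : ℝ, ∀ p ∈ U, s ≤ σ p → σ p ≤ S → Ψ p ≤ M ∧ enA A u p ≤ M ∧
    ∀ n, |fderiv ℝ (χ n) p (F p)| ≤ M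
  fin : ∀ s S : ℝ, S < S1 → μ (shell U σ s S) < ⊤
  jump1 : ∀ q : ℝ → ℝ, ContDiff ℝ 1 q → (∃ s S, S < S1 ∧ ∀ x, q x ≠ 0 → s ≤ x ∧ x ≤ S) →
    Tendsto (fun n => ∫ p in U, q (σ p) * u p * fderiv ℝ (χ n) p (gradA A u p) ∂μ) atTop (nhds 0)
  jump2 : ∀ q : ℝ → ℝ, ContDiff ℝ 1 q → (∃ s S, S < S1 ∧ ∀ x, q x ≠ 0 → s ≤ x ∧ x ≤ S) →
    Tendsto (fun n => ∫ p in U, q (σ p) * fderiv ℝ u p (F p) * fderiv ℝ (χ n) p (gradA A u p) ∂μ)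
      atTop (nhds 0)
  jump3 : ∀ q : ℝ → ℝ, ContDiff ℝ 1 q → (∃ s S, S < S1 ∧ ∀ x, q x ≠ 0 → s ≤ x ∧ x ≤ S) →
    Tendsto (fun n => ∫ p in U, q (σ p) * (fderiv ℝ σ p (F p) * u p)
      * fderiv ℝ (χ n) p (gradA A u p) ∂μ) atTop (nhds 0)

namespace Cut

lemma integrable (C : Cut μ U A σ Ψ F u χ S1) (G : Geo U A σ Ψ F K Q) {f : H → ℝ}
    (hf : ContinuousOn f U) {a b M : ℝ} (hb : b < S1)
    (h0 : ∀ p ∈ U, f p ≠ 0 → a ≤ σ p ∧ σ p ≤ b) (hM : ∀ p ∈ U, a ≤ σ p → σ p ≤ b → |f p| ≤ M) :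
    IntegrableOn f U μ := by
  have hσ := G.σ_C2.continuousOn
  have hm := meas_shell G.isOpen hσ a b
  have h1 : IntegrableOn f (shell U σ a b) μ := by
    refine IntegrableOn.of_bound (C.fin a b hb) ?_ M ?_
    · exact (hf.mono inter_subset_left).aestronglyMeasurable hm
    · refine (ae_restrict_iff' hm).2 (Eventually.of_forall fun p hp => ?_)
      exact hM p hp.1 hp.2.1 hp.2.2
  refine h1.of_forall_sdiff_eq_zero G.isOpen.measurableSet ?_
  intro p hp
  by_contra hne
  exact hp.2 ⟨hp.1, h0 p hp.1 hne⟩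

lemma integrable' (C : Cut μ U A σ Ψ F u χ S1) (G : Geo U A σ Ψ F K Q) {f : H → ℝ}
    (hf : ContinuousOn f U) {a b : ℝ} (hb : b < S1) (n : ℕ)
    (h0 : ∀ p ∈ U, f p ≠ 0 → a ≤ σ p ∧ σ p ≤ b)
    (h1 : ∀ p ∈ U, χ n p = 0 → fderiv ℝ (χ n) p = 0 → f p = 0) :
    IntegrableOn f U μ := by
  obtain ⟨S, hS, hSU, h⟩ := C.compact n a b hb
  refine integrableOn_of_compact μ G.isOpen hS hSU ?_ hf
  intro p hp hpS
  by_contra hne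
  obtain ⟨h2, h3⟩ := h0 p hp hne
  obtain ⟨h4, h5⟩ := h p hp h2 h3 hpS
  exact hne (h1 p hp h4 h5)

/-- Dominated convergence for the cutoffs. -/
lemma tendsto_mul (C : Cut μ U A σ Ψ F u χ S1) (G : Geo U A σ Ψ F K Q) {f : H → ℝ}
    (hc : ContinuousOn f U) (hf : IntegrableOn f U μ) :
    Tendsto (fun n => ∫ p in U, χ n p * f p ∂μ) atTop (nhds (∫ p in U, f p ∂μ)) := by
  refine tendsto_integral_of_dominated_convergence (fun p => |f p|) ?_ hf.abs ?_ ?_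
  · intro n
    exact ((C.C1 n).continuousOn.mul hc).aestronglyMeasurable G.isOpen.measurableSet
  · intro n
    refine (ae_restrict_iff' G.isOpen.measurableSet).2 (Eventually.of_forall fun p hp => ?_)
    rw [norm_mul, norm_eq_abs, norm_eq_abs, abs_of_nonneg (C.nonneg n p hp)]
    exact mul_le_of_le_one_left (abs_nonneg _) (C.le_one n p hp)
  · refine (ae_restrict_iff' G.isOpen.measurableSet).2 (Eventually.of_forall fun p hp => ?_)
    refine tendsto_const_nhds.congr' ?_
    filter_upwards [C.lim p hp] with n hn
    rw [hn.1, one_mul]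

lemma fderiv_cont (C : Cut μ U A σ Ψ F u χ S1) (G : Geo U A σ Ψ F K Q) (n : ℕ) :
    ContinuousOn (fderiv ℝ (χ n)) U :=
  (C.C1 n).continuousOn_fderiv_of_isOpen G.isOpen le_rfl

/-- The terms with `F χ` go to zero. -/
lemma tendsto_Fχ (C : Cut μ U A σ Ψ F u χ S1) (G : Geo U A σ Ψ F K Q) {f : H → ℝ}
    (hc : ContinuousOn f U) {a b M : ℝ} (hb : b < S1)
    (h0 : ∀ p ∈ U, f p ≠ 0 → a ≤ σ p ∧ σ p ≤ b) (hM : ∀ p ∈ U, a ≤ σ p → σ p ≤ b → |f p| ≤ M) :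
    Tendsto (fun n => ∫ p in U, f p * fderiv ℝ (χ n) p (F p) ∂μ) atTop (nhds 0) := by
  have hf := C.integrable G hc hb h0 hM
  obtain ⟨N, hN⟩ := C.bdd a b hb
  have : Tendsto (fun n => ∫ p in U, f p * fderiv ℝ (χ n) p (F p) ∂μ) atTop
      (nhds (∫ p in U, (0:ℝ) ∂μ)) := by
    refine tendsto_integral_of_dominated_convergence (fun p => |f p| * N) ?_ (hf.abs.mul_const N)
      ?_ ?_
    · intro n
      exact (hc.mul ((C.fderiv_cont G n).clm_apply G.F_C1.continuousOn)).aestronglyMeasurable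
        G.isOpen.measurableSet
    · intro n
      refine (ae_restrict_iff' G.isOpen.measurableSet).2 (Eventually.of_forall fun p hp => ?_)
      by_cases hfp : f p = 0
      · simp [hfp]
      · obtain ⟨h1, h2⟩ := h0 p hp hfp
        rw [norm_mul, norm_eq_abs, norm_eq_abs]
        exact mul_le_mul_of_nonneg_left ((hN p hp h1 h2).2.2 n) (abs_nonneg _)
    · refine (ae_restrict_iff' G.isOpen.measurableSet).2 (Eventually.of_forall fun p hp => ?_)
      refine tendsto_const_nhds.congr' ?_
      filter_upwards [C.lim p hp] with n hn
      simp [hn.2]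
  simpa using this

/-- Integration by parts with cutoffs, limiting form. -/
lemma flux (C : Cut μ U A σ Ψ F u χ S1) (G : Geo U A σ Ψ F K Q) {W : H → H}
    (hW : ContDiffOn ℝ 1 W U) {q : ℝ → ℝ} (hq : ContDiff ℝ 1 q) {s S : ℝ} (hS : S < S1)
    (hqs : ∀ x, q x ≠ 0 → s ≤ x ∧ x ≤ S) {f g : H → ℝ} (hfc : ContinuousOn f U)
    (hgc : ContinuousOn g U) (hfi : IntegrableOn f U μ)
    (hgi : IntegrableOn g U μ)
    (hf : ∀ p ∈ U, f p ≤ q (σ p) * divg W p)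
    (hg : ∀ p ∈ U, -(deriv q (σ p) * fderiv ℝ σ p (W p)) ≤ g p)
    (hJ : Tendsto (fun n => ∫ p in U, q (σ p) * fderiv ℝ (χ n) p (W p) ∂μ) atTop (nhds 0)) :
    ∫ p in U, f p ∂μ ≤ ∫ p in U, g p ∂μ := by
  have hσ1 : ContDiffOn ℝ 1 σ U := G.σ_C2.of_le (by norm_num)
  have hdq : ∀ x, deriv q x ≠ 0 → s ≤ x ∧ x ≤ S := by
    intro x hx
    by_contra hcon
    apply hx
    have : (Icc s S)ᶜ ∈ nhds x := isClosed_Icc.isOpen_compl.mem_nhds hcon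
    have : q =ᶠ[nhds x] fun _ => 0 := by
      filter_upwards [this] with y hy
      by_contra h; exact hy (hqs y h)
    rw [this.deriv_eq]; simp
  have hqσ : ContDiffOn ℝ 1 (fun p => q (σ p)) U := hq.comp_contDiffOn hσ1
  have hq'σ : ContinuousOn (fun p => deriv q (σ p)) U :=
    (hq.continuous_deriv le_rfl).comp_continuousOn hσ1.continuousOn
  have hσ' : ContinuousOn (fderiv ℝ σ) U := G.dσ_C1.continuousOn
  have hWc := hW.continuousOn
  have hdW : ContinuousOn (divg W) U := continuousOn_divg G.isOpen hW
  have key : ∀ n, ∫ p in U, χ n p * f p ∂μ ≤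
      (∫ p in U, χ n p * g p ∂μ) - ∫ p in U, q (σ p) * fderiv ℝ (χ n) p (W p) ∂μ := by
    intro n
    have hχc := (C.C1 n).continuousOn
    have i1 : IntegrableOn (fun p => χ n p * (q (σ p) * divg W p)) U μ := by
      refine C.integrable' G (a := s) (hχc.mul (hqσ.continuousOn.mul hdW)) hS n ?_ ?_
      · intro p _ h
        exact hqs _ (fun h' => h (by simp [h']))
      · intro p _ h _; simp [h]
    have i2 : IntegrableOn (fun p => χ n p * (deriv q (σ p) * fderiv ℝ σ p (W p))) U μ := by
      refine C.integrable' G (a := s) (hχc.mul (hq'σ.mul (hσ'.clm_apply hWc))) hS n ?_ ?_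
      · intro p _ h
        exact hdq _ (fun h' => h (by simp [h']))
      · intro p _ h _; simp [h]
    have i3 : IntegrableOn (fun p => q (σ p) * fderiv ℝ (χ n) p (W p)) U μ := by
      refine C.integrable' G (a := s) (hqσ.continuousOn.mul ((C.fderiv_cont G n).clm_apply hWc)) hS n ?_ ?_
      · intro p _ h
        exact hqs _ (fun h' => h (by simp [h']))
      · intro p _ _ h; simp [h]
    have i4 : IntegrableOn (fun p => χ n p * f p) U μ := by
      refine Integrable.mono' hfi.abs ((hχc.mul hfc).aestronglyMeasurable G.isOpen.measurableSet) ?_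
      refine (ae_restrict_iff' G.isOpen.measurableSet).2 (Eventually.of_forall fun p hp => ?_)
      rw [norm_mul, norm_eq_abs, norm_eq_abs, abs_of_nonneg (C.nonneg n p hp)]
      exact mul_le_of_le_one_left (abs_nonneg _) (C.le_one n p hp)
    have i5 : IntegrableOn (fun p => χ n p * g p) U μ := by
      refine Integrable.mono' hgi.abs ((hχc.mul hgc).aestronglyMeasurable G.isOpen.measurableSet) ?_
      refine (ae_restrict_iff' G.isOpen.measurableSet).2 (Eventually.of_forall fun p hp => ?_)
      rw [norm_mul, norm_eq_abs, norm_eq_abs, abs_of_nonneg (C.nonneg n p hp)]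
      exact mul_le_of_le_one_left (abs_nonneg _) (C.le_one n p hp)
    obtain ⟨Kc, hKc, hKU, hK0⟩ := C.compact n s S hS
    have hdiv := setIntegral_divg μ G.isOpen hKc hKU (W := fun p => (χ n p * q (σ p)) • W p) (by
      intro p hp hpK
      by_cases h : q (σ p) = 0
      · simp [h]
      · obtain ⟨h1, h2⟩ := hqs _ h
        simp [(hK0 p hp h1 h2 hpK).1]) (((C.C1 n).mul hqσ).smul hW)
    have hpt : ∀ p ∈ U, divg (fun p => (χ n p * q (σ p)) • W p) p =
        χ n p * (q (σ p) * divg W p) + χ n p * (deriv q (σ p) * fderiv ℝ σ p (W p))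
          + q (σ p) * fderiv ℝ (χ n) p (W p) := by
      intro p hp
      have hn := G.isOpen.mem_nhds hp
      have d1 := (((C.C1 n).differentiableOn one_ne_zero).differentiableAt hn).hasFDerivAt
      have d2 := ((hq.differentiable one_ne_zero) (σ p)).hasDerivAt.comp_hasFDerivAt p
        (G.diffAt_σ hp).hasFDerivAt
      have d3 := (d1.mul d2)
      have d4 := (hW.differentiableOn one_ne_zero).differentiableAt hn
      have := divg_smul d3.differentiableAt d4
      rw [d3.fderiv] at this
      refine this.trans ?_
      simp
      ring
    rw [setIntegral_congr_fun G.isOpen.measurableSet hpt, int_add3 i1 i2 i3] at hdiv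
    have j1 : ∫ p in U, χ n p * f p ∂μ ≤ ∫ p in U, χ n p * (q (σ p) * divg W p) ∂μ :=
      setIntegral_mono_on i4 i1 G.isOpen.measurableSet fun p hp =>
        mul_le_mul_of_nonneg_left (hf p hp) (C.nonneg n p hp)
    have j2 : ∫ p in U, -(χ n p * (deriv q (σ p) * fderiv ℝ σ p (W p))) ∂μ
        ≤ ∫ p in U, χ n p * g p ∂μ :=
      setIntegral_mono_on i2.neg i5 G.isOpen.measurableSet fun p hp => by
        rw [← mul_neg]
        exact mul_le_mul_of_nonneg_left (hg p hp) (C.nonneg n p hp)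
    rw [integral_neg] at j2
    linarith
  have t1 := C.tendsto_mul G hfc hfi
  have t2 := (C.tendsto_mul G hgc hgi).sub hJ
  rw [sub_zero] at t2
  exact le_of_tendsto_of_tendsto' t1 t2 key

end Cut
end UCP

end

section

set_option linter.unusedSectionVars false
set_option linter.unusedSimpArgs false
namespace UCP

/-- derivative of the smooth transition is bounded and supported in the unit interval -/
lemma exists_T_bound : ∃ M : ℝ, 0 ≤ M ∧ ∀ x, |deriv smoothTransition x| ≤ M ∧
    (deriv smoothTransition x ≠ 0 → 0 ≤ x ∧ x ≤ 1) := by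
  have hc : Continuous (deriv smoothTransition) :=
    (smoothTransition.contDiff (n := 1)).continuous_deriv le_rfl
  have h0 : ∀ x, deriv smoothTransition x ≠ 0 → 0 ≤ x ∧ x ≤ 1 := by
    intro x hx
    by_contra hcon
    apply hx
    rw [not_and_or, not_le, not_le] at hcon
    rcases hcon with h | h
    · have : smoothTransition =ᶠ[nhds x] fun _ => 0 := by
        filter_upwards [Iio_mem_nhds h] with y hy
        exact smoothTransition.zero_of_nonpos (le_of_lt hy)
      rw [this.deriv_eq]; simp
    · have : smoothTransition =ᶠ[nhds x] fun _ => 1 := by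
        filter_upwards [Ioi_mem_nhds h] with y hy
        exact smoothTransition.one_of_one_le (le_of_lt hy)
      rw [this.deriv_eq]; simp
  obtain ⟨M, hM⟩ := (isCompact_Icc (a := (0:ℝ)) (b := 1)).exists_bound_of_continuousOn hc.continuousOn
  refine ⟨max M 0, le_max_right _ _, fun x => ⟨?_, h0 x⟩⟩
  by_cases hx : deriv smoothTransition x = 0
  · simp [hx]
  · exact (hM x (h0 x hx)).trans (le_max_left _ _)

/-- window function -/
def win (a b x : ℝ) : ℝ := smoothTransition (x - a) * smoothTransition (b - x)

lemma win_C1 (a b : ℝ) : ContDiff ℝ 1 (win a b) := by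
  unfold win
  exact (smoothTransition.contDiff.comp (contDiff_id.sub contDiff_const)).mul
    (smoothTransition.contDiff.comp (contDiff_const.sub contDiff_id))

lemma win_supp {a b x : ℝ} (h : win a b x ≠ 0) : a ≤ x ∧ x ≤ b := by
  by_contra hcon
  apply h
  rw [not_and_or, not_le, not_le] at hcon
  rcases hcon with h | h
  · simp [win, smoothTransition.zero_of_nonpos (by linarith : x - a ≤ 0)]
  · simp [win, smoothTransition.zero_of_nonpos (by linarith : b - x ≤ 0)]

lemma win_nonneg (a b x : ℝ) : 0 ≤ win a b x :=
  mul_nonneg (smoothTransition.nonneg _) (smoothTransition.nonneg _)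

lemma win_le_one (a b x : ℝ) : win a b x ≤ 1 :=
  mul_le_one₀ (smoothTransition.le_one _) (smoothTransition.nonneg _) (smoothTransition.le_one _)

lemma win_one {a b x : ℝ} (h1 : a + 1 ≤ x) (h2 : x ≤ b - 1) : win a b x = 1 := by
  simp [win, smoothTransition.one_of_one_le (by linarith : 1 ≤ x - a),
    smoothTransition.one_of_one_le (by linarith : 1 ≤ b - x)]

lemma win_deriv (a b x : ℝ) : |deriv (win a b) x| ≤
    |deriv smoothTransition (x - a)| + |deriv smoothTransition (b - x)| := by
  have hd : Differentiable ℝ smoothTransition :=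
    (smoothTransition.contDiff (n := 1)).differentiable one_ne_zero
  have h1 := (hd (x - a)).hasDerivAt.comp x ((hasDerivAt_id x).sub_const a)
  have h2 := (hd (b - x)).hasDerivAt.comp x ((hasDerivAt_id x).const_sub b)
  have h3 : HasDerivAt (win a b) _ x := h1.mul h2
  rw [h3.deriv]
  refine (abs_add_le _ _).trans ?_
  simp only [Function.comp, abs_mul, id, abs_neg, abs_one, mul_one]
  rw [abs_of_nonneg (smoothTransition.nonneg _), abs_of_nonneg (smoothTransition.nonneg _)]
  gcongr
  · exact mul_le_of_le_one_right (abs_nonneg _) (smoothTransition.le_one _)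
  · exact mul_le_of_le_one_left (abs_nonneg _) (smoothTransition.le_one _)

lemma deriv_supp {q : ℝ → ℝ} {s S : ℝ} (hqs : ∀ x, q x ≠ 0 → s ≤ x ∧ x ≤ S) :
    ∀ x, deriv q x ≠ 0 → s ≤ x ∧ x ≤ S := by
  intro x hx
  by_contra hcon
  apply hx
  have : (Icc s S)ᶜ ∈ nhds x := isClosed_Icc.isOpen_compl.mem_nhds hcon
  have : q =ᶠ[nhds x] fun _ => 0 := by
    filter_upwards [this] with y hy
    by_contra h; exact hy (hqs y h)
  rw [this.deriv_eq]; simp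

variable {H : Type*} [NormedAddCommGroup H] [NormedSpace ℝ H] [FiniteDimensional ℝ H]
variable [MeasurableSpace H] [BorelSpace H] {μ : Measure H} [μ.IsAddHaarMeasure]
variable {U : Set H} {A : H → (H →L[ℝ] ℝ) →L[ℝ] H} {σ Ψ : H → ℝ} {F : H → H} {K Q : ℝ}
variable {u V : H → ℝ} {χ : ℕ → H → ℝ} {S1 : ℝ}

lemma setIntegral_le_shell (hU : IsOpen U) (hσ : ContinuousOn σ U) {f g : H → ℝ} {a b N : ℝ}
    (hf : IntegrableOn f (shell U σ a b) μ) (hg : IntegrableOn g U μ)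
    (h0 : ∀ p ∈ U, g p ≠ 0 → a ≤ σ p ∧ σ p ≤ b)
    (hgf : ∀ p ∈ U, a ≤ σ p → σ p ≤ b → g p ≤ N * f p) :
    ∫ p in U, g p ∂μ ≤ N * ∫ p in shell U σ a b, f p ∂μ := by
  have hm := meas_shell hU hσ a b
  have e : ∫ p in shell U σ a b, g p ∂μ = ∫ p in U, g p ∂μ :=
    (setIntegral_eq_of_subset_of_forall_sdiff_eq_zero hU.measurableSet inter_subset_left (by
      intro p hp
      by_contra hne
      exact hp.2 ⟨hp.1, h0 p hp.1 hne⟩)).symm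
  rw [← e, ← integral_const_mul]
  exact setIntegral_mono_on (hg.mono_set inter_subset_left) (hf.const_mul N) hm
    fun p hp => hgf p hp.1 hp.2.1 hp.2.2

lemma shell_le_setIntegral (hU : IsOpen U) (hσ : ContinuousOn σ U) {f g : H → ℝ} {a b N : ℝ}
    (hf : IntegrableOn f (shell U σ a b) μ) (hg : IntegrableOn g U μ)
    (h0 : ∀ p ∈ U, 0 ≤ g p)
    (hgf : ∀ p ∈ U, a ≤ σ p → σ p ≤ b → N * f p ≤ g p) :
    N * ∫ p in shell U σ a b, f p ∂μ ≤ ∫ p in U, g p ∂μ := by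
  have hm := meas_shell hU hσ a b
  rw [← integral_const_mul]
  refine (setIntegral_mono_on (hf.const_mul N) (hg.mono_set inter_subset_left) hm
    fun p hp => hgf p hp.1 hp.2.1 hp.2.2).trans ?_
  refine setIntegral_mono_set hg ?_ (LE.le.eventuallyLE inter_subset_left)
  exact (ae_restrict_iff' hU.measurableSet).2 (Eventually.of_forall fun p hp => h0 p hp)

namespace Cut

lemma int_shell (C : Cut μ U A σ Ψ F u χ S1) (G : Geo U A σ Ψ F K Q) {f : H → ℝ}
    (hf : ContinuousOn f U) {a b M : ℝ} (hb : b < S1)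
    (hM : ∀ p ∈ U, a ≤ σ p → σ p ≤ b → |f p| ≤ M) :
    IntegrableOn f (shell U σ a b) μ := by
  have hm := meas_shell G.isOpen G.σ_C2.continuousOn a b
  refine IntegrableOn.of_bound (C.fin a b hb) ?_ M ?_
  · exact (hf.mono inter_subset_left).aestronglyMeasurable hm
  · refine (ae_restrict_iff' hm).2 (Eventually.of_forall fun p hp => ?_)
    exact hM p hp.1 hp.2.1 hp.2.2

lemma integrable_q (C : Cut μ U A σ Ψ F u χ S1) (G : Geo U A σ Ψ F K Q) {f : H → ℝ}
    (hf : ContinuousOn f U) {a b M : ℝ} (hb : b < S1) {q : ℝ → ℝ} (hq : Continuous q)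
    (h0 : ∀ x, q x ≠ 0 → a ≤ x ∧ x ≤ b) (hM : ∀ p ∈ U, a ≤ σ p → σ p ≤ b → |f p| ≤ M) :
    IntegrableOn (fun p => q (σ p) * f p) U μ := by
  obtain ⟨N, hN⟩ := (isCompact_Icc (a := a) (b := b)).exists_bound_of_continuousOn hq.continuousOn
  refine C.integrable G (a := a) (b := b) (M := N * M)
    ((hq.comp_continuousOn G.σ_C2.continuousOn).mul hf) hb ?_ ?_
  · intro p _ h
    exact h0 _ fun h' => h (by simp [h'])
  · intro p hp h1 h2
    rw [abs_mul]
    have := hN _ ⟨h1, h2⟩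
    exact mul_le_mul this (hM p hp h1 h2) (abs_nonneg _) ((norm_nonneg _).trans this)

lemma en_cont (G : Geo U A σ Ψ F K Q) (hu : ContDiffOn ℝ 2 u U) : ContinuousOn (enA A u) U :=
  (hu.continuousOn_fderiv_of_isOpen G.isOpen (by norm_num)).clm_apply (G.gradA_C1 hu).continuousOn

lemma Ψu_cont (G : Geo U A σ Ψ F K Q) (hu : ContDiffOn ℝ 2 u U) :
    ContinuousOn (fun p => Ψ p * u p ^ 2) U :=
  G.Ψ_C1.continuousOn.mul (hu.continuousOn.pow 2)

lemma bdd2 (C : Cut μ U A σ Ψ F u χ S1) (G : Geo U A σ Ψ F K Q) (hub : ∀ p ∈ U, |u p| ≤ 1)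
    {a b : ℝ} (hb : b < S1) : ∃ M : ℝ, ∀ p ∈ U, a ≤ σ p → σ p ≤ b →
      |enA A u p| ≤ M ∧ |Ψ p * u p ^ 2| ≤ M := by
  obtain ⟨M, hM⟩ := C.bdd a b hb
  refine ⟨M, fun p hp h1 h2 => ?_⟩
  obtain ⟨h3, h4, _⟩ := hM p hp h1 h2
  have hΨ := G.Ψ_pos p hp
  refine ⟨by rw [abs_of_nonneg (show 0 ≤ enA A u p from G.psd p hp _)]; exact h4, ?_⟩
  rw [abs_of_nonneg (by positivity)]
  have : u p ^ 2 ≤ 1 := by rw [sq_le_one_iff_abs_le_one]; exact hub p hp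
  nlinarith

set_option maxHeartbeats 400000 in
/-- Caccioppoli inequality. -/
lemma cacc (C : Cut μ U A σ Ψ F u χ S1) (G : Geo U A σ Ψ F K Q) (hu : ContDiffOn ℝ 2 u U)
    (heq : ∀ p ∈ U, divg (gradA A u) p = V p * u p) {C0 : ℝ} (hC0 : 0 ≤ C0)
    (hV : ∀ p ∈ U, |V p| ≤ C0 * Ψ p) (hub : ∀ p ∈ U, |u p| ≤ 1) {S0 : ℝ} (hS : S0 < S1)
    (hK : ∀ x ≤ S0, K * exp x ≤ 1 / 200) : ∃ C1 : ℝ, 0 ≤ C1 ∧ ∀ s, s + 2 ≤ S0 →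
      ∫ p in shell U σ s (s + 1), enA A u p ∂μ ≤
        C1 * ∫ p in shell U σ (s - 1) (s + 2), Ψ p * u p ^ 2 ∂μ := by
  obtain ⟨M, hM0, hM⟩ := exists_T_bound
  refine ⟨2 * (C0 + 16 * M ^ 2), by positivity, fun s hs => ?_⟩
  have hb : s + 2 < S1 := by linarith
  set w := win (s - 1) (s + 2) with hw
  have hwC := win_C1 (s - 1) (s + 2)
  have hw'c : Continuous (deriv w) := hwC.continuous_deriv le_rfl
  have hws : ∀ x, w x ≠ 0 → s - 1 ≤ x ∧ x ≤ s + 2 := fun x => win_supp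
  have hw's := deriv_supp hws
  have hσc := G.σ_C2.continuousOn
  have hq : ContDiff ℝ 1 (fun x => w x ^ 2) := hwC.pow 2
  have hqs : ∀ x, w x ^ 2 ≠ 0 → s - 1 ≤ x ∧ x ≤ s + 2 := fun x h => hws x (by
    intro h'; simp [h'] at h)
  have hw'b : ∀ x, deriv w x ^ 2 ≤ 4 * M ^ 2 := by
    intro x
    have h1 := win_deriv (s - 1) (s + 2) x
    have h2 := (hM (x - (s - 1))).1
    have h3 := (hM ((s + 2) - x)).1
    rw [← sq_abs]
    have : |deriv w x| ≤ 2 * M := by linarith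
    nlinarith [abs_nonneg (deriv w x)]
  obtain ⟨N, hN⟩ := C.bdd2 G hub (a := s - 1) (b := s + 2) hb
  have en0 : ∀ p ∈ U, 0 ≤ enA A u p := fun p hp => G.psd p hp _
  have Ψu0 : ∀ p ∈ U, 0 ≤ Ψ p * u p ^ 2 := fun p hp =>
    mul_nonneg (G.Ψ_pos p hp).le (sq_nonneg _)
  have ien := C.integrable_q G (en_cont G hu) hb hq.continuous hqs (fun p hp h1 h2 => (hN p hp h1 h2).1)
  have iΨ := C.integrable_q G (Ψu_cont G hu) hb hq.continuous hqs (fun p hp h1 h2 => (hN p hp h1 h2).2)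
  have iΨ' := C.integrable_q G (Ψu_cont G hu) hb (q := fun x => deriv w x ^ 2) (hw'c.pow 2) (a := s - 1) (b := s + 2)
    (fun x h => hw's x (by intro h'; simp [h'] at h)) (fun p hp h1 h2 => (hN p hp h1 h2).2)
  have hσq : ContinuousOn (fun p => w (σ p) ^ 2) U := hq.continuous.comp_continuousOn hσc
  have hσq' : ContinuousOn (fun p => deriv w (σ p) ^ 2) U := (hw'c.pow 2).comp_continuousOn hσc
  have if0 : IntegrableOn (fun p => w (σ p) ^ 2 * enA A u p - C0 * (w (σ p) ^ 2 * (Ψ p * u p ^ 2))) U μ :=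
    ien.sub (iΨ.const_mul C0)
  have ig0 : IntegrableOn (fun p => 1 / 2 * (w (σ p) ^ 2 * enA A u p)
      + 4 * (deriv w (σ p) ^ 2 * (Ψ p * u p ^ 2))) U μ :=
    (ien.const_mul (1/2)).add (iΨ'.const_mul 4)
  have hfl := C.flux G (W := fun p => u p • gradA A u p)
    ((hu.of_le (by norm_num)).smul (G.gradA_C1 hu)) hq hb hqs
    (f := fun p => w (σ p) ^ 2 * enA A u p - C0 * (w (σ p) ^ 2 * (Ψ p * u p ^ 2)))
    (g := fun p => 1 / 2 * (w (σ p) ^ 2 * enA A u p) + 4 * (deriv w (σ p) ^ 2 * (Ψ p * u p ^ 2)))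
    ((hσq.mul (en_cont G hu)).sub (continuousOn_const.mul (hσq.mul (Ψu_cont G hu))))
    ((continuousOn_const.mul (hσq.mul (en_cont G hu))).add
      (continuousOn_const.mul (hσq'.mul (Ψu_cont G hu))))
    if0 ig0 ?_ ?_ ?_
  · rw [integral_sub ien (iΨ.const_mul C0), integral_add (ien.const_mul (1/2)) (iΨ'.const_mul 4),
      integral_const_mul, integral_const_mul, integral_const_mul] at hfl
    have ish : IntegrableOn (fun p => Ψ p * u p ^ 2) (shell U σ (s - 1) (s + 2)) μ :=
      C.int_shell G (Ψu_cont G hu) hb (fun p hp h1 h2 => (hN p hp h1 h2).2)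
    have ish2 : IntegrableOn (enA A u) (shell U σ s (s + 1)) μ :=
      C.int_shell G (en_cont G hu) (by linarith)
        (fun p hp h1 h2 => (hN p hp (by linarith) (by linarith)).1)
    have b1 := setIntegral_le_shell G.isOpen hσc ish iΨ (N := 1)
      (fun p _ h => hqs _ fun h' => h (by simp only [h', zero_mul]))
      (fun p hp _ _ => by
        have h1 := win_nonneg (s - 1) (s + 2) (σ p)
        have h2 := win_le_one (s - 1) (s + 2) (σ p)
        exact mul_le_mul_of_nonneg_right (pow_le_one₀ h1 h2) (Ψu0 p hp))
    have b2 := setIntegral_le_shell G.isOpen hσc ish iΨ' (N := 4 * M ^ 2)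
      (fun p _ h => hw's _ fun h' => h (by simp [h']))
      (fun p hp _ _ => mul_le_mul_of_nonneg_right (hw'b _) (Ψu0 p hp))
    have b3 := shell_le_setIntegral G.isOpen hσc ish2 ien (N := 1)
      (fun p hp => mul_nonneg (sq_nonneg _) (en0 p hp))
      (fun p hp h1 h2 => by
        rw [hw, win_one (by linarith) (by linarith), one_pow])
    have := mul_le_mul_of_nonneg_left b1 hC0
    linarith
  · intro p hp
    have hn := G.isOpen.mem_nhds hp
    have e1 := divg_smul ((hu.differentiableOn two_ne_zero).differentiableAt hn)
      (((G.gradA_C1 hu).differentiableOn one_ne_zero).differentiableAt hn)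
    rw [e1, heq p hp]
    have hVp := abs_le.1 (hV p hp)
    have : -(C0 * Ψ p) * u p ^ 2 ≤ V p * u p ^ 2 := mul_le_mul_of_nonneg_right hVp.1 (sq_nonneg _)
    have := mul_le_mul_of_nonneg_left this (sq_nonneg (w (σ p)))
    rw [enA]
    linarith
  · intro p hp
    have hn := G.isOpen.mem_nhds hp
    have e1 : deriv (fun x => w x ^ 2) (σ p) = 2 * w (σ p) * deriv w (σ p) := by
      have := ((hwC.differentiable one_ne_zero (σ p)).hasDerivAt.pow 2).deriv
      refine this.trans ?_
      simp; rfl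
    have e3 : fderiv ℝ σ p (gradA A u p) = Ψ p * fderiv ℝ u p (F p) := by
      rw [gradA, G.symm p hp, G.Aσ p hp, map_smul, smul_eq_mul]
    rw [e1, map_smul, e3, smul_eq_mul]
    by_cases hz : w (σ p) = 0
    · have := mul_nonneg (sq_nonneg (deriv w (σ p))) (Ψu0 p hp)
      rw [hz]; simp only [mul_zero, zero_mul, neg_zero, ne_eq, OfNat.ofNat_ne_zero, not_false_eq_true, zero_pow, zero_add]
      linarith
    have hσ := hws _ hz
    have hB := abs_le.1 (G.hB p hp)
    have hKp := hK (σ p) (by linarith)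
    have hF := G.F_sq hp (fderiv ℝ u p)
    change _ ≤ _ * enA A u p at hF
    have hF2 : Ψ p * fderiv ℝ u p (F p) ^ 2 ≤ 2 * enA A u p :=
      hF.trans (mul_le_mul_of_nonneg_right (by linarith) (en0 p hp))
    have hΨ := G.Ψ_pos p hp
    have k1 : 0 ≤ Ψ p * (1/2 * w (σ p) * fderiv ℝ u p (F p) + 2 * deriv w (σ p) * u p) ^ 2 := by
      positivity
    have k2 := mul_le_mul_of_nonneg_left hF2 (sq_nonneg (w (σ p)))
    linarith
  · refine (C.jump1 _ hq ⟨_, _, hb, hqs⟩).congr fun n => ?_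
    congr 1; ext p
    simp only [map_smul, smul_eq_mul]; ring

end Cut
end UCP

end

section

set_option linter.unusedSectionVars false
set_option linter.unusedSimpArgs false
namespace UCP

variable {H : Type*} [NormedAddCommGroup H] [NormedSpace ℝ H] [FiniteDimensional ℝ H]
variable [MeasurableSpace H] [BorelSpace H] {μ : Measure H} [μ.IsAddHaarMeasure]
variable {U : Set H} {A : H → (H →L[ℝ] ℝ) →L[ℝ] H} {σ Ψ : H → ℝ} {F : H → H} {K Q : ℝ}
variable {u V : H → ℝ} {χ : ℕ → H → ℝ} {S1 : ℝ}

namespace Cut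

lemma domT_cont (G : Geo U A σ Ψ F K Q) (hu : ContDiffOn ℝ 2 u U) (α : ℝ) :
    ContinuousOn (domT A σ Ψ α u) U := by
  have h1 := G.σ_C2.continuousOn
  have h2 := en_cont G hu
  have h3 := Ψu_cont G hu
  unfold domT
  fun_prop

lemma domT_bdd (C : Cut μ U A σ Ψ F u χ S1) (G : Geo U A σ Ψ F K Q) (hub : ∀ p ∈ U, |u p| ≤ 1)
    {a b : ℝ} (hb : b < S1) (α : ℝ) : ∃ M : ℝ, ∀ p ∈ U, a ≤ σ p → σ p ≤ b →
      |domT A σ Ψ α u p| ≤ M := by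
  obtain ⟨N, hN⟩ := C.bdd2 G hub (a := a) (b := b) hb
  have hc : Continuous (fun x : ℝ => (1 + (2 * α * x) ^ 2) * exp (α * x ^ 2) ^ 2) := by fun_prop
  obtain ⟨M, hM⟩ := (isCompact_Icc (a := a) (b := b)).exists_bound_of_continuousOn hc.continuousOn
  refine ⟨M * (N + N), fun p hp h1 h2 => ?_⟩
  obtain ⟨h3, h4⟩ := hN p hp h1 h2
  have h5 := hM (σ p) ⟨h1, h2⟩
  rw [domT, abs_mul]
  exact mul_le_mul h5 ((abs_add_le _ _).trans (add_le_add h3 h4)) (abs_nonneg _)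
    ((norm_nonneg _).trans h5)

lemma carJ (C : Cut μ U A σ Ψ F u χ S1) (G : Geo U A σ Ψ F K Q) (hu : ContDiffOn ℝ 2 u U)
    (hub : ∀ p ∈ U, |u p| ≤ 1) (α c : ℝ) {q : ℝ → ℝ} (hq : ContDiff ℝ 1 q) {s S : ℝ} (hS : S < S1)
    (hqs : ∀ x, q x ≠ 0 → s ≤ x ∧ x ≤ S) (hK : ∀ x ≤ S, K * exp x ≤ 1 / 200) :
    Tendsto (fun n => ∫ p in U, q (σ p) * fderiv ℝ (χ n) p (carF A σ Ψ F K c α (conj α σ u) p) ∂μ)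
      atTop (nhds 0) := by
  set q1 : ℝ → ℝ := fun x => q x * (exp (α * x ^ 2) ^ 2 * (2 * (K * exp x) - c)) with hq1
  set q2 : ℝ → ℝ := fun x => q x * (- exp (α * x ^ 2) ^ 2) with hq2
  set q3 : ℝ → ℝ := fun x => q x * (- (exp (α * x ^ 2) ^ 2 * (2 * α * x))) with hq3
  have c1 : ContDiff ℝ 1 q1 := by fun_prop
  have c2 : ContDiff ℝ 1 q2 := by fun_prop
  have c3 : ContDiff ℝ 1 q3 := by fun_prop
  have s1 : ∀ x, q1 x ≠ 0 → s ≤ x ∧ x ≤ S := fun x h => hqs x (left_ne_zero_of_mul h)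
  have s2 : ∀ x, q2 x ≠ 0 → s ≤ x ∧ x ≤ S := fun x h => hqs x (left_ne_zero_of_mul h)
  have s3 : ∀ x, q3 x ≠ 0 → s ≤ x ∧ x ≤ S := fun x h => hqs x (left_ne_zero_of_mul h)
  have hv := G.conj_C2 hu α
  have hσ1 : ContDiffOn ℝ 1 σ U := G.σ_C2.of_le (by norm_num)
  have hσc := hσ1.continuousOn
  have k1 : ContinuousOn (fderiv ℝ (conj α σ u)) U :=
    hv.continuousOn_fderiv_of_isOpen G.isOpen (by norm_num)
  have k1u : ContinuousOn (fderiv ℝ u) U :=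
    hu.continuousOn_fderiv_of_isOpen G.isOpen (by norm_num)
  have k2 := (G.gradA_C1 hv).continuousOn
  have k2u := (G.gradA_C1 hu).continuousOn
  have k3 := G.F_C1.continuousOn
  have k4 := G.Ψ_C1.continuousOn
  have k5 := G.B_C1.continuousOn
  have k6 := hv.continuousOn
  have k7 := k1.clm_apply k3
  have k8 := k1.clm_apply k2
  have k9 := k1u.clm_apply k3
  have k10 := hu.continuousOn
  set f1 : H → ℝ := fun p => 2 * (K * exp (σ p)) * conj α σ u p - fderiv ℝ (conj α σ u) p (F p)
    - c * conj α σ u p with hf1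
  set f3 : H → ℝ := fun p => 1 / 2 * fderiv ℝ (conj α σ u) p (gradA A (conj α σ u) p)
      - 1 / 2 * (2 * α * σ p) ^ 2 * Ψ p * fderiv ℝ σ p (F p) * conj α σ u p ^ 2
      - 2 * (K * exp (σ p)) * (2 * α * σ p) * Ψ p * conj α σ u p ^ 2 with hf3
  set h : H → ℝ := fun p => q (σ p) * (f1 p * (2 * α * σ p) * conj α σ u p * Ψ p + f3 p) with hh
  have hqc : ContinuousOn (fun p => q (σ p)) U := hq.continuous.comp_continuousOn hσc
  have hhc : ContinuousOn h U := by
    simp only [hh, hf1, hf3]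
    refine hqc.mul ?_
    clear_value q1 q2 q3
    fun_prop
  have hhs : ∀ p ∈ U, h p ≠ 0 → s ≤ σ p ∧ σ p ≤ S := fun p _ hne => hqs _ (left_ne_zero_of_mul hne)
  obtain ⟨M, hM⟩ := C.domT_bdd G hub (a := s) (b := S) hS α
  obtain ⟨N, hN⟩ := (isCompact_Icc (a := s) (b := S)).exists_bound_of_continuousOn
    hq.continuous.continuousOn
  have hhb : ∀ p ∈ U, s ≤ σ p → σ p ≤ S → |h p| ≤ N * (25 * (1 + |c|) * M + 20 * M) := by
    intro p hp h1 h2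
    obtain ⟨b1, b2, _⟩ := G.car_bounds hu α c hp (hK _ h2)
    have b3 := hM p hp h1 h2
    have b4 := le_abs_self (domT A σ Ψ α u p)
    have b5 := hN (σ p) ⟨h1, h2⟩
    rw [hh, abs_mul]
    refine mul_le_mul b5 ((abs_add_le _ _).trans (add_le_add (b2.trans ?_) (b1.trans ?_)))
      (abs_nonneg _) ((norm_nonneg _).trans b5)
    · exact mul_le_mul_of_nonneg_left (b4.trans b3) (by positivity)
    · exact mul_le_mul_of_nonneg_left (b4.trans b3) (by positivity)
  have t1 := C.jump1 q1 c1 ⟨s, S, hS, s1⟩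
  have t2 := C.jump2 q2 c2 ⟨s, S, hS, s2⟩
  have t3 := C.jump3 q3 c3 ⟨s, S, hS, s3⟩
  have t4 := C.tendsto_Fχ G hhc hS hhs hhb
  have t := ((t1.add t2).add t3).add t4
  rw [add_zero, add_zero, add_zero] at t
  refine t.congr fun n => ?_
  have d := C.fderiv_cont G n
  have dg := d.clm_apply k2u
  have dF := d.clm_apply k3
  have i1 : IntegrableOn (fun p => q1 (σ p) * u p * fderiv ℝ (χ n) p (gradA A u p)) U μ := by
    refine C.integrable' G (((c1.continuous.comp_continuousOn hσc).mul k10).mul dg) hS n (a := s) ?_ ?_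
    · exact fun p _ h => s1 _ (left_ne_zero_of_mul (left_ne_zero_of_mul h))
    · intro p _ _ h; simp [h]
  have i2 : IntegrableOn (fun p => q2 (σ p) * fderiv ℝ u p (F p) * fderiv ℝ (χ n) p (gradA A u p)) U μ := by
    refine C.integrable' G (((c2.continuous.comp_continuousOn hσc).mul k9).mul dg) hS n (a := s) ?_ ?_
    · exact fun p _ h => s2 _ (left_ne_zero_of_mul (left_ne_zero_of_mul h))
    · intro p _ _ h; simp [h]
  have i3 : IntegrableOn (fun p => q3 (σ p) * (fderiv ℝ σ p (F p) * u p) * fderiv ℝ (χ n) p (gradA A u p)) U μ := by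
    refine C.integrable' G (((c3.continuous.comp_continuousOn hσc).mul (k5.mul k10)).mul dg) hS n (a := s) ?_ ?_
    · exact fun p _ h => s3 _ (left_ne_zero_of_mul (left_ne_zero_of_mul h))
    · intro p _ _ h; simp [h]
  have i4 : IntegrableOn (fun p => h p * fderiv ℝ (χ n) p (F p)) U μ := by
    refine C.integrable' G (hhc.mul dF) hS n (a := s) ?_ ?_
    · exact fun p hp h => hhs p hp (left_ne_zero_of_mul h)
    · intro p _ _ h; simp [h]
  rw [← int_add3 i1 i2 i3]
  have i123 : IntegrableOn (fun p => q1 (σ p) * u p * fderiv ℝ (χ n) p (gradA A u p)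
    + q2 (σ p) * fderiv ℝ u p (F p) * fderiv ℝ (χ n) p (gradA A u p)
    + q3 (σ p) * (fderiv ℝ σ p (F p) * u p) * fderiv ℝ (χ n) p (gradA A u p)) U μ := (i1.add i2).add i3
  rw [← integral_add i123 i4]
  refine setIntegral_congr_fun G.isOpen.measurableSet fun p hp => ?_
  have e4 := congrArg (fun T : H →L[ℝ] ℝ => T (F p)) (G.fderiv_conj hu α hp)
  have hcc : conj α σ u p = exp (α * σ p ^ 2) * u p := rfl
  have e5 : fderiv ℝ (χ n) p (carF A σ Ψ F K c α (conj α σ u) p) =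
      f1 p * (exp (α * σ p ^ 2) * fderiv ℝ (χ n) p (gradA A u p)
        + (2 * α * σ p * conj α σ u p * Ψ p) * fderiv ℝ (χ n) p (F p))
        + f3 p * fderiv ℝ (χ n) p (F p) := by
    rw [carF, map_add, map_smul, map_smul, smul_eq_mul, smul_eq_mul]
    congr 2
    rw [G.gradA_conj hu α hp, map_add, map_smul, map_smul, smul_eq_mul, smul_eq_mul]
  simp only [add_apply, smul_apply, smul_eq_mul] at e4
  have e6 : f1 p = 2 * (K * exp (σ p)) * (exp (α * σ p ^ 2) * u p) -
    (exp (α * σ p ^ 2) * fderiv ℝ u p (F p) + 2 * α * σ p * (exp (α * σ p ^ 2) * u p) * fderiv ℝ σ p (F p))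
    - c * (exp (α * σ p ^ 2) * u p) := by
    simp only [hf1]; rw [e4, hcc]
  simp only [e5, hq1, hq2, hq3, hh]
  linear_combination (- q (σ p) * exp (α * σ p ^ 2) * fderiv ℝ (χ n) p (gradA A u p)) * e6

end Cut
end UCP

end

section

set_option linter.unusedSectionVars false
set_option linter.unusedSimpArgs false
namespace UCP

variable {H : Type*} [NormedAddCommGroup H] [NormedSpace ℝ H] [FiniteDimensional ℝ H]
variable [MeasurableSpace H] [BorelSpace H] {μ : Measure H} [μ.IsAddHaarMeasure]
variable {U : Set H} {A : H → (H →L[ℝ] ℝ) →L[ℝ] H} {σ Ψ : H → ℝ} {F : H → H} {K Q : ℝ}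
variable {u V : H → ℝ} {χ : ℕ → H → ℝ} {S1 : ℝ}

lemma domT_le (G : Geo U A σ Ψ F K Q) {α s : ℝ} (hα : 0 ≤ α) {p : H} (hp : p ∈ U)
    (h1 : s ≤ σ p) (h2 : σ p ≤ 0) :
    domT A σ Ψ α u p ≤ (1 + (2 * α * s) ^ 2) * exp (α * s ^ 2) ^ 2 * (enA A u p + Ψ p * u p ^ 2) := by
  have en0 : 0 ≤ enA A u p := G.psd p hp _
  have Ψu0 : 0 ≤ Ψ p * u p ^ 2 := mul_nonneg (G.Ψ_pos p hp).le (sq_nonneg _)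
  have hs : σ p ^ 2 ≤ s ^ 2 := by nlinarith
  rw [domT]
  refine mul_le_mul_of_nonneg_right ?_ (by linarith)
  have e1 : exp (α * σ p ^ 2) ≤ exp (α * s ^ 2) := exp_le_exp.2 (by gcongr)
  have e2 : (2 * α * σ p) ^ 2 ≤ (2 * α * s) ^ 2 := by
    rw [mul_pow, mul_pow _ s]; gcongr
  gcongr

namespace Cut

set_option maxHeartbeats 400000 in
/-- Carleman inequality. -/
lemma carl (C : Cut μ U A σ Ψ F u χ S1) (G : Geo U A σ Ψ F K Q) (hu : ContDiffOn ℝ 2 u U)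
    (heq : ∀ p ∈ U, divg (gradA A u) p = V p * u p) {C0 c : ℝ} (hC0 : 0 ≤ C0)
    (hV : ∀ p ∈ U, |V p| ≤ C0 * Ψ p) (hub : ∀ p ∈ U, |u p| ≤ 1) {S0 : ℝ} (hS : S0 < S1)
    (hS0 : S0 ≤ -1) (hc : Q = 2 * c + 2)
    (hK : ∀ x ≤ S0, K * exp x * (-x) ≤ 1 / 200) (hK' : ∀ x ≤ S0, K * exp x ≤ 1 / 200) :
    ∃ N : ℝ, 0 ≤ N ∧ ∀ α, 10 * (C0 + |c| + 1) ≤ α → ∀ s t, s + 1 ≤ t → t ≤ S0 - 2 →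
      α ^ 2 * exp (α * (S0 - 2) ^ 2) ^ 2 * ∫ p in shell U σ t (S0 - 2), Ψ p * u p ^ 2 ∂μ ≤
      N * ((1 + (2 * α * s) ^ 2) * exp (α * s ^ 2) ^ 2) *
          (∫ p in shell U σ s (s + 1), (enA A u p + Ψ p * u p ^ 2) ∂μ)
      + N * ((1 + (2 * α * (S0 - 1)) ^ 2) * exp (α * (S0 - 1) ^ 2) ^ 2) *
          (∫ p in shell U σ (S0 - 1) S0, (enA A u p + Ψ p * u p ^ 2) ∂μ) := by
  obtain ⟨M, hM0, hM⟩ := exists_T_bound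
  refine ⟨M * (100 * (1 + |c|)), by positivity, fun α hα s t hst ht => ?_⟩
  have hα0 : 0 ≤ α := by linarith [abs_nonneg c]
  set q := win s S0 with hq
  have hqC : ContDiff ℝ 1 q := win_C1 s S0
  have hqs : ∀ x, q x ≠ 0 → s ≤ x ∧ x ≤ S0 := fun x => win_supp
  have hσc := G.σ_C2.continuousOn
  have hTc : Continuous (deriv smoothTransition) :=
    (smoothTransition.contDiff (n := 1)).continuous_deriv le_rfl
  have hL1c : Continuous (fun x => |deriv smoothTransition (x - s)|) := by fun_prop
  have hL2c : Continuous (fun x => |deriv smoothTransition (S0 - x)|) := by fun_prop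
  have hL1s : ∀ x, |deriv smoothTransition (x - s)| ≠ 0 → s ≤ x ∧ x ≤ s + 1 := by
    intro x hx
    have := (hM (x - s)).2 (abs_ne_zero.1 hx)
    constructor <;> linarith
  have hL2s : ∀ x, |deriv smoothTransition (S0 - x)| ≠ 0 → S0 - 1 ≤ x ∧ x ≤ S0 := by
    intro x hx
    have := (hM (S0 - x)).2 (abs_ne_zero.1 hx)
    constructor <;> linarith
  obtain ⟨N1, hN1⟩ := C.domT_bdd G hub (a := s) (b := s + 1) (by linarith) α
  obtain ⟨N2, hN2⟩ := C.domT_bdd G hub (a := S0 - 1) (b := S0) hS α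
  obtain ⟨N0, hN0⟩ := C.bdd2 G hub (a := s) (b := S0) hS
  have hcc : 0 ≤ 100 * (1 + |c|) := by positivity
  have hD := domT_cont G hu α
  have i1 : IntegrableOn (fun p => |deriv smoothTransition (σ p - s)| * (100 * (1 + |c|) * domT A σ Ψ α u p)) U μ :=
    C.integrable_q G (continuousOn_const.mul hD) (by linarith) hL1c hL1s (M := 100 * (1 + |c|) * N1)
      (fun p hp h1 h2 => by
        change |100 * (1 + |c|) * domT A σ Ψ α u p| ≤ _
        rw [abs_mul, abs_of_nonneg hcc]; exact mul_le_mul_of_nonneg_left (hN1 p hp h1 h2) hcc)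
  have i2 : IntegrableOn (fun p => |deriv smoothTransition (S0 - σ p)| * (100 * (1 + |c|) * domT A σ Ψ α u p)) U μ :=
    C.integrable_q G (continuousOn_const.mul hD) hS hL2c hL2s (M := 100 * (1 + |c|) * N2)
      (fun p hp h1 h2 => by
        change |100 * (1 + |c|) * domT A σ Ψ α u p| ≤ _
        rw [abs_mul, abs_of_nonneg hcc]; exact mul_le_mul_of_nonneg_left (hN2 p hp h1 h2) hcc)
  have ig : IntegrableOn (fun p => |deriv smoothTransition (σ p - s)| * (100 * (1 + |c|) * domT A σ Ψ α u p)
      + |deriv smoothTransition (S0 - σ p)| * (100 * (1 + |c|) * domT A σ Ψ α u p)) U μ := i1.add i2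
  have hqq : Continuous (fun x => q x * (α ^ 2 * (-x) * exp (α * x ^ 2) ^ 2)) := by
    have := hqC.continuous; fun_prop
  have ifn : IntegrableOn (fun p => (q (σ p) * (α ^ 2 * (-σ p) * exp (α * σ p ^ 2) ^ 2)) * (Ψ p * u p ^ 2)) U μ :=
    C.integrable_q G (Ψu_cont G hu) hS hqq (fun x h => hqs x (left_ne_zero_of_mul h))
      (fun p hp h1 h2 => (hN0 p hp h1 h2).2)
  have hfl := C.flux G (G.carF_C1 (G.conj_C2 hu α) c α) hqC hS hqs
    ((hqq.comp_continuousOn hσc).mul (Ψu_cont G hu))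
    (((hL1c.comp_continuousOn hσc).mul (continuousOn_const.mul hD)).add
      ((hL2c.comp_continuousOn hσc).mul (continuousOn_const.mul hD))) ifn ig ?_ ?_
      (C.carJ G hu hub α c hqC hS hqs hK')
  · have e := integral_add i1 i2
    change ∫ p in U, (q (σ p) * (α ^ 2 * (-σ p) * exp (α * σ p ^ 2) ^ 2)) * (Ψ p * u p ^ 2) ∂μ ≤
      ∫ p in U, (|deriv smoothTransition (σ p - s)| * (100 * (1 + |c|) * domT A σ Ψ α u p)
      + |deriv smoothTransition (S0 - σ p)| * (100 * (1 + |c|) * domT A σ Ψ α u p)) ∂μ at hfl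
    rw [e] at hfl
    have j0 : IntegrableOn (fun p => Ψ p * u p ^ 2) (shell U σ t (S0 - 2)) μ :=
      C.int_shell G (Ψu_cont G hu) (by linarith) (fun p hp h1 h2 =>
        (hN0 p hp (by linarith) (by linarith)).2)
    have hcE : ContinuousOn (fun p => enA A u p + Ψ p * u p ^ 2) U := (en_cont G hu).add (Ψu_cont G hu)
    have hbE : ∀ p ∈ U, s ≤ σ p → σ p ≤ S0 → |enA A u p + Ψ p * u p ^ 2| ≤ N0 + N0 :=
      fun p hp h1 h2 => (abs_add_le _ _).trans (add_le_add (hN0 p hp h1 h2).1 (hN0 p hp h1 h2).2)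
    have j1 : IntegrableOn (fun p => enA A u p + Ψ p * u p ^ 2) (shell U σ s (s + 1)) μ :=
      C.int_shell G hcE (by linarith) (fun p hp h1 h2 => hbE p hp h1 (by linarith))
    have j2 : IntegrableOn (fun p => enA A u p + Ψ p * u p ^ 2) (shell U σ (S0 - 1) S0) μ :=
      C.int_shell G hcE hS (fun p hp h1 h2 => hbE p hp (by linarith) h2)
    have en0 : ∀ p ∈ U, 0 ≤ enA A u p + Ψ p * u p ^ 2 := fun p hp =>
      add_nonneg (G.psd p hp _) (mul_nonneg (G.Ψ_pos p hp).le (sq_nonneg _))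
    have dom0 : ∀ p ∈ U, 0 ≤ domT A σ Ψ α u p := fun p hp => mul_nonneg (by positivity) (en0 p hp)
    have b0 := shell_le_setIntegral G.isOpen hσc j0 ifn (N := α ^ 2 * exp (α * (S0 - 2) ^ 2) ^ 2)
      (fun p hp => by
        have h1 := mul_nonneg (G.Ψ_pos p hp).le (sq_nonneg (u p))
        by_cases hz : q (σ p) = 0
        · simp [hz]
        have h2 : 0 ≤ -σ p := by linarith [hqs _ hz]
        have h3 := win_nonneg s S0 (σ p)
        positivity)
      (fun p hp h1 h2 => by
        have h3 := mul_nonneg (G.Ψ_pos p hp).le (sq_nonneg (u p))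
        refine mul_le_mul_of_nonneg_right ?_ h3
        rw [hq, win_one (by linarith) (by linarith), one_mul]
        have h4 : (S0 - 2) ^ 2 ≤ σ p ^ 2 := by nlinarith
        have h5 : exp (α * (S0 - 2) ^ 2) ≤ exp (α * σ p ^ 2) := exp_le_exp.2 (by gcongr)
        have h6 : α ^ 2 ≤ α ^ 2 * (-σ p) := by nlinarith [sq_nonneg α]
        exact mul_le_mul h6 (pow_le_pow_left₀ (exp_pos _).le h5 2) (sq_nonneg _)
          ((sq_nonneg α).trans h6))
    have b1 := setIntegral_le_shell G.isOpen hσc j1 i1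
      (N := M * (100 * (1 + |c|)) * ((1 + (2 * α * s) ^ 2) * exp (α * s ^ 2) ^ 2))
      (fun p _ h => hL1s _ (left_ne_zero_of_mul h))
      (fun p hp h1 h2 => by
        have h3 := domT_le (u := u) G hα0 hp h1 (by linarith)
        have h4 := (hM (σ p - s)).1
        have h5 := mul_le_mul_of_nonneg_left h3 hcc
        refine (mul_le_mul h4 h5 (mul_nonneg hcc (dom0 p hp)) hM0).trans (le_of_eq (by ring)))
    have b2 := setIntegral_le_shell G.isOpen hσc j2 i2
      (N := M * (100 * (1 + |c|)) * ((1 + (2 * α * (S0 - 1)) ^ 2) * exp (α * (S0 - 1) ^ 2) ^ 2))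
      (fun p _ h => hL2s _ (left_ne_zero_of_mul h))
      (fun p hp h1 h2 => by
        have h3 := domT_le (u := u) G hα0 hp h1 (by linarith)
        have h4 := (hM (S0 - σ p)).1
        have h5 := mul_le_mul_of_nonneg_left h3 hcc
        refine (mul_le_mul h4 h5 (mul_nonneg hcc (dom0 p hp)) hM0).trans (le_of_eq (by ring)))
    exact b0.trans (hfl.trans (add_le_add b1 b2))
  · intro p hp
    change (q (σ p) * (α ^ 2 * (-σ p) * exp (α * σ p ^ 2) ^ 2)) * (Ψ p * u p ^ 2) ≤ _
    by_cases hz : q (σ p) = 0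
    · simp [hz]
    have h2 := hqs _ hz
    have h1 := G.divg_carF hu heq hC0 hV hc hα hp (by linarith) (hK _ h2.2)
    refine (mul_le_mul_of_nonneg_left h1 (win_nonneg s S0 (σ p))).trans' (le_of_eq ?_)
    simp only [hq, conj]; ring
  · intro p hp
    change _ ≤ |deriv smoothTransition (σ p - s)| * (100 * (1 + |c|) * domT A σ Ψ α u p)
      + |deriv smoothTransition (S0 - σ p)| * (100 * (1 + |c|) * domT A σ Ψ α u p)
    have dom0 : 0 ≤ domT A σ Ψ α u p := mul_nonneg (by positivity)
      (add_nonneg (G.psd p hp _) (mul_nonneg (G.Ψ_pos p hp).le (sq_nonneg _)))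
    rw [← add_mul]
    by_cases hz : deriv q (σ p) = 0
    · rw [hz]; simp only [zero_mul, neg_zero]; positivity
    have h2 := deriv_supp hqs _ hz
    refine (neg_le_abs _).trans ?_
    rw [abs_mul]
    exact mul_le_mul (win_deriv _ _ _) (G.carF_dσ hu α c hp (hK' _ h2.2)) (abs_nonneg _) (by positivity)

end Cut
end UCP

end

section

set_option linter.unusedSectionVars false
set_option linter.unusedSimpArgs false
namespace UCP

variable {H : Type*} [NormedAddCommGroup H] [NormedSpace ℝ H] [FiniteDimensional ℝ H]
variable [MeasurableSpace H] [BorelSpace H] {μ : Measure H} [μ.IsAddHaarMeasure]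
variable {U : Set H} {A : H → (H →L[ℝ] ℝ) →L[ℝ] H} {σ Ψ : H → ℝ} {F : H → H} {K Q : ℝ}
variable {u V : H → ℝ} {χ : ℕ → H → ℝ} {S1 : ℝ}

lemma weight_le (α s : ℝ) (hα : 0 ≤ α) : (1 + (2 * α * s) ^ 2) * exp (α * s ^ 2) ^ 2 ≤
    exp (8 * (4 * α ^ 2 + 2 * α)) * exp ((2 * (4 * α ^ 2 + 2 * α)) * (s + 2) ^ 2) := by
  have h1 : 1 + (2 * α * s) ^ 2 ≤ exp ((2 * α * s) ^ 2) := by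
    linarith [add_one_le_exp ((2 * α * s) ^ 2)]
  have h2 : exp (α * s ^ 2) ^ 2 = exp (2 * α * s ^ 2) := by
    rw [← exp_nat_mul]; congr 1; push_cast; ring
  rw [h2, ← exp_add]
  refine (mul_le_mul_of_nonneg_right h1 (exp_pos _).le).trans ?_
  rw [← exp_add]
  refine exp_le_exp.2 ?_
  have h3 : s ^ 2 ≤ 2 * (s + 2) ^ 2 + 8 := by nlinarith [sq_nonneg (s + 4)]
  have h4 := mul_le_mul_of_nonneg_left h3 (show 0 ≤ 4 * α ^ 2 + 2 * α by positivity)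
  linarith

/-- The abstract unique continuation result. -/
theorem core (C : Cut μ U A σ Ψ F u χ S1) (G : Geo U A σ Ψ F K Q) (hu : ContDiffOn ℝ 2 u U)
    (heq : ∀ p ∈ U, divg (gradA A u) p = V p * u p) {C0 : ℝ} (hC0 : 0 ≤ C0)
    (hV : ∀ p ∈ U, |V p| ≤ C0 * Ψ p) (hub : ∀ p ∈ U, |u p| ≤ 1) {S0 : ℝ} (hS : S0 < S1)
    (hS0 : S0 ≤ -1) (hK : ∀ x ≤ S0, K * exp x * (-x) ≤ 1 / 200)
    (hvan : ∀ κ : ℝ, 0 < κ → Tendsto (fun s => exp (κ * s ^ 2) *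
      ∫ p in shell U σ (s - 3) s, Ψ p * u p ^ 2 ∂μ) atBot (nhds 0)) :
    ∀ p ∈ U, σ p < S0 - 2 → u p = 0 := by
  obtain ⟨c, hc⟩ : ∃ c : ℝ, Q = 2 * c + 2 := ⟨(Q - 2) / 2, by ring⟩
  have hK' : ∀ x ≤ S0, K * exp x ≤ 1 / 200 := by
    intro x hx
    refine (hK x hx).trans' ?_
    exact le_mul_of_one_le_right (mul_nonneg G.K_nonneg (exp_pos _).le) (by linarith)
  obtain ⟨C1, hC1, hcac⟩ := C.cacc G hu heq hC0 hV hub hS hK'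
  obtain ⟨N, hN, hcar⟩ := C.carl G hu heq hC0 hV hub hS hS0 hc hK hK'
  have hσc := G.σ_C2.continuousOn
  have Ψu0 : ∀ p ∈ U, 0 ≤ Ψ p * u p ^ 2 := fun p hp =>
    mul_nonneg (G.Ψ_pos p hp).le (sq_nonneg _)
  have en0 : ∀ p ∈ U, 0 ≤ enA A u p := fun p hp => G.psd p hp _
  have iΨ : ∀ a b, b < S1 → IntegrableOn (fun p => Ψ p * u p ^ 2) (shell U σ a b) μ := by
    intro a b hb
    obtain ⟨M, hM⟩ := C.bdd2 G hub (a := a) hb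
    exact C.int_shell G (Cut.Ψu_cont G hu) hb (fun p hp h1 h2 => (hM p hp h1 h2).2)
  have ien : ∀ a b, b < S1 → IntegrableOn (enA A u) (shell U σ a b) μ := by
    intro a b hb
    obtain ⟨M, hM⟩ := C.bdd2 G hub (a := a) hb
    exact C.int_shell G (Cut.en_cont G hu) hb (fun p hp h1 h2 => (hM p hp h1 h2).1)
  set D := ∫ p in shell U σ (S0 - 1) S0, (enA A u p + Ψ p * u p ^ 2) ∂μ with hD
  have I0 : ∀ a b, 0 ≤ ∫ p in shell U σ a b, Ψ p * u p ^ 2 ∂μ := fun a b =>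
    setIntegral_nonneg (meas_shell G.isOpen hσc a b) fun p hp => Ψu0 p hp.1
  have D0 : 0 ≤ D := setIntegral_nonneg (meas_shell G.isOpen hσc _ _) fun p hp =>
    add_nonneg (en0 p hp.1) (Ψu0 p hp.1)
  -- first limit
  have step1 : ∀ α, 10 * (C0 + |c| + 1) ≤ α → ∀ t ≤ S0 - 2,
      α ^ 2 * exp (α * (S0 - 2) ^ 2) ^ 2 * ∫ p in shell U σ t (S0 - 2), Ψ p * u p ^ 2 ∂μ ≤
      N * ((1 + (2 * α * (S0 - 1)) ^ 2) * exp (α * (S0 - 1) ^ 2) ^ 2) * D := by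
    intro α hα t ht
    have hα0 : 0 ≤ α := by linarith [abs_nonneg c]
    have hα1 : 0 < α := by linarith [abs_nonneg c]
    set β := 4 * α ^ 2 + 2 * α with hβ
    have hv := (hvan (2 * β) (by positivity)).comp (tendsto_atBot_add_const_right atBot (2:ℝ) tendsto_id)
    have hv2 := (hv.const_mul (N * exp (8 * β) * (C1 + 1))).add_const
      (N * ((1 + (2 * α * (S0 - 1)) ^ 2) * exp (α * (S0 - 1) ^ 2) ^ 2) * D)
    rw [mul_zero, zero_add] at hv2
    refine ge_of_tendsto hv2 ?_
    filter_upwards [Iic_mem_atBot (t - 1), Iic_mem_atBot (S0 - 2)] with s hs hs2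
    have hs : s ≤ t - 1 := hs
    have hs2 : s ≤ S0 - 2 := hs2
    have h1 := hcar α hα s t (by linarith) ht
    refine h1.trans (add_le_add_left ?_ _)
    simp only [Function.comp, id]
    have h2 := hcac s (by linarith)
    have h3 : ∫ p in shell U σ s (s + 1), Ψ p * u p ^ 2 ∂μ ≤
        ∫ p in shell U σ (s - 1) (s + 2), Ψ p * u p ^ 2 ∂μ := by
      refine setIntegral_mono_set (iΨ _ _ (by linarith)) ?_ (LE.le.eventuallyLE ?_)
      · exact (ae_restrict_iff' (meas_shell G.isOpen hσc _ _)).2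
          (Eventually.of_forall fun p hp => Ψu0 p hp.1)
      · intro p hp
        exact ⟨hp.1, by linarith [hp.2.1], by linarith [hp.2.2]⟩
    have h4 := integral_add (ien s (s + 1) (by linarith)) (iΨ s (s + 1) (by linarith))
    rw [h4]
    have h5 := weight_le α s hα0
    rw [show s + 2 - 3 = s - 1 by ring]
    set J := ∫ p in shell U σ (s - 1) (s + 2), Ψ p * u p ^ 2 ∂μ
    have h6 : (∫ p in shell U σ s (s + 1), enA A u p ∂μ) + (∫ p in shell U σ s (s + 1), Ψ p * u p ^ 2 ∂μ)
      ≤ (C1 + 1) * J := by linarith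
    have hJ : 0 ≤ (C1 + 1) * J := mul_nonneg (by linarith) (I0 _ _)
    calc _ ≤ N * ((1 + (2 * α * s) ^ 2) * exp (α * s ^ 2) ^ 2) * ((C1 + 1) * J) := by gcongr
      _ ≤ N * (exp (8 * β) * exp (2 * β * (s + 2) ^ 2)) * ((C1 + 1) * J) := by gcongr
      _ = _ := by ring
  -- second limit
  have step2 : ∀ t ≤ S0 - 2, ∫ p in shell U σ t (S0 - 2), Ψ p * u p ^ 2 ∂μ = 0 := by
    intro t ht
    refine le_antisymm ?_ (I0 _ _)
    have hlim : Tendsto (fun α : ℝ => N * (1 + 4 * (S0 - 1) ^ 2) * D * exp (-α)) atTop (nhds 0) := by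
      have := (tendsto_exp_neg_atTop_nhds_zero).const_mul (N * (1 + 4 * (S0 - 1) ^ 2) * D)
      rwa [mul_zero] at this
    refine ge_of_tendsto hlim ?_
    filter_upwards [Ici_mem_atTop (10 * (C0 + |c| + 1)), Ici_mem_atTop (1:ℝ)] with α h1 h2
    have h2 : 1 ≤ α := h2
    have h3 := step1 α h1 t ht
    set I := ∫ p in shell U σ t (S0 - 2), Ψ p * u p ^ 2 ∂μ
    have e1 : exp (α * (S0 - 1) ^ 2) ^ 2 ≤ exp (α * (S0 - 2) ^ 2) ^ 2 * exp (-α) := by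
      rw [← exp_nat_mul, ← exp_nat_mul, ← exp_add]
      refine exp_le_exp.2 ?_
      push_cast
      nlinarith
    have e2 : 1 + (2 * α * (S0 - 1)) ^ 2 ≤ α ^ 2 * (1 + 4 * (S0 - 1) ^ 2) := by nlinarith
    have h4 : (α ^ 2 * exp (α * (S0 - 2) ^ 2) ^ 2) * I ≤
        (α ^ 2 * exp (α * (S0 - 2) ^ 2) ^ 2) * (N * (1 + 4 * (S0 - 1) ^ 2) * D * exp (-α)) := by
      refine h3.trans ?_
      calc _ ≤ N * ((α ^ 2 * (1 + 4 * (S0 - 1) ^ 2)) * (exp (α * (S0 - 2) ^ 2) ^ 2 * exp (-α))) * D := by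
            gcongr
        _ = _ := by ring
    exact le_of_mul_le_mul_left h4 (by positivity)
  intro p hp hσ
  have hz := step2 (σ p - 1) (by linarith)
  have hms := meas_shell G.isOpen hσc (σ p - 1) (S0 - 2)
  rw [setIntegral_eq_zero_iff_of_nonneg_ae ((ae_restrict_iff' hms).2
    (Eventually.of_forall fun p hp => Ψu0 p hp.1)) (iΨ _ _ (by linarith))] at hz
  have hO : IsOpen (U ∩ σ ⁻¹' Ioo (σ p - 1) (S0 - 2)) := hσc.isOpen_inter_preimage G.isOpen isOpen_Ioo
  have hsub : U ∩ σ ⁻¹' Ioo (σ p - 1) (S0 - 2) ⊆ shell U σ (σ p - 1) (S0 - 2) := fun x hx =>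
    ⟨hx.1, hx.2.1.le, hx.2.2.le⟩
  have := Measure.eqOn_open_of_ae_eq (ae_restrict_of_ae_restrict_of_subset hsub hz) hO
    ((Cut.Ψu_cont G hu).mono inter_subset_left) continuousOn_const
  have h0 := this (show p ∈ _ from ⟨hp, by linarith, hσ⟩)
  simp only [Pi.zero_apply] at h0
  rcases mul_eq_zero.1 h0 with h | h
  · exact absurd h (G.Ψ_pos p hp).ne'
  · exact pow_eq_zero_iff two_ne_zero |>.1 h

end UCP

end

section

set_option linter.unusedSectionVars false
set_option linter.unusedSimpArgs false
set_option maxSynthPendingDepth 3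
namespace UCP

lemma exists_S0 (K S1 : ℝ) : ∃ S0 < S1, S0 ≤ -1 ∧ ∀ x ≤ S0, K * exp x * (-x) ≤ 1 / 200 := by
  have h := (tendsto_pow_mul_exp_neg_atTop_nhds_zero 1).const_mul K
  rw [mul_zero] at h
  have h2 := h.eventually (gt_mem_nhds (show (0:ℝ) < 1 / 200 by norm_num))
  obtain ⟨T, hT⟩ := eventually_atTop.1 h2
  refine ⟨min (-T) (min (S1 - 1) (-1)), ?_, ?_, ?_⟩
  · exact ((min_le_right _ _).trans (min_le_left _ _)).trans_lt (by linarith)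
  · exact (min_le_right _ _).trans (min_le_right _ _)
  · intro x hx
    have := hT (-x) (by linarith [hx.trans (min_le_left _ _)])
    rw [neg_neg, pow_one] at this
    linarith

variable {H : Type*} [NormedAddCommGroup H] [NormedSpace ℝ H] [FiniteDimensional ℝ H]

lemma exists_trace_bound (H : Type*) [NormedAddCommGroup H] [NormedSpace ℝ H]
    [FiniteDimensional ℝ H] : ∃ t : ℝ, 0 ≤ t ∧ ∀ T : H →L[ℝ] H,
    |LinearMap.trace ℝ H (T : H →ₗ[ℝ] H)| ≤ t * ‖T‖ := by
  let L : (H →L[ℝ] H) →ₗ[ℝ] ℝ := (LinearMap.trace ℝ H).comp (ContinuousLinearMap.coeLM ℝ)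
  refine ⟨‖LinearMap.toContinuousLinearMap L‖, norm_nonneg (LinearMap.toContinuousLinearMap L), fun T => ?_⟩
  exact (LinearMap.toContinuousLinearMap L).le_opNorm T

/-- Local ellipticity data with a fixed center. -/
structure Ell (A : H → (H →L[ℝ] ℝ) →L[ℝ] H) (p1 : H) (G : H →L[ℝ] (H →L[ℝ] ℝ)) (M r : ℝ) : Prop where
  hM : 1 ≤ M
  r0 : 0 < r
  r1 : r ≤ 1
  C1 : ContDiffOn ℝ 1 A (Metric.ball p1 r)
  symm : ∀ x ∈ Metric.ball p1 r, ∀ ξ η : H →L[ℝ] ℝ, ξ (A x η) = η (A x ξ)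
  coer : ∀ x ∈ Metric.ball p1 r, ∀ ξ : H →L[ℝ] ℝ, ‖ξ‖ ^ 2 ≤ M * ξ (A x ξ)
  bd : ∀ x ∈ Metric.ball p1 r, ‖A x‖ ≤ M
  bdD : ∀ x ∈ Metric.ball p1 r, ‖fderiv ℝ A x‖ ≤ M
  inv : ∀ y, A p1 (G y) = y

/-- squared distance -/
def eR (G : H →L[ℝ] (H →L[ℝ] ℝ)) (p1 x : H) : ℝ := G (x - p1) (x - p1)

/-- domain -/
def eU (G : H →L[ℝ] (H →L[ℝ] ℝ)) (p1 : H) (M r : ℝ) : Set H :=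
  {x | x ≠ p1 ∧ eR G p1 x < (r / M ^ 2) ^ 2}

variable {A : H → (H →L[ℝ] ℝ) →L[ℝ] H} {p1 : H} {G : H →L[ℝ] (H →L[ℝ] ℝ)} {M r : ℝ}

lemma eR_contDiff : ContDiff ℝ 2 (eR G p1) := by
  unfold eR
  exact (G.contDiff.comp (contDiff_id.sub contDiff_const)).clm_apply (contDiff_id.sub contDiff_const)

lemma abs_clm2_le (ξ : H →L[ℝ] ℝ) (T : (H →L[ℝ] ℝ) →L[ℝ] H) (η : H →L[ℝ] ℝ) {a b c : ℝ}
    (h1 : ‖ξ‖ ≤ a) (h2 : ‖T‖ ≤ b) (h3 : ‖η‖ ≤ c) : |ξ (T η)| ≤ a * (b * c) :=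
  ξ.le_of_opNorm_le_of_le h1 (T.le_of_opNorm_le_of_le h2 h3)

lemma pos_of_mul_nonneg {H : Type*} [NormedAddCommGroup H] [NormedSpace ℝ H] {ξ : H →L[ℝ] ℝ} {z : ℝ}
    (M : ℝ) (hM : 1 ≤ M) (h : ‖ξ‖ ^ 2 ≤ M * z) : 0 ≤ z := by
  have h1 : 0 ≤ M * z := (sq_nonneg _).trans h
  exact nonneg_of_mul_nonneg_right h1 (by linarith)

namespace Ell

lemma mem0 (e : Ell A p1 G M r) : p1 ∈ Metric.ball p1 r := Metric.mem_ball_self e.r0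

lemma Gsymm (e : Ell A p1 G M r) (x y : H) : G x y = G y x := by
  have := e.symm p1 e.mem0 (G x) (G y)
  rwa [e.inv, e.inv] at this

lemma G_norm (e : Ell A p1 G M r) (y : H) : ‖G y‖ ≤ M * ‖y‖ := by
  have h := e.coer p1 e.mem0 (G y)
  rw [e.inv] at h
  have h1 : G y y ≤ ‖G y‖ * ‖y‖ := (le_abs_self _).trans ((G y).le_opNorm y)
  by_contra hcon
  rw [not_le] at hcon
  have hM := e.hM
  have : 0 ≤ M * ‖y‖ := by positivity
  nlinarith [mul_le_mul_of_nonneg_left h1 (show 0 ≤ M by linarith)]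

lemma low (e : Ell A p1 G M r) (y : H) : ‖y‖ ^ 2 ≤ M ^ 3 * G y y := by
  have h := e.coer p1 e.mem0 (G y)
  rw [e.inv] at h
  have h1 : ‖y‖ ≤ M * ‖G y‖ := by
    have := (A p1).le_of_opNorm_le (e.bd p1 e.mem0) (G y)
    rwa [e.inv] at this
  have hM := e.hM
  calc ‖y‖ ^ 2 ≤ (M * ‖G y‖) ^ 2 := by gcongr
    _ = M ^ 2 * ‖G y‖ ^ 2 := by ring
    _ ≤ M ^ 2 * (M * G y y) := by gcongr
    _ = _ := by ring

lemma pos (e : Ell A p1 G M r) {x : H} (hx : x ≠ p1) : 0 < eR G p1 x := by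
  have h := e.low (x - p1)
  have h2 : 0 < ‖x - p1‖ := norm_pos_iff.2 (sub_ne_zero.2 hx)
  have h3 : 0 < M ^ 3 * eR G p1 x := lt_of_lt_of_le (by positivity) h
  have hM := e.hM
  exact pos_of_mul_pos_right h3 (by positivity)

lemma isOpen (_e : Ell A p1 G M r) : IsOpen (eU G p1 M r) :=
  isOpen_ne.inter (isOpen_lt eR_contDiff.continuous continuous_const)

lemma sub (e : Ell A p1 G M r) : eU G p1 M r ⊆ Metric.ball p1 r := by
  intro x hx
  have h := e.low (x - p1)
  have hM := e.hM
  have h2 : M ^ 3 * G (x - p1) (x - p1) < M ^ 3 * (r / M ^ 2) ^ 2 :=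
    mul_lt_mul_of_pos_left hx.2 (by positivity)
  have h3 : M ^ 3 * (r / M ^ 2) ^ 2 = r ^ 2 / M := by field_simp
  have h4 : r ^ 2 / M ≤ r ^ 2 := div_le_self (by positivity) hM
  rw [mem_ball_iff_norm]
  exact lt_of_pow_lt_pow_left₀ 2 e.r0.le (by linarith)

lemma hasF_R (e : Ell A p1 G M r) (x : H) :
    HasFDerivAt (eR G p1) ((2:ℝ) • G (x - p1)) x := by
  have h0 : HasFDerivAt (fun x => x - p1) (ContinuousLinearMap.id ℝ H) x :=
    (hasFDerivAt_id x).sub_const p1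
  have h1 : HasFDerivAt (fun x => G (x - p1)) (G.comp (ContinuousLinearMap.id ℝ H)) x :=
    G.hasFDerivAt.comp x h0
  have h2 := h1.clm_apply h0
  refine h2.congr_fderiv ?_
  ext h
  simp [e.Gsymm h]
  ring

lemma hasF_σ (e : Ell A p1 G M r) {x : H} (hx : x ≠ p1) :
    HasFDerivAt (fun x => 1 / 2 * log (eR G p1 x)) ((eR G p1 x)⁻¹ • G (x - p1)) x := by
  refine (((e.hasF_R x).log (e.pos hx).ne').const_mul (1/2)).congr_fderiv ?_
  ext h; simp; ring

lemma hasF_Ψ (e : Ell A p1 G M r) {x : H} (hx : x ≠ p1) :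
    HasFDerivAt (fun x => (eR G p1 x)⁻¹) ((-2 * ((eR G p1 x)⁻¹) ^ 2) • G (x - p1)) x := by
  refine ((hasDerivAt_inv (e.pos hx).ne').comp_hasFDerivAt x (e.hasF_R x)).congr_fderiv ?_
  ext h; simp; ring

lemma exp_σ (e : Ell A p1 G M r) {x : H} (hx : x ≠ p1) :
    exp (1 / 2 * log (eR G p1 x)) ^ 2 = eR G p1 x := by
  rw [← exp_nat_mul]; push_cast
  rw [show 2 * (1 / 2 * log (eR G p1 x)) = log (eR G p1 x) by ring, exp_log (e.pos hx)]

lemma norm_le (e : Ell A p1 G M r) {x : H} (hx : x ≠ p1) :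
    ‖x - p1‖ ≤ M ^ 2 * exp (1 / 2 * log (eR G p1 x)) := by
  have h := e.low (x - p1)
  have h2 := e.exp_σ hx
  have hM := e.hM
  have h3 := e.pos hx
  refine le_of_sq_le_sq ?_ (by positivity)
  rw [mul_pow, h2]
  refine h.trans ?_
  change M ^ 3 * eR G p1 x ≤ _
  rw [← pow_mul]
  gcongr
  norm_num

end Ell
end UCP

end

section

set_option linter.unusedSectionVars false
set_option linter.unusedSimpArgs false
set_option maxSynthPendingDepth 3
namespace UCP

variable {H : Type*} [NormedAddCommGroup H] [NormedSpace ℝ H] [FiniteDimensional ℝ H]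
variable {A : H → (H →L[ℝ] ℝ) →L[ℝ] H} {p1 : H} {G : H →L[ℝ] (H →L[ℝ] ℝ)} {M r : ℝ}

namespace Ell

lemma lip (e : Ell A p1 G M r) {x : H} (hx : x ∈ Metric.ball p1 r) :
    ‖A x - A p1‖ ≤ M * ‖x - p1‖ := by
  refine Convex.norm_image_sub_le_of_norm_fderiv_le (𝕜 := ℝ) (s := Metric.ball p1 r) ?_ e.bdD
    (convex_ball _ _) e.mem0 hx
  intro y hy
  exact (e.C1.differentiableOn one_ne_zero).differentiableAt (Metric.isOpen_ball.mem_nhds hy)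

/-- the field -/
def eF (A : H → (H →L[ℝ] ℝ) →L[ℝ] H) (G : H →L[ℝ] (H →L[ℝ] ℝ)) (p1 x : H) : H :=
  A x (G (x - p1))

lemma hasF_F (e : Ell A p1 G M r) {x : H} (hx : x ∈ Metric.ball p1 r) :
    ∃ T : H →L[ℝ] H, HasFDerivAt (eF A G p1) T x ∧ ∀ h, T h = A x (G h) + fderiv ℝ A x h (G (x - p1)) := by
  have h0 : HasFDerivAt (fun x => x - p1) (ContinuousLinearMap.id ℝ H) x :=
    (hasFDerivAt_id x).sub_const p1
  have h1 : HasFDerivAt (fun x => G (x - p1)) (G.comp (ContinuousLinearMap.id ℝ H)) x :=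
    G.hasFDerivAt.comp x h0
  have hA := ((e.C1.differentiableOn one_ne_zero).differentiableAt
    (Metric.isOpen_ball.mem_nhds hx)).hasFDerivAt
  exact ⟨_, hA.clm_apply h1, fun h => by simp⟩

set_option maxHeartbeats 800000 in
lemma geo (e : Ell A p1 G M r) {t : ℝ} (ht : 0 ≤ t)
    (htr : ∀ T : H →L[ℝ] H, |LinearMap.trace ℝ H (T : H →ₗ[ℝ] H)| ≤ t * ‖T‖) :
    Geo (eU G p1 M r) A (fun x => 1 / 2 * log (eR G p1 x)) (fun x => (eR G p1 x)⁻¹) (eF A G p1)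
      ((5 + 2 * t) * M ^ 12 * M ^ 2) (Module.finrank ℝ H) := by
  have hM := e.hM
  have hM0 : 0 ≤ M := by linarith
  have hpow : ∀ {i j : ℕ}, i ≤ j → M ^ i ≤ M ^ j := fun h => pow_le_pow_right₀ hM h
  have hAd : ∀ x ∈ eU G p1 M r, DifferentiableAt ℝ A x := fun x hx =>
    (e.C1.differentiableOn one_ne_zero).differentiableAt (Metric.isOpen_ball.mem_nhds (e.sub hx))
  -- basic bounds
  have hK : ∀ x ∈ eU G p1 M r, ∀ z : ℝ, |z| ≤ (5 + 2 * t) * M ^ 12 * ‖x - p1‖ →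
      |z| ≤ (5 + 2 * t) * M ^ 12 * M ^ 2 * exp (1 / 2 * log (eR G p1 x)) := by
    intro x hx z hz
    refine hz.trans ?_
    rw [mul_assoc _ (M ^ 2)]
    exact mul_le_mul_of_nonneg_left (e.norm_le hx.1) (by positivity)
  have hGy : ∀ x, ‖G (x - p1)‖ ≤ M * ‖x - p1‖ := fun x => e.G_norm _
  have hY : ∀ x ∈ eU G p1 M r, ‖(A x - A p1) (G (x - p1))‖ ≤ M ^ 2 * ‖x - p1‖ ^ 2 := by
    intro x hx
    refine ((A x - A p1).le_of_opNorm_le_of_le (e.lip (e.sub hx)) (hGy x)).trans (le_of_eq (by ring))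
  have hFb : ∀ x ∈ eU G p1 M r, ‖eF A G p1 x‖ ≤ M ^ 2 * ‖x - p1‖ := by
    intro x hx
    refine ((A x).le_of_opNorm_le_of_le (e.bd x (e.sub hx)) (hGy x)).trans (le_of_eq (by ring))
  have hFY : ∀ x, eF A G p1 x = (x - p1) + (A x - A p1) (G (x - p1)) := by
    intro x; rw [eF, sub_apply, e.inv]; abel
  have hΨ : ∀ x ∈ eU G p1 M r, (eR G p1 x)⁻¹ * ‖x - p1‖ ^ 2 ≤ M ^ 3 := by
    intro x hx
    rw [inv_mul_le_iff₀ (e.pos hx.1), mul_comm]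
    exact e.low _
  have hy1 : ∀ x ∈ eU G p1 M r, ‖x - p1‖ ≤ 1 := by
    intro x hx
    have := e.sub hx
    rw [mem_ball_iff_norm] at this
    linarith [e.r1]
  have hb : ∀ x ∈ eU G p1 M r, |(eR G p1 x)⁻¹ * G (x - p1) ((A x - A p1) (G (x - p1)))|
      ≤ M ^ 6 * ‖x - p1‖ := by
    intro x hx
    have hp := inv_pos.2 (e.pos hx.1)
    rw [abs_mul, abs_of_pos hp]
    have h1 := (G (x - p1)).le_of_opNorm_le_of_le (hGy x) (hY x hx)
    calc _ ≤ (eR G p1 x)⁻¹ * (M * ‖x - p1‖ * (M ^ 2 * ‖x - p1‖ ^ 2)) :=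
          mul_le_mul_of_nonneg_left h1 hp.le
      _ = ((eR G p1 x)⁻¹ * ‖x - p1‖ ^ 2) * (M ^ 3 * ‖x - p1‖) := by ring
      _ ≤ M ^ 3 * (M ^ 3 * ‖x - p1‖) := mul_le_mul_of_nonneg_right (hΨ x hx) (by positivity)
      _ = _ := by ring
  have hBe : ∀ x ∈ eU G p1 M r, fderiv ℝ (fun x => 1 / 2 * log (eR G p1 x)) x (eF A G p1 x)
      = 1 + (eR G p1 x)⁻¹ * G (x - p1) ((A x - A p1) (G (x - p1))) := by
    intro x hx
    rw [(e.hasF_σ hx.1).fderiv, hFY]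
    simp only [smul_apply, map_add, smul_eq_mul]
    have : (eR G p1 x)⁻¹ * (G (x - p1)) (x - p1) = 1 := inv_mul_cancel₀ (e.pos hx.1).ne'
    rw [this]
  have c1 : ContDiffOn ℝ 2 (fun x => 1 / 2 * log (eR G p1 x)) (eU G p1 M r) :=
    contDiffOn_const.mul (eR_contDiff.contDiffOn.log fun x hx => (e.pos hx.1).ne')
  have c2 : ContDiffOn ℝ 1 (fun x => (eR G p1 x)⁻¹) (eU G p1 M r) :=
    (eR_contDiff.of_le (by norm_num)).contDiffOn.inv fun x hx => (e.pos hx.1).ne'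
  have c3 : ContDiffOn ℝ 1 (eF A G p1) (eU G p1 M r) :=
    (e.C1.mono e.sub).clm_apply (G.contDiff.comp (contDiff_id.sub contDiff_const)).contDiffOn
  refine ⟨e.isOpen, by positivity, e.C1.mono e.sub, c2, c3, c1,
    fun x hx => e.symm x (e.sub hx), ?_, fun x hx => inv_pos.2 (e.pos hx.1), ?_, ?_, ?_, ?_, ?_, ?_⟩
  · intro x hx ξ
    have := e.coer x (e.sub hx) ξ
    exact pos_of_mul_nonneg M hM this
  · intro x hx
    rw [(e.hasF_σ hx.1).fderiv, map_smul]; rfl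
  · intro x hx
    refine hK x hx _ ?_
    rw [hBe x hx, add_sub_cancel_left]
    refine (hb x hx).trans (mul_le_mul_of_nonneg_right ?_ (norm_nonneg _))
    nlinarith [hpow (show 6 ≤ 12 by norm_num), pow_pos (show 0 < M by linarith) 12]
  · intro x hx
    refine hK x hx _ ?_
    obtain ⟨T, hT, hTe⟩ := e.hasF_F (e.sub hx)
    have e1 : divg (eF A G p1) x - (Module.finrank ℝ H : ℝ) =
        LinearMap.trace ℝ H ((T - ContinuousLinearMap.id ℝ H : H →L[ℝ] H) : H →ₗ[ℝ] H) := by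
      have e2 : ((T - ContinuousLinearMap.id ℝ H : H →L[ℝ] H) : H →ₗ[ℝ] H) = (T : H →ₗ[ℝ] H) - LinearMap.id := rfl
      rw [HasFDerivAt.divg_eq hT, e2, map_sub, LinearMap.trace_id]
    rw [e1]
    have e3 : ‖T - ContinuousLinearMap.id ℝ H‖ ≤ 2 * M ^ 2 * ‖x - p1‖ := by
      refine ContinuousLinearMap.opNorm_le_bound _ (by positivity) fun h => ?_
      have e4 : (T - ContinuousLinearMap.id ℝ H) h = (A x - A p1) (G h) + fderiv ℝ A x h (G (x - p1)) := by
        simp [hTe, e.inv]; abel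
      rw [e4]
      refine (norm_add_le _ _).trans ?_
      have h1 := (A x - A p1).le_of_opNorm_le_of_le (e.lip (e.sub hx)) (e.G_norm h)
      have h2 := (fderiv ℝ A x h).le_of_opNorm_le_of_le
        ((fderiv ℝ A x).le_of_opNorm_le (e.bdD x (e.sub hx)) h) (hGy x)
      linarith
    refine (htr _).trans ((mul_le_mul_of_nonneg_left e3 ht).trans ?_)
    have h2 : t * M ^ 2 ≤ t * M ^ 12 := mul_le_mul_of_nonneg_left (hpow (by norm_num)) ht
    have h3 : 0 ≤ M ^ 12 := by positivity
    have : t * (2 * M ^ 2) ≤ (5 + 2 * t) * M ^ 12 := by linarith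
    have := mul_le_mul_of_nonneg_right this (norm_nonneg (x - p1))
    linarith
  · intro x hx
    have hp := inv_pos.2 (e.pos hx.1)
    have e1 : fderiv ℝ (fun x => (eR G p1 x)⁻¹) x (eF A G p1 x) + 2 * (eR G p1 x)⁻¹ =
        (-2 * ((eR G p1 x)⁻¹ * G (x - p1) ((A x - A p1) (G (x - p1))))) * (eR G p1 x)⁻¹ := by
      have h1 := hBe x hx
      rw [(e.hasF_σ hx.1).fderiv] at h1
      rw [(e.hasF_Ψ hx.1).fderiv]
      simp only [smul_apply, smul_eq_mul] at h1 ⊢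
      linear_combination (-2 * (eR G p1 x)⁻¹) * h1
    rw [e1, abs_mul, abs_of_pos hp]
    refine mul_le_mul_of_nonneg_right (hK x hx _ ?_) hp.le
    rw [abs_mul]
    have h1 := hb x hx
    have h2 : |(-2:ℝ)| = 2 := by norm_num
    rw [h2]
    have h3 : 2 * M ^ 6 ≤ (5 + 2 * t) * M ^ 12 := by
      nlinarith [hpow (show 6 ≤ 12 by norm_num), pow_pos (show 0 < M by linarith) 12]
    have := mul_le_mul_of_nonneg_right h3 (norm_nonneg (x - p1))
    linarith
  · intro x hx
    refine hK x hx _ ?_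
    have hp := inv_pos.2 (e.pos hx.1)
    obtain ⟨T, hT, hTe⟩ := e.hasF_F (e.sub hx)
    have hev : (fun q => fderiv ℝ (fun x => 1 / 2 * log (eR G p1 x)) q (eF A G p1 q)) =ᶠ[nhds x]
        fun q => (eR G p1 q)⁻¹ * G (q - p1) (eF A G p1 q) := by
      filter_upwards [e.isOpen.mem_nhds hx] with q hq
      rw [(e.hasF_σ hq.1).fderiv]; rfl
    have h0 : HasFDerivAt (fun x => x - p1) (ContinuousLinearMap.id ℝ H) x :=
      (hasFDerivAt_id x).sub_const p1
    have h1 : HasFDerivAt (fun x => G (x - p1)) (G.comp (ContinuousLinearMap.id ℝ H)) x :=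
      G.hasFDerivAt.comp x h0
    have hd := (e.hasF_Ψ hx.1).fun_mul (h1.clm_apply hT)
    rw [hev.fderiv_eq, hd.fderiv]
    set P := (eR G p1 x)⁻¹ with hP
    set y := x - p1 with hy
    set Y := (A x - A p1) (G y) with hYd
    have k1 : P * G y y = 1 := inv_mul_cancel₀ (e.pos hx.1).ne'
    have k2 : A x (G (eF A G p1 x)) = A x (G (eF A G p1 x)) := rfl
    have k3 : G y (A x (G (eF A G p1 x))) = G (eF A G p1 x) (eF A G p1 x) := by
      rw [e.symm x (e.sub hx)]; rfl
    set D := G y (fderiv ℝ A x (eF A G p1 x) (G y)) with hDd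
    have e1 : (P • ((G y).comp T + (G.comp (ContinuousLinearMap.id ℝ H)).flip (eF A G p1 x)) +
        G y (eF A G p1 x) • ((-2 * P ^ 2) • G y)) (eF A G p1 x) =
        -2 * (P * G y Y) ^ 2 + 2 * (P * G Y Y) + P * D := by
      simp only [add_apply, smul_apply, ContinuousLinearMap.comp_apply, smul_eq_mul,
        ContinuousLinearMap.flip_apply, ContinuousLinearMap.id_apply, hTe, map_add, k3]
      rw [← hDd, hFY x, ← hy, ← hYd]
      simp only [map_add, add_apply, e.Gsymm Y y]
      linear_combination (-2 * P * G y y - 4 * P * G y Y) * k1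
    rw [e1]
    have b1 := hb x hx
    have b2 : P * |G Y Y| ≤ M ^ 8 * ‖y‖ := by
      have h1 := (G Y).le_of_opNorm_le_of_le (e.G_norm Y) (le_refl ‖Y‖)
      have h2 := hY x hx
      have h3 := hΨ x hx
      have h4 := hy1 x hx
      calc P * |G Y Y| ≤ P * (M * ‖Y‖ * ‖Y‖) := mul_le_mul_of_nonneg_left h1 hp.le
        _ ≤ P * (M * (M ^ 2 * ‖y‖ ^ 2) * (M ^ 2 * ‖y‖ ^ 2)) := by gcongr
        _ = (P * ‖y‖ ^ 2) * (M ^ 5 * (‖y‖ * ‖y‖)) := by ring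
        _ ≤ M ^ 3 * (M ^ 5 * (1 * ‖y‖)) := by gcongr
        _ = _ := by ring
    have b3 : P * |D| ≤ M ^ 8 * ‖y‖ := by
      have h1 := abs_clm2_le (G y) (fderiv ℝ A x (eF A G p1 x)) (G y) (hGy x)
        ((fderiv ℝ A x).le_of_opNorm_le_of_le (e.bdD x (e.sub hx)) (hFb x hx)) (hGy x)
      calc P * |D| ≤ P * (M * ‖y‖ * (M * (M ^ 2 * ‖y‖) * (M * ‖y‖))) :=
            mul_le_mul_of_nonneg_left h1 hp.le
        _ = (P * ‖y‖ ^ 2) * (M ^ 5 * ‖y‖) := by ring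
        _ ≤ M ^ 3 * (M ^ 5 * ‖y‖) := mul_le_mul_of_nonneg_right (hΨ x hx) (by positivity)
        _ = _ := by ring
    have b4 : (P * G y Y) ^ 2 ≤ M ^ 12 * ‖y‖ := by
      rw [← sq_abs]
      calc |P * G y Y| ^ 2 ≤ (M ^ 6 * ‖y‖) ^ 2 := by gcongr
        _ = M ^ 12 * (‖y‖ * ‖y‖) := by ring
        _ ≤ M ^ 12 * (1 * ‖y‖) := by
          have := hy1 x hx
          gcongr
        _ = _ := by ring
    have h8 : M ^ 8 * ‖y‖ ≤ M ^ 12 * ‖y‖ := mul_le_mul_of_nonneg_right (hpow (by norm_num)) (norm_nonneg _)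
    have h9 : 0 ≤ t * (M ^ 12 * ‖y‖) := by positivity
    refine (abs_add_le _ _).trans ((add_le_add_left (abs_add_le _ _) _).trans ?_)
    rw [abs_mul, abs_mul, abs_mul P, abs_mul P, abs_of_pos hp, abs_of_nonneg (sq_nonneg (P * G y Y))]
    have h2 : |(-2:ℝ)| = 2 := by norm_num
    have h2' : |(2:ℝ)| = 2 := by norm_num
    rw [h2, h2']
    linarith
  · intro x hx ξ
    have hcoer := e.coer x (e.sub hx) ξ
    obtain ⟨T, hT, hTe⟩ := e.hasF_F (e.sub hx)
    have e1 : ξ (fderiv ℝ (eF A G p1) x (A x ξ)) - 1 / 2 * ξ (fderiv ℝ A x (eF A G p1 x) ξ) - ξ (A x ξ)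
        = ξ ((A x - A p1) (G (A x ξ))) + ξ (fderiv ℝ A x (A x ξ) (G (x - p1)))
          - 1 / 2 * ξ (fderiv ℝ A x (eF A G p1 x) ξ) := by
      simp only [hT.fderiv, hTe, map_add, map_sub, sub_apply, e.inv]; ring
    rw [e1]
    have hAξ := (A x).le_of_opNorm_le (e.bd x (e.sub hx)) ξ
    have b1 := abs_clm2_le ξ (A x - A p1) (G (A x ξ)) le_rfl (e.lip (e.sub hx))
      ((e.G_norm _).trans (mul_le_mul_of_nonneg_left hAξ hM0))
    have b2 := abs_clm2_le ξ (fderiv ℝ A x (A x ξ)) (G (x - p1)) le_rfl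
      ((fderiv ℝ A x).le_of_opNorm_le_of_le (e.bdD x (e.sub hx)) hAξ) (hGy x)
    have b3 := abs_clm2_le ξ (fderiv ℝ A x (eF A G p1 x)) ξ le_rfl
      ((fderiv ℝ A x).le_of_opNorm_le_of_le (e.bdD x (e.sub hx)) (hFb x hx)) le_rfl
    have b4 : |ξ ((A x - A p1) (G (A x ξ))) + ξ (fderiv ℝ A x (A x ξ) (G (x - p1)))
          - 1 / 2 * ξ (fderiv ℝ A x (eF A G p1 x) ξ)| ≤ 3 * M ^ 3 * ‖x - p1‖ * ‖ξ‖ ^ 2 := by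
      have := abs_nonneg (ξ (fderiv ℝ A x (eF A G p1 x) ξ))
      refine (abs_sub _ _).trans ?_
      have b5 := abs_add_le (ξ ((A x - A p1) (G (A x ξ)))) (ξ (fderiv ℝ A x (A x ξ) (G (x - p1))))
      rw [abs_mul, show |(1/2:ℝ)| = 1/2 by norm_num]
      linarith
    have hE0 : 0 ≤ ξ (A x ξ) := pos_of_mul_nonneg M hM hcoer
    have hk := hK x hx ((5 + 2 * t) * M ^ 12 * ‖x - p1‖) (le_of_eq (abs_of_nonneg (by positivity)))
    rw [abs_of_nonneg (by positivity)] at hk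
    refine b4.trans ?_
    calc 3 * M ^ 3 * ‖x - p1‖ * ‖ξ‖ ^ 2 ≤ 3 * M ^ 3 * ‖x - p1‖ * (M * ξ (A x ξ)) := by gcongr
      _ = (3 * M ^ 4) * ‖x - p1‖ * ξ (A x ξ) := by ring
      _ ≤ ((5 + 2 * t) * M ^ 12) * ‖x - p1‖ * ξ (A x ξ) := by
        gcongr
        · linarith
        · norm_num
      _ ≤ _ := mul_le_mul_of_nonneg_right hk hE0

end Ell
end UCP

end

section

set_option linter.unusedSectionVars false
set_option linter.unusedSimpArgs false
set_option maxSynthPendingDepth 3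
namespace UCP

variable {H : Type*} [NormedAddCommGroup H] [NormedSpace ℝ H] [FiniteDimensional ℝ H]
variable [MeasurableSpace H] [BorelSpace H] {μ : Measure H} [μ.IsAddHaarMeasure]
variable {A : H → (H →L[ℝ] ℝ) →L[ℝ] H} {p1 : H} {G : H →L[ℝ] (H →L[ℝ] ℝ)} {M r : ℝ}

/-- closed ellipsoidal shell -/
def eC (G : H →L[ℝ] (H →L[ℝ] ℝ)) (p1 : H) (s S : ℝ) : Set H :=
  {x | exp s ^ 2 ≤ eR G p1 x ∧ eR G p1 x ≤ exp S ^ 2}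

namespace Ell

lemma eC_compact (e : Ell A p1 G M r) (s S : ℝ) : IsCompact (eC G p1 s S) := by
  refine Metric.isCompact_of_isClosed_isBounded ?_ ?_
  · exact (isClosed_le continuous_const eR_contDiff.continuous).inter
      (isClosed_le eR_contDiff.continuous continuous_const)
  · refine (Metric.isBounded_closedBall (x := p1) (r := M ^ 2 * exp S)).subset ?_
    intro x hx
    rw [mem_closedBall_iff_norm]
    have hM := e.hM
    refine le_of_sq_le_sq ?_ (by positivity)
    refine (e.low (x - p1)).trans ?_
    calc M ^ 3 * eR G p1 x ≤ M ^ 3 * exp S ^ 2 := by gcongr; exact hx.2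
      _ ≤ M ^ 4 * exp S ^ 2 := by gcongr <;> norm_num
      _ = _ := by ring

lemma eC_sub (e : Ell A p1 G M r) {s S : ℝ} (hS : S < log (r / M ^ 2)) :
    eC G p1 s S ⊆ eU G p1 M r := by
  intro x hx
  have hM := e.hM
  have hr := e.r0
  refine ⟨?_, hx.2.trans_lt ?_⟩
  · rintro rfl
    have := hx.1
    simp only [eR, sub_self, map_zero] at this
    have h2 := exp_pos s
    nlinarith
  · have : exp S < r / M ^ 2 := by rwa [lt_log_iff_exp_lt (by positivity)] at hS
    gcongr

lemma mem_eC (e : Ell A p1 G M r) {s S : ℝ} {x : H} (hx : x ∈ eU G p1 M r)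
    (h1 : s ≤ 1 / 2 * log (eR G p1 x)) (h2 : 1 / 2 * log (eR G p1 x) ≤ S) : x ∈ eC G p1 s S := by
  refine ⟨?_, ?_⟩
  · rw [← e.exp_σ hx.1]
    have := exp_le_exp.2 h1
    gcongr
  · rw [← e.exp_σ hx.1]
    have := exp_le_exp.2 h2
    gcongr

lemma cut (e : Ell A p1 G M r) {u : H → ℝ} {F : H → H}
    (hu : ContDiffOn ℝ 2 u (eU G p1 M r)) :
    Cut μ (eU G p1 M r) A (fun x => 1/2*log (eR G p1 x)) (fun x => (eR G p1 x)⁻¹) F u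
      (fun _ _ => 1) (log (r / M ^ 2)) := by
  have hz : ∀ p, fderiv ℝ (fun _ : H => (1:ℝ)) p = 0 := fun p => by simp
  refine ⟨fun _ => contDiffOn_const, fun _ _ _ => zero_le_one, fun _ _ _ => le_rfl, ?_, ?_, ?_, ?_, ?_, ?_, ?_⟩
  · intro p hp
    exact Eventually.of_forall fun n => ⟨rfl, hz p⟩
  · intro n s S hS
    refine ⟨eC G p1 s S, e.eC_compact s S, e.eC_sub hS, ?_⟩
    intro p hp h1 h2 h3
    exact absurd (e.mem_eC hp h1 h2) h3
  · intro s S hS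
    have hfu : ContinuousOn (fderiv ℝ u) (eU G p1 M r) :=
      hu.continuousOn_fderiv_of_isOpen e.isOpen (by norm_num)
    have hc : ContinuousOn (enA A u) (eC G p1 s S) :=
      (hfu.clm_apply ((e.C1.mono e.sub).continuousOn.clm_apply hfu)).mono (e.eC_sub hS)
    obtain ⟨M1, hM1⟩ := (e.eC_compact s S).exists_bound_of_continuousOn hc
    refine ⟨max (max ((exp s ^ 2)⁻¹) M1) 0, ?_⟩
    intro p hp h1 h2
    have hm := e.mem_eC hp h1 h2
    refine ⟨?_, ?_, ?_⟩
    · refine le_trans ?_ ((le_max_left _ _).trans (le_max_left _ _))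
      have := hm.1
      exact inv_anti₀ (by positivity) this
    · exact ((le_abs_self _).trans (hM1 p hm)).trans ((le_max_right _ _).trans (le_max_left _ _))
    · intro n
      rw [hz]; simp
  · intro s S hS
    refine lt_of_le_of_lt (measure_mono ?_) (e.eC_compact s S).measure_lt_top
    intro x hx
    exact e.mem_eC hx.1 hx.2.1 hx.2.2
  all_goals
    intro q _ _
    simp

end Ell

lemma exists_inv (T : (H →L[ℝ] ℝ) →L[ℝ] H) (hT : ∀ ξ, T ξ = 0 → ξ = 0) :
    ∃ G : H →L[ℝ] (H →L[ℝ] ℝ), ∀ y, T (G y) = y := by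
  have hinj : Function.Injective (T : (H →L[ℝ] ℝ) →ₗ[ℝ] H) := by
    rw [← LinearMap.ker_eq_bot, LinearMap.ker_eq_bot']
    exact hT
  have hfr : Module.finrank ℝ (H →L[ℝ] ℝ) = Module.finrank ℝ H := by
    rw [← (LinearMap.toContinuousLinearMap : (H →ₗ[ℝ] ℝ) ≃ₗ[ℝ] _).finrank_eq]
    exact Subspace.dual_finrank_eq
  let L := LinearEquiv.ofInjectiveOfFinrankEq (T : (H →L[ℝ] ℝ) →ₗ[ℝ] H) hinj hfr
  refine ⟨LinearMap.toContinuousLinearMap (L.symm : H →ₗ[ℝ] (H →L[ℝ] ℝ)), fun y => ?_⟩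
  exact L.apply_symm_apply y

/-- uniform local continuation -/
theorem ell_uniform (μ : Measure H) [μ.IsAddHaarMeasure] (M r : ℝ) (hM : 1 ≤ M) (hr : 0 < r) :
    ∃ δ > 0, ∀ (A : H → (H →L[ℝ] ℝ) →L[ℝ] H) (p1 : H) (G : H →L[ℝ] (H →L[ℝ] ℝ)) (u V : H → ℝ) (C : ℝ),
      Ell A p1 G M r → ContDiffOn ℝ 2 u (Metric.ball p1 r) →
      (∀ p ∈ Metric.ball p1 r, divg (gradA A u) p = V p * u p) →
      (∀ p ∈ Metric.ball p1 r, |u p| ≤ 1) → (∀ p ∈ Metric.ball p1 r, |V p| ≤ C) →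
      (∀ᶠ p in nhds p1, u p = 0) → ∀ p ∈ Metric.ball p1 δ, u p = 0 := by
  obtain ⟨t, ht, htr⟩ := exists_trace_bound H
  obtain ⟨S0, hS, hS0, hK⟩ := exists_S0 ((5+2*t)*M^12*M^2) (log (r / M ^ 2))
  have hM0 : 0 < M := by linarith
  refine ⟨exp (S0 - 2) / M, by positivity, ?_⟩
  intro A p1 G u V C e hu heq hub hV hnear p hp
  rcases eq_or_ne p p1 with rfl | hne
  · exact hnear.self_of_nhds
  have hu' := hu.mono e.sub
  have hC : 0 ≤ C := (abs_nonneg _).trans (hV p1 e.mem0)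
  have hcore := core (μ := μ) (e.cut (F := Ell.eF A G p1) hu') (e.geo ht htr) hu' (fun p hp => heq p (e.sub hp)) (V := V)
    (C0 := C * (r / M ^ 2) ^ 2) (by positivity) ?_ (fun p hp => hub p (e.sub hp)) hS hS0 hK ?_
  · have hlt : eR G p1 p < exp (S0 - 2) ^ 2 := by
      rw [mem_ball_iff_norm] at hp
      have h1 : eR G p1 p ≤ M * ‖p - p1‖ * ‖p - p1‖ :=
        (le_abs_self _).trans ((G (p - p1)).le_of_opNorm_le_of_le (e.G_norm _) le_rfl)
      have h2 : 0 < ‖p - p1‖ := norm_pos_iff.2 (sub_ne_zero.2 hne)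
      calc eR G p1 p ≤ M * ‖p - p1‖ * ‖p - p1‖ := h1
        _ = M * ‖p - p1‖ ^ 2 := by ring
        _ ≤ M ^ 2 * ‖p - p1‖ ^ 2 := by
          have : M ≤ M ^ 2 := by nlinarith
          gcongr
        _ < M ^ 2 * (exp (S0 - 2) / M) ^ 2 := by gcongr
        _ = _ := by field_simp
    have hσ : 1 / 2 * log (eR G p1 p) < S0 - 2 := by
      rw [← exp_lt_exp]
      refine lt_of_pow_lt_pow_left₀ 2 (exp_pos _).le ?_
      rwa [e.exp_σ hne]
    refine hcore p ⟨hne, ?_⟩ hσ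
    refine hlt.trans_le ?_
    have : exp S0 < r / M ^ 2 := by rwa [lt_log_iff_exp_lt (by positivity)] at hS
    have h3 : exp (S0 - 2) ≤ exp S0 := exp_le_exp.2 (by linarith)
    gcongr
    exact h3.trans this.le
  · intro p hp
    refine (hV p (e.sub hp)).trans ?_
    rw [mul_assoc]
    refine le_mul_of_one_le_right hC ?_
    rw [← div_eq_mul_inv, one_le_div (e.pos hp.1)]
    exact hp.2.le
  · intro κ _
    obtain ⟨ε, hε, hball⟩ := Metric.eventually_nhds_iff_ball.1 hnear
    refine (tendsto_const_nhds (x := (0:ℝ))).congr' ?_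
    have h1 : ∀ᶠ s : ℝ in atBot, exp s < ε / M ^ 2 :=
      tendsto_exp_atBot.eventually_lt_const (by positivity)
    filter_upwards [h1] with s hs
    rw [setIntegral_eq_zero_of_forall_eq_zero, mul_zero]
    intro x hx
    rw [hball x, zero_pow two_ne_zero, mul_zero]
    rw [mem_ball_iff_norm]
    have h2 := e.norm_le hx.1.1
    have h3 := exp_le_exp.2 hx.2.2
    calc ‖x - p1‖ ≤ M ^ 2 * exp s := h2.trans (by gcongr)
      _ < M ^ 2 * (ε / M ^ 2) := by gcongr
      _ = ε := by field_simp

/-- local uniform continuation around a point -/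
theorem ell_local (μ : Measure H) [μ.IsAddHaarMeasure] {O : Set H} (hO : IsOpen O)
    (A : H → (H →L[ℝ] ℝ) →L[ℝ] H)
    (hA : ContDiffOn ℝ 1 A O) (hsymm : ∀ x ∈ O, ∀ ξ η : H →L[ℝ] ℝ, ξ (A x η) = η (A x ξ))
    (hcoer : ∀ p ∈ O, ∃ c > 0, ∀ᶠ x in nhds p, ∀ ξ : H →L[ℝ] ℝ, c * ‖ξ‖ ^ 2 ≤ ξ (A x ξ))
    (u V : H → ℝ) (hu : ContDiffOn ℝ 2 u O) (hub : ∀ p ∈ O, |u p| ≤ 1)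
    (heq : ∀ p ∈ O, divg (gradA A u) p = V p * u p)
    (hV : ∀ p ∈ O, ∃ C, ∀ᶠ x in nhds p, |V x| ≤ C) (p : H) (hp : p ∈ O) :
    ∃ δ > 0, ∀ p1 ∈ Metric.ball p δ, (∀ᶠ x in nhds p1, u x = 0) →
      ∀ x ∈ Metric.ball p1 δ, u x = 0 := by
  obtain ⟨c, hc, hce⟩ := hcoer p hp
  obtain ⟨C, hCe⟩ := hV p hp
  have hAc : ContinuousAt A p := hA.continuousOn.continuousAt (hO.mem_nhds hp)
  have hDc : ContinuousAt (fderiv ℝ A) p :=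
    (hA.continuousOn_fderiv_of_isOpen hO le_rfl).continuousAt (hO.mem_nhds hp)
  have h1 : ∀ᶠ x in nhds p, ‖A x‖ < ‖A p‖ + 1 := hAc.norm.eventually_lt_const (by linarith)
  have h2 : ∀ᶠ x in nhds p, ‖fderiv ℝ A x‖ < ‖fderiv ℝ A p‖ + 1 :=
    hDc.norm.eventually_lt_const (by linarith)
  obtain ⟨ε, hε, hb⟩ := Metric.eventually_nhds_iff_ball.1
    (hce.and (hCe.and (h1.and (h2.and (hO.mem_nhds hp)))))
  set M := max (max 1 c⁻¹) (max (‖A p‖ + 1) (‖fderiv ℝ A p‖ + 1)) with hM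
  have m1 : 1 ≤ M := (le_max_left _ _).trans (le_max_left _ _)
  have m2 : c⁻¹ ≤ M := (le_max_right _ _).trans (le_max_left _ _)
  have m3 : ‖A p‖ + 1 ≤ M := (le_max_left _ _).trans (le_max_right _ _)
  have m4 : ‖fderiv ℝ A p‖ + 1 ≤ M := (le_max_right _ _).trans (le_max_right _ _)
  set r := min 1 (ε / 2) with hrd
  have hr : 0 < r := lt_min one_pos (by linarith)
  obtain ⟨δ, hδ, hmain⟩ := ell_uniform μ M r m1 hr
  refine ⟨min δ (ε / 2), lt_min hδ (by linarith), ?_⟩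
  intro p1 hp1 hn x hx
  have hsub : Metric.ball p1 r ⊆ Metric.ball p ε := by
    refine Metric.ball_subset_ball' ?_
    have a1 : dist p1 p < ε / 2 := (Metric.mem_ball.1 hp1).trans_le (min_le_right _ _)
    have a2 : r ≤ ε / 2 := min_le_right _ _
    linarith
  have hco : ∀ x ∈ Metric.ball p1 r, ∀ ξ : H →L[ℝ] ℝ, ‖ξ‖ ^ 2 ≤ M * ξ (A x ξ) := by
    intro x hx ξ
    have b1 := (hb x (hsub hx)).1 ξ
    have b2 : 0 ≤ ξ (A x ξ) := le_trans (by positivity) b1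
    calc ‖ξ‖ ^ 2 = c⁻¹ * (c * ‖ξ‖ ^ 2) := by field_simp
      _ ≤ c⁻¹ * ξ (A x ξ) := by gcongr
      _ ≤ _ := by gcongr
  obtain ⟨G, hG⟩ := exists_inv (A p1) (by
    intro ξ h0
    have := hco p1 (Metric.mem_ball_self hr) ξ
    rw [h0] at this
    simp only [map_zero, mul_zero] at this
    have h3 : ‖ξ‖ = 0 := by nlinarith [norm_nonneg ξ]
    exact norm_eq_zero.1 h3)
  have hsO : Metric.ball p1 r ⊆ O := fun x hx => (hb x (hsub hx)).2.2.2.2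
  have e : Ell A p1 G M r := ⟨m1, hr, min_le_left _ _, hA.mono hsO, fun x hx => hsymm x (hsO hx), hco,
    fun x hx => (hb x (hsub hx)).2.2.1.le.trans m3,
    fun x hx => (hb x (hsub hx)).2.2.2.1.le.trans m4, hG⟩
  exact hmain A p1 G u V C e (hu.mono hsO) (fun p hp => heq p (hsO hp)) (fun p hp => hub p (hsO hp))
    (fun x hx => (hb x (hsub hx)).2.1) hn x (Metric.ball_subset_ball (min_le_left _ _) hx)

/-- propagation along a path -/
theorem ell_path (μ : Measure H) [μ.IsAddHaarMeasure] {O : Set H} (hO : IsOpen O)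
    (A : H → (H →L[ℝ] ℝ) →L[ℝ] H)
    (hA : ContDiffOn ℝ 1 A O) (hsymm : ∀ x ∈ O, ∀ ξ η : H →L[ℝ] ℝ, ξ (A x η) = η (A x ξ))
    (hcoer : ∀ p ∈ O, ∃ c > 0, ∀ᶠ x in nhds p, ∀ ξ : H →L[ℝ] ℝ, c * ‖ξ‖ ^ 2 ≤ ξ (A x ξ))
    (u V : H → ℝ) (hu : ContDiffOn ℝ 2 u O) (hub : ∀ p ∈ O, |u p| ≤ 1)
    (heq : ∀ p ∈ O, divg (gradA A u) p = V p * u p)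
    (hV : ∀ p ∈ O, ∃ C, ∀ᶠ x in nhds p, |V x| ≤ C)
    {P : Set H} (hP : IsPreconnected P) (hPO : P ⊆ O) (p0 : H) (hp0 : p0 ∈ P)
    (h0 : ∀ᶠ x in nhds p0, u x = 0) (p : H) (hp : p ∈ P) : u p = 0 := by
  set Z : Set H := {q | ∀ᶠ x in nhds q, u x = 0} with hZ
  have hZo : IsOpen Z := isOpen_setOfPred_eventually_nhds
  have hcl : closure Z ∩ P ⊆ Z := by
    rintro q ⟨hq, hqP⟩
    obtain ⟨δ, hδ, hmain⟩ := ell_local μ hO A hA hsymm hcoer u V hu hub heq hV q (hPO hqP)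
    obtain ⟨p1, hp1, hd⟩ := Metric.mem_closure_iff.1 hq δ hδ
    refine Metric.eventually_nhds_iff_ball.2 ⟨δ - dist p1 q, ?_, ?_⟩
    · rw [dist_comm] at hd; linarith
    · intro x hx
      refine hmain p1 (by rw [Metric.mem_ball, dist_comm]; exact hd) hp1 x ?_
      rw [Metric.mem_ball] at *
      have := dist_triangle x q p1
      rw [dist_comm q p1] at this
      linarith
  have : P ⊆ Z := hP.subset_of_closure_inter_subset hZo ⟨p0, hp0, h0⟩ hcl
  exact (this hp).self_of_nhds

end UCP

end

section

set_option linter.unusedSectionVars false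
set_option linter.unusedSimpArgs false
set_option maxSynthPendingDepth 3
namespace UCP

variable {H : Type*} [NormedAddCommGroup H] [NormedSpace ℝ H] [FiniteDimensional ℝ H]
variable {ι : Type*} [Fintype ι] [DecidableEq ι]

/-- second order coefficients in a frame -/
def frA (a : ι → ι → H → ℝ) (X : ι → H → H) (p : H) : (H →L[ℝ] ℝ) →L[ℝ] H :=
  ∑ i, ∑ j, a i j p • (ContinuousLinearMap.apply ℝ ℝ (X j p)).smulRight (X i p)

/-- perturbation of the dilation coefficients -/
def frY (a : ι → ι → H → ℝ) (ζ : ι → H → ℝ) (l : ι) (p : H) : ℝ :=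
  ∑ q, (a l q p - if l = q then 1 else 0) * ζ q p

/-- the radial field -/
def frF (a : ι → ι → H → ℝ) (X : ι → H → H) (ζ : ι → H → ℝ) (p : H) : H :=
  ∑ l, (ζ l p + frY a ζ l p) • X l p

lemma frY_add (a : ι → ι → H → ℝ) (ζ : ι → H → ℝ) (l : ι) (p : H) :
    ζ l p + frY a ζ l p = ∑ q, a l q p * ζ q p := by
  simp [frY, sub_mul, Finset.sum_sub_distrib]

lemma frA_apply (a : ι → ι → H → ℝ) (X : ι → H → H) (p : H) (ξ : H →L[ℝ] ℝ) :
    frA a X p ξ = ∑ i, (∑ j, a i j p * ξ (X j p)) • X i p := by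
  simp only [frA, sum_apply, smul_apply, ContinuousLinearMap.smulRight_apply,
    ContinuousLinearMap.apply_apply, Finset.sum_smul, smul_smul]

lemma frA_apply2 (a : ι → ι → H → ℝ) (X : ι → H → H) (p : H) (ξ η : H →L[ℝ] ℝ) :
    η (frA a X p ξ) = ∑ i, ∑ j, a i j p * ξ (X j p) * η (X i p) := by
  simp only [frA_apply, map_sum, map_smul, smul_eq_mul, Finset.sum_mul]

/-- Abstract frame data. -/
structure Frame (U : Set H) (X : ι → H → H) (ω : H → H →L[ℝ] ℝ) (θ : ι → ℝ) (ζ : ι → H → ℝ)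
    (a : ι → ι → H → ℝ) (σ Ψ : H → ℝ) (γ Q L lam : ℝ) : Prop where
  isOpen : IsOpen U
  γ0 : 0 ≤ γ
  L0 : 0 ≤ L
  lam0 : 0 < lam
  θ0 : ∀ l, 0 ≤ θ l
  θ1 : ∀ l, θ l ≤ 1
  X_C1 : ∀ l, ContDiffOn ℝ 1 (X l) U
  ζ_C1 : ∀ l, ContDiffOn ℝ 1 (ζ l) U
  a_C1 : ∀ i j, ContDiffOn ℝ 1 (a i j) U
  Ψ_C1 : ContDiffOn ℝ 1 Ψ U
  σ_C2 : ContDiffOn ℝ 2 σ U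
  dX : ∀ l, ∀ p ∈ U, ∀ h, fderiv ℝ (X l) p h = (θ l * ω p h) • X l p
  θω : ∀ l, ∀ p ∈ U, θ l * ω p (X l p) = 0
  dζ : ∀ l j, ∀ p ∈ U, fderiv ℝ (ζ l) p (X j p) =
    (if j = l then 1 + γ * θ l else 0) - θ l * ω p (X j p) * ζ l p
  ωZ : ∀ p ∈ U, ∑ l, ζ l p * ω p (X l p) = γ
  dσ : ∀ l, ∀ p ∈ U, fderiv ℝ σ p (X l p) = Ψ p * ζ l p
  Ψζ : ∀ p ∈ U, Ψ p * ∑ l, ζ l p ^ 2 = 1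
  Ψ_pos : ∀ p ∈ U, 0 < Ψ p
  dΨ : ∀ p ∈ U, ∀ h, fderiv ℝ Ψ p h = Ψ p * (2 * ω p h - (2 * γ + 2) * fderiv ℝ σ p h)
  Qe : ∑ l, (1 + γ * θ l) = Q
  symm : ∀ i j, ∀ p ∈ U, a i j p = a j i p
  ell : ∀ p ∈ U, ∀ η : ι → ℝ, lam * ∑ i, η i ^ 2 ≤ ∑ i, ∑ j, a i j p * η i * η j
  e1 : ∀ p ∈ U, exp (σ p) ≤ 1
  b0 : ∀ i j, ∀ p ∈ U, |a i j p - if i = j then 1 else 0| ≤ L * exp (σ p)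
  b1 : ∀ l j, ∀ p ∈ U, |fderiv ℝ (frY a ζ l) p (X j p)| ≤ L * exp (σ p)
  b2 : ∀ l j, ∀ p ∈ U, |frY a ζ l p * ω p (X j p)| ≤ L * exp (σ p)
  b3 : ∀ i j, ∀ p ∈ U, |fderiv ℝ (a i j) p (frF a X ζ p)| ≤ L * exp (σ p)

namespace Frame

variable {U : Set H} {X : ι → H → H} {ω : H → H →L[ℝ] ℝ} {θ : ι → ℝ} {ζ : ι → H → ℝ}
variable {a : ι → ι → H → ℝ} {σ Ψ : H → ℝ} {γ Q L lam : ℝ}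

lemma hasF_comb (R : Frame U X ω θ ζ a σ Ψ γ Q L lam) {p : H} (hp : p ∈ U) (f : ι → H → ℝ)
    (hf : ∀ l, DifferentiableAt ℝ (f l) p) :
    HasFDerivAt (fun q => ∑ l, f l q • X l q)
      (∑ l, (fderiv ℝ (f l) p + (f l p * θ l) • ω p).smulRight (X l p)) p := by
  have h : ∀ l ∈ Finset.univ, HasFDerivAt (fun q => f l q • X l q)
      ((fderiv ℝ (f l) p + (f l p * θ l) • ω p).smulRight (X l p)) p := by
    intro l _
    have hX := ((R.X_C1 l).differentiableOn one_ne_zero).differentiableAt (R.isOpen.mem_nhds hp)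
    refine ((hf l).hasFDerivAt.fun_smul hX.hasFDerivAt).congr_fderiv ?_
    ext h
    simp only [add_apply, smul_apply, ContinuousLinearMap.smulRight_apply, R.dX l p hp h]
    simp only [smul_smul, ← add_smul, smul_eq_mul]
    congr 1
    ring
  exact HasFDerivAt.fun_sum h

lemma divg_comb (R : Frame U X ω θ ζ a σ Ψ γ Q L lam) {p : H} (hp : p ∈ U) (f : ι → H → ℝ)
    (hf : ∀ l, DifferentiableAt ℝ (f l) p) :
    divg (fun q => ∑ l, f l q • X l q) p = ∑ l, fderiv ℝ (f l) p (X l p) := by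
  rw [divg, (R.hasF_comb hp f hf).fderiv]
  have : ((∑ l, (fderiv ℝ (f l) p + (f l p * θ l) • ω p).smulRight (X l p) : H →L[ℝ] H) : H →ₗ[ℝ] H)
    = ∑ l, ((fderiv ℝ (f l) p + (f l p * θ l) • ω p : H →L[ℝ] ℝ) : H →ₗ[ℝ] ℝ).smulRight (X l p) := by
    ext h; simp
  rw [this, map_sum]
  refine Finset.sum_congr rfl fun l _ => ?_
  rw [LinearMap.trace_smulRight]
  have := R.θω l p hp
  simp only [ContinuousLinearMap.coe_coe, add_apply, smul_apply, smul_eq_mul]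
  linear_combination (f l p) * this

lemma diff_ζ (R : Frame U X ω θ ζ a σ Ψ γ Q L lam) {p : H} (hp : p ∈ U) (l : ι) :
    DifferentiableAt ℝ (ζ l) p :=
  ((R.ζ_C1 l).differentiableOn one_ne_zero).differentiableAt (R.isOpen.mem_nhds hp)

lemma diff_a (R : Frame U X ω θ ζ a σ Ψ γ Q L lam) {p : H} (hp : p ∈ U) (i j : ι) :
    DifferentiableAt ℝ (a i j) p :=
  ((R.a_C1 i j).differentiableOn one_ne_zero).differentiableAt (R.isOpen.mem_nhds hp)

lemma Y_C1 (R : Frame U X ω θ ζ a σ Ψ γ Q L lam) (l : ι) : ContDiffOn ℝ 1 (frY a ζ l) U := by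
  unfold frY
  exact ContDiffOn.sum fun q _ => ((R.a_C1 l q).sub contDiffOn_const).mul (R.ζ_C1 q)

lemma diff_Y (R : Frame U X ω θ ζ a σ Ψ γ Q L lam) {p : H} (hp : p ∈ U) (l : ι) :
    DifferentiableAt ℝ (frY a ζ l) p :=
  ((R.Y_C1 l).differentiableOn one_ne_zero).differentiableAt (R.isOpen.mem_nhds hp)

lemma F_C1 (R : Frame U X ω θ ζ a σ Ψ γ Q L lam) : ContDiffOn ℝ 1 (frF a X ζ) U := by
  unfold frF
  exact ContDiffOn.sum fun l _ => ((R.ζ_C1 l).add (R.Y_C1 l)).smul (R.X_C1 l)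

lemma A_C1 (R : Frame U X ω θ ζ a σ Ψ γ Q L lam) : ContDiffOn ℝ 1 (frA a X) U := by
  unfold frA
  refine ContDiffOn.sum fun i _ => ContDiffOn.sum fun j _ => (R.a_C1 i j).smul ?_
  have h1 : ContDiffOn ℝ 1 (fun p => ContinuousLinearMap.apply ℝ ℝ (X j p)) U :=
    (ContinuousLinearMap.apply ℝ ℝ : H →L[ℝ] _).contDiff.comp_contDiffOn (R.X_C1 j)
  exact h1.smulRight (R.X_C1 i)

lemma ωF (R : Frame U X ω θ ζ a σ Ψ γ Q L lam) {p : H} (hp : p ∈ U) :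
    ω p (frF a X ζ p) = γ + ∑ l, frY a ζ l p * ω p (X l p) := by
  simp only [frF, map_sum, map_smul, smul_eq_mul, add_mul, Finset.sum_add_distrib, R.ωZ p hp]

lemma σF (R : Frame U X ω θ ζ a σ Ψ γ Q L lam) {p : H} (hp : p ∈ U) :
    fderiv ℝ σ p (frF a X ζ p) =
      1 + Ψ p * ∑ l, ∑ q, (a l q p - if l = q then 1 else 0) * ζ q p * ζ l p := by
  have h : fderiv ℝ σ p (frF a X ζ p) = Ψ p * ∑ l, ζ l p ^ 2 + Ψ p * ∑ l, frY a ζ l p * ζ l p := by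
    simp only [frF, map_sum, map_smul, smul_eq_mul, R.dσ _ p hp, Finset.mul_sum,
      ← Finset.sum_add_distrib]
    exact Finset.sum_congr rfl fun l _ => by ring
  rw [h, R.Ψζ p hp]
  simp only [frY, Finset.sum_mul]

lemma ζF (R : Frame U X ω θ ζ a σ Ψ γ Q L lam) {p : H} (hp : p ∈ U) (l : ι) :
    fderiv ℝ (ζ l) p (frF a X ζ p) = ζ l p + frY a ζ l p * (1 + γ * θ l)
      - θ l * (∑ j, frY a ζ j p * ω p (X j p)) * ζ l p := by
  have h : fderiv ℝ (ζ l) p (frF a X ζ p) = (ζ l p + frY a ζ l p) * (1 + γ * θ l)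
      - θ l * ω p (frF a X ζ p) * ζ l p := by
    simp only [frF, map_sum, map_smul, smul_eq_mul, R.dζ _ _ p hp, mul_sub, Finset.sum_sub_distrib]
    congr 1
    · simp
    · rw [Finset.mul_sum, Finset.sum_mul]
      exact Finset.sum_congr rfl fun j _ => by ring
  rw [h, R.ωF hp]
  ring

lemma ζA (R : Frame U X ω θ ζ a σ Ψ γ Q L lam) {p : H} (hp : p ∈ U) (l : ι) (c : ι → ℝ) :
    fderiv ℝ (ζ l) p (∑ j, c j • X j p) = c l * (1 + γ * θ l)
      - θ l * ω p (∑ j, c j • X j p) * ζ l p := by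
  simp only [map_sum, map_smul, smul_eq_mul, R.dζ _ _ p hp, mul_sub, Finset.sum_sub_distrib]
  congr 1
  · simp
  · rw [Finset.mul_sum, Finset.sum_mul]
    exact Finset.sum_congr rfl fun j _ => by ring

lemma dA (R : Frame U X ω θ ζ a σ Ψ γ Q L lam) {p : H} (hp : p ∈ U) (h : H) (ξ : H →L[ℝ] ℝ) :
    ξ (fderiv ℝ (frA a X) p h ξ) = (∑ i, ∑ j, fderiv ℝ (a i j) p h * ξ (X j p) * ξ (X i p))
      + 2 * ω p h * ∑ i, θ i * (∑ j, a i j p * ξ (X j p)) * ξ (X i p) := by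
  have hd : DifferentiableAt ℝ (frA a X) p :=
    (R.A_C1.differentiableOn one_ne_zero).differentiableAt (R.isOpen.mem_nhds hp)
  have h1 := (ξ.hasFDerivAt (x := frA a X p ξ)).comp p (hd.hasFDerivAt.clm_apply (hasFDerivAt_const ξ p))
  have hX : ∀ j, HasFDerivAt (fun q => ξ (X j q)) ((θ j * ξ (X j p)) • ω p) p := by
    intro j
    have hX := ((R.X_C1 j).differentiableOn one_ne_zero).differentiableAt (R.isOpen.mem_nhds hp)
    refine ((ξ.hasFDerivAt (x := X j p)).comp p hX.hasFDerivAt).congr_fderiv ?_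
    ext h
    simp only [ContinuousLinearMap.comp_apply, R.dX j p hp h, map_smul, smul_apply, smul_eq_mul]
    ring
  have h2 : HasFDerivAt (fun q => ∑ i, ∑ j, a i j q * ξ (X j q) * ξ (X i q))
      (∑ i, ∑ j, ((a i j p * ξ (X j p)) • ((θ i * ξ (X i p)) • ω p)
        + ξ (X i p) • (a i j p • ((θ j * ξ (X j p)) • ω p) + ξ (X j p) • fderiv ℝ (a i j) p))) p :=
    HasFDerivAt.fun_sum fun i _ => HasFDerivAt.fun_sum fun j _ =>
      (((R.diff_a hp i j).hasFDerivAt.fun_mul (hX j)).fun_mul (hX i))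
  have h3 := congrArg (fun T => T h) (h1.unique (h2.congr_of_eventuallyEq
    (Eventually.of_forall fun q => frA_apply2 a X q ξ ξ)))
  simp only [ContinuousLinearMap.comp_apply, add_apply, ContinuousLinearMap.flip_apply,
    zero_apply, map_zero, zero_add, sum_apply, smul_apply,
    smul_eq_mul] at h3
  rw [h3]
  have h4 : ∑ i, ∑ j, a i j p * ξ (X j p) * (θ j * ξ (X j p) * ω p h) * 0 = 0 := by simp
  have h5 : ∑ i, ∑ j, (ξ (X i p) * (a i j p * (θ j * ξ (X j p) * ω p h)))
      = ∑ i, ∑ j, a i j p * ξ (X j p) * (θ i * ξ (X i p) * ω p h) := by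
    rw [Finset.sum_comm]
    refine Finset.sum_congr rfl fun i _ => Finset.sum_congr rfl fun j _ => ?_
    rw [R.symm i j p hp]; ring
  simp only [mul_add, Finset.sum_add_distrib]
  rw [h5]
  simp only [Finset.mul_sum, Finset.sum_mul, ← Finset.sum_add_distrib]
  refine Finset.sum_congr rfl fun i _ => Finset.sum_congr rfl fun j _ => ?_
  ring

end Frame
end UCP

end

section

set_option linter.unusedSectionVars false
set_option linter.unusedSimpArgs false
set_option maxSynthPendingDepth 3
namespace UCP

variable {H : Type*} [NormedAddCommGroup H] [NormedSpace ℝ H] [FiniteDimensional ℝ H]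
variable {ι : Type*} [Fintype ι] [DecidableEq ι]

lemma abs_sum_le_card (f : ι → ℝ) {c : ℝ} (h : ∀ i, |f i| ≤ c) :
    |∑ i, f i| ≤ (Fintype.card ι : ℝ) * c := by
  refine (Finset.abs_sum_le_sum_abs _ _).trans ?_
  refine (Finset.sum_le_sum fun i _ => h i).trans ?_
  simp

lemma abs_mul_le_sum_sq (ζ : ι → ℝ) (l q : ι) : |ζ l * ζ q| ≤ ∑ i, ζ i ^ 2 := by
  have h1 : ζ l ^ 2 ≤ ∑ i, ζ i ^ 2 :=
    Finset.single_le_sum (f := fun i => ζ i ^ 2) (fun i _ => sq_nonneg _) (Finset.mem_univ l)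
  have h2 : ζ q ^ 2 ≤ ∑ i, ζ i ^ 2 :=
    Finset.single_le_sum (f := fun i => ζ i ^ 2) (fun i _ => sq_nonneg _) (Finset.mem_univ q)
  rw [abs_le]
  constructor
  · nlinarith [sq_nonneg (ζ l + ζ q)]
  · nlinarith [sq_nonneg (ζ l - ζ q)]

lemma abs_mul_le_mul {x y a b : ℝ} (hx : |x| ≤ a) (hy : |y| ≤ b) : |x * y| ≤ a * b := by
  rw [abs_mul]
  exact mul_le_mul hx hy (abs_nonneg _) ((abs_nonneg _).trans hx)

namespace Frame

variable {U : Set H} {X : ι → H → H} {ω : H → H →L[ℝ] ℝ} {θ : ι → ℝ} {ζ : ι → H → ℝ}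
variable {a : ι → ι → H → ℝ} {σ Ψ : H → ℝ} {γ Q L lam : ℝ}

lemma Ψζζ (R : Frame U X ω θ ζ a σ Ψ γ Q L lam) {p : H} (hp : p ∈ U) (l q : ι) :
    |Ψ p * (ζ l p * ζ q p)| ≤ 1 := by
  rw [abs_mul, abs_of_pos (R.Ψ_pos p hp), ← R.Ψζ p hp]
  exact mul_le_mul_of_nonneg_left (abs_mul_le_sum_sq (fun i => ζ i p) l q) (R.Ψ_pos p hp).le

lemma hB (R : Frame U X ω θ ζ a σ Ψ γ Q L lam) {p : H} (hp : p ∈ U) :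
    |fderiv ℝ σ p (frF a X ζ p) - 1| ≤
      ((Fintype.card ι : ℝ) * ((Fintype.card ι : ℝ) * L)) * exp (σ p) := by
  rw [R.σF hp, add_sub_cancel_left]
  simp only [Finset.mul_sum]
  rw [mul_assoc, mul_assoc]
  refine abs_sum_le_card _ fun l => abs_sum_le_card _ fun q => ?_
  have := abs_mul_le_mul (R.b0 l q p hp) (R.Ψζζ hp q l)
  rw [mul_one] at this
  convert this using 2
  ring

lemma hωY (R : Frame U X ω θ ζ a σ Ψ γ Q L lam) {p : H} (hp : p ∈ U) :
    |∑ l, frY a ζ l p * ω p (X l p)| ≤ ((Fintype.card ι : ℝ) * L) * exp (σ p) := by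
  rw [mul_assoc]
  exact abs_sum_le_card _ fun l => R.b2 l l p hp

lemma hdiv (R : Frame U X ω θ ζ a σ Ψ γ Q L lam) {p : H} (hp : p ∈ U) :
    |divg (frF a X ζ) p - Q| ≤ ((Fintype.card ι : ℝ) * L) * exp (σ p) := by
  have h1 : divg (frF a X ζ) p = ∑ l, fderiv ℝ (fun q => ζ l q + frY a ζ l q) p (X l p) :=
    R.divg_comb hp (fun l q => ζ l q + frY a ζ l q) fun l => (R.diff_ζ hp l).add (R.diff_Y hp l)
  have h2 : ∀ l, fderiv ℝ (fun q => ζ l q + frY a ζ l q) p (X l p)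
      = (1 + γ * θ l) + fderiv ℝ (frY a ζ l) p (X l p) := by
    intro l
    rw [fderiv_fun_add (R.diff_ζ hp l) (R.diff_Y hp l), add_apply, R.dζ l l p hp, R.θω l p hp]
    simp
  rw [h1]
  simp only [h2]
  rw [Finset.sum_add_distrib, R.Qe, add_sub_cancel_left, mul_assoc]
  exact abs_sum_le_card _ fun l => R.b1 l l p hp

/-- constant for the weight -/
def K3 (ι : Type*) [Fintype ι] (γ L : ℝ) : ℝ :=
  2 * ((Fintype.card ι : ℝ) * L) + (2 * γ + 2) * ((Fintype.card ι : ℝ) * ((Fintype.card ι : ℝ) * L))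

lemma K3_nonneg (R : Frame U X ω θ ζ a σ Ψ γ Q L lam) : 0 ≤ K3 ι γ L := by
  have := R.L0
  have := R.γ0
  unfold K3
  positivity

lemma ΨF (R : Frame U X ω θ ζ a σ Ψ γ Q L lam) {p : H} (hp : p ∈ U) :
    ∃ τ, |τ| ≤ K3 ι γ L * exp (σ p) ∧ fderiv ℝ Ψ p (frF a X ζ p) = Ψ p * (-2 + τ) := by
  refine ⟨2 * (∑ l, frY a ζ l p * ω p (X l p))
    - (2 * γ + 2) * (fderiv ℝ σ p (frF a X ζ p) - 1), ?_, ?_⟩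
  · have h1 := R.hB hp
    have h2 := R.hωY hp
    have hγ := R.γ0
    refine (abs_sub _ _).trans ?_
    rw [abs_mul, abs_mul, abs_of_nonneg (show 0 ≤ 2 * γ + 2 by linarith), abs_two, K3]
    have h3 := mul_le_mul_of_nonneg_left h1 (show 0 ≤ 2 * γ + 2 by linarith)
    linarith
  · rw [R.dΨ p hp, R.ωF hp]
    ring

lemma hΨ (R : Frame U X ω θ ζ a σ Ψ γ Q L lam) {p : H} (hp : p ∈ U) :
    |fderiv ℝ Ψ p (frF a X ζ p) + 2 * Ψ p| ≤ K3 ι γ L * exp (σ p) * Ψ p := by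
  obtain ⟨τ, h1, h2⟩ := R.ΨF hp
  rw [h2, show Ψ p * (-2 + τ) + 2 * Ψ p = τ * Ψ p by ring, abs_mul, abs_of_pos (R.Ψ_pos p hp)]
  exact mul_le_mul_of_nonneg_right h1 (R.Ψ_pos p hp).le

/-- constant for second derivative -/
def K4 (ι : Type*) [Fintype ι] (γ L : ℝ) : ℝ :=
  1 + (Fintype.card ι : ℝ) * L * (1 + γ) + (Fintype.card ι : ℝ) * L

lemma K4_nonneg (R : Frame U X ω θ ζ a σ Ψ γ Q L lam) : 0 ≤ K4 ι γ L := by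
  have := R.L0
  have := R.γ0
  unfold K4
  positivity

lemma ζFb (R : Frame U X ω θ ζ a σ Ψ γ Q L lam) {p : H} (hp : p ∈ U) (l q : ι) :
    |Ψ p * (fderiv ℝ (ζ q) p (frF a X ζ p) * ζ l p)| ≤ K4 ι γ L := by
  rw [R.ζF hp]
  have hL := R.L0
  have hγ := R.γ0
  have he := R.e1 p hp
  have hθ := R.θ1 q
  have hθ0 := R.θ0 q
  have h1 := R.Ψζζ hp q l
  have h2 : |Ψ p * (frY a ζ q p * ζ l p)| ≤ (Fintype.card ι : ℝ) * L := by
    simp only [frY, Finset.mul_sum, Finset.sum_mul]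
    refine abs_sum_le_card _ fun i => ?_
    have := abs_mul_le_mul ((R.b0 q i p hp).trans (mul_le_of_le_one_right hL he)) (R.Ψζζ hp i l)
    rw [mul_one] at this
    convert this using 2
    ring
  have h3 := (R.hωY hp).trans (mul_le_of_le_one_right (by positivity) he)
  have h4 : |(1 + γ * θ q)| ≤ 1 + γ := by
    rw [abs_of_nonneg (by positivity)]
    nlinarith
  have h5 : |θ q| ≤ 1 := by rwa [abs_of_nonneg hθ0]
  have e1 : Ψ p * ((ζ q p + frY a ζ q p * (1 + γ * θ q)
      - θ q * (∑ j, frY a ζ j p * ω p (X j p)) * ζ q p) * ζ l p)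
      = Ψ p * (ζ q p * ζ l p) + Ψ p * (frY a ζ q p * ζ l p) * (1 + γ * θ q)
        - (θ q * (∑ j, frY a ζ j p * ω p (X j p))) * (Ψ p * (ζ q p * ζ l p)) := by ring
  rw [e1]
  have h6 := abs_mul_le_mul h2 h4
  have h7 := abs_mul_le_mul (abs_mul_le_mul h5 h3) h1
  refine (abs_sub _ _).trans ((add_le_add_left (abs_add_le _ _) _).trans ?_)
  unfold K4
  linarith

/-- constant for second derivative -/
def K5 (ι : Type*) [Fintype ι] (γ L : ℝ) : ℝ :=
  (Fintype.card ι : ℝ) * ((Fintype.card ι : ℝ) * (L * (3 + K3 ι γ L + 2 * K4 ι γ L)))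

lemma hBF (R : Frame U X ω θ ζ a σ Ψ γ Q L lam) {p : H} (hp : p ∈ U) :
    |fderiv ℝ (fun q => fderiv ℝ σ q (frF a X ζ q)) p (frF a X ζ p)| ≤ K5 ι γ L * exp (σ p) := by
  have hev : (fun q => fderiv ℝ σ q (frF a X ζ q)) =ᶠ[nhds p] fun p => 1 +
      ∑ l, ∑ q, (Ψ p * (a l q p - if l = q then 1 else 0)) * (ζ q p * ζ l p) := by
    filter_upwards [R.isOpen.mem_nhds hp] with q hq
    rw [R.σF hq]
    simp only [Finset.mul_sum]
    congr 1
    exact Finset.sum_congr rfl fun i _ => Finset.sum_congr rfl fun j _ => by ring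
  have hΨd : DifferentiableAt ℝ Ψ p :=
    (R.Ψ_C1.differentiableOn one_ne_zero).differentiableAt (R.isOpen.mem_nhds hp)
  have hd : HasFDerivAt (fun p => 1 +
      ∑ l, ∑ q, (Ψ p * (a l q p - if l = q then 1 else 0)) * (ζ q p * ζ l p))
      (∑ l, ∑ q, ((Ψ p * (a l q p - if l = q then 1 else 0)) •
          (ζ q p • fderiv ℝ (ζ l) p + ζ l p • fderiv ℝ (ζ q) p)
        + (ζ q p * ζ l p) • (Ψ p • fderiv ℝ (a l q) p +
          (a l q p - if l = q then 1 else 0) • fderiv ℝ Ψ p))) p := by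
    refine HasFDerivAt.const_add _ (HasFDerivAt.fun_sum fun l _ => HasFDerivAt.fun_sum fun q _ => ?_)
    exact (hΨd.hasFDerivAt.fun_mul ((R.diff_a hp l q).hasFDerivAt.sub_const _)).fun_mul
      ((R.diff_ζ hp q).hasFDerivAt.fun_mul (R.diff_ζ hp l).hasFDerivAt)
  rw [hev.fderiv_eq, hd.fderiv]
  simp only [sum_apply, add_apply, smul_apply, smul_eq_mul]
  rw [K5, mul_assoc, mul_assoc]
  refine abs_sum_le_card _ fun l => abs_sum_le_card _ fun q => ?_
  obtain ⟨τ, h1, h2⟩ := R.ΨF hp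
  rw [h2]
  have hL := R.L0
  have he := R.e1 p hp
  have hτ : |-2 + τ| ≤ 2 + K3 ι γ L := by
    refine (abs_add_le _ _).trans ?_
    have := mul_le_of_le_one_right R.K3_nonneg he
    rw [abs_neg, abs_two]
    linarith
  set b := a l q p - if l = q then 1 else 0 with hb
  have b0 := R.b0 l q p hp
  rw [← hb] at b0
  have t1 := abs_mul_le_mul b0 (R.ζFb hp q l)
  have t2 := abs_mul_le_mul b0 (R.ζFb hp l q)
  have t3 := abs_mul_le_mul (R.b3 l q p hp) (R.Ψζζ hp q l)
  have t4 := abs_mul_le_mul (abs_mul_le_mul b0 hτ) (R.Ψζζ hp q l)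
  have e1 : Ψ p * b * (ζ q p * fderiv ℝ (ζ l) p (frF a X ζ p) + ζ l p * fderiv ℝ (ζ q) p (frF a X ζ p)) +
      ζ q p * ζ l p * (Ψ p * fderiv ℝ (a l q) p (frF a X ζ p) + b * (Ψ p * (-2 + τ)))
      = b * (Ψ p * (fderiv ℝ (ζ l) p (frF a X ζ p) * ζ q p)) +
        b * (Ψ p * (fderiv ℝ (ζ q) p (frF a X ζ p) * ζ l p)) +
        fderiv ℝ (a l q) p (frF a X ζ p) * (Ψ p * (ζ q p * ζ l p)) +
        b * (-2 + τ) * (Ψ p * (ζ q p * ζ l p)) := by ring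
  rw [e1]
  refine (abs_add_le _ _).trans ((add_le_add_left (abs_add_le _ _) _).trans
    ((add_le_add_left (add_le_add_left (abs_add_le _ _) _) _).trans ?_))
  linarith

/-- constant for commutator -/
def K6 (ι : Type*) [Fintype ι] (L lam : ℝ) : ℝ :=
  (3 * (Fintype.card ι : ℝ) ^ 3 * (1 + L) * L + (Fintype.card ι : ℝ) ^ 2 * L) / lam

lemma hR (R : Frame U X ω θ ζ a σ Ψ γ Q L lam) {p : H} (hp : p ∈ U) (ξ : H →L[ℝ] ℝ) :
    |ξ (fderiv ℝ (frF a X ζ) p (frA a X p ξ)) - 1 / 2 * ξ (fderiv ℝ (frA a X) p (frF a X ζ p) ξ)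
      - ξ (frA a X p ξ)| ≤ K6 ι L lam * exp (σ p) * ξ (frA a X p ξ) := by
  set x : ι → ℝ := fun i => ξ (X i p) with hx
  set c : ι → ℝ := fun i => ∑ j, a i j p * x j with hc
  have hL := R.L0
  have he := R.e1 p hp
  have hlam := R.lam0
  have hAc : frA a X p ξ = ∑ j, c j • X j p := frA_apply a X p ξ
  have hF := R.hasF_comb hp (fun l q => ζ l q + frY a ζ l q)
    fun l => (R.diff_ζ hp l).add (R.diff_Y hp l)
  have hF' : fderiv ℝ (frF a X ζ) p = _ := hF.fderiv
  have e0 : ξ (frA a X p ξ) = ∑ i, c i * x i := by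
    rw [frA_apply2]; simp only [hc, Finset.sum_mul, hx]
  have e1 : ξ (fderiv ℝ (frF a X ζ) p (frA a X p ξ)) =
      (∑ l, c l * x l * (1 + γ * θ l)) + (∑ l, ∑ j, fderiv ℝ (frY a ζ l) p (X j p) * (c j * x l))
      + ∑ l, ∑ j, (frY a ζ l p * ω p (X j p)) * (θ l * (c j * x l)) := by
    rw [hF']
    simp only [sum_apply, ContinuousLinearMap.smulRight_apply, add_apply, smul_apply, smul_eq_mul,
      map_sum, map_smul]
    rw [← Finset.sum_add_distrib, ← Finset.sum_add_distrib]
    refine Finset.sum_congr rfl fun l _ => ?_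
    rw [fderiv_fun_add (R.diff_ζ hp l) (R.diff_Y hp l), add_apply, hAc, R.ζA hp]
    have k1 : ∑ j, fderiv ℝ (frY a ζ l) p (X j p) * (c j * x l)
        = fderiv ℝ (frY a ζ l) p (∑ j, c j • X j p) * x l := by
      simp only [map_sum, map_smul, smul_eq_mul, Finset.sum_mul]
      exact Finset.sum_congr rfl fun j _ => by ring
    have k2 : ∑ j, (frY a ζ l p * ω p (X j p)) * (θ l * (c j * x l))
        = frY a ζ l p * θ l * x l * ω p (∑ j, c j • X j p) := by
      simp only [map_sum, map_smul, smul_eq_mul, Finset.mul_sum]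
      exact Finset.sum_congr rfl fun j _ => by ring
    rw [k1, k2]
    ring
  have e2 := R.dA hp (frF a X ζ p) ξ
  rw [R.ωF hp] at e2
  set W := ∑ l, frY a ζ l p * ω p (X l p) with hW
  have e3 : ∑ l, c l * x l * (1 + γ * θ l) = ∑ i, c i * x i + γ * ∑ i, θ i * c i * x i := by
    rw [Finset.mul_sum, ← Finset.sum_add_distrib]
    exact Finset.sum_congr rfl fun l _ => by ring
  have e4 : ∑ i, θ i * (∑ j, a i j p * ξ (X j p)) * ξ (X i p) = ∑ i, θ i * c i * x i := rfl
  rw [e4] at e2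
  have e5 : ξ (fderiv ℝ (frF a X ζ) p (frA a X p ξ))
      - 1 / 2 * ξ (fderiv ℝ (frA a X) p (frF a X ζ p) ξ) - ξ (frA a X p ξ) =
      (∑ l, ∑ j, fderiv ℝ (frY a ζ l) p (X j p) * (c j * x l))
      + (∑ l, ∑ j, (frY a ζ l p * ω p (X j p)) * (θ l * (c j * x l)))
      - W * (∑ i, θ i * c i * x i)
      - 1 / 2 * ∑ i, ∑ j, fderiv ℝ (a i j) p (frF a X ζ p) * ξ (X j p) * ξ (X i p) := by
    rw [e1, e2, e0, e3]; ring
  rw [e5]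
  set N : ℝ := (Fintype.card ι : ℝ) with hN
  set R2 := ∑ i, x i ^ 2 with hR2
  have hR20 : 0 ≤ R2 := Finset.sum_nonneg fun i _ => sq_nonneg _
  have hxx : ∀ i j, |x i * x j| ≤ R2 := fun i j => abs_mul_le_sum_sq x i j
  have ha : ∀ i j, |a i j p| ≤ 1 + L := by
    intro i j
    have := R.b0 i j p hp
    have h2 : |(if i = j then (1:ℝ) else 0)| ≤ 1 := by split_ifs <;> simp
    calc |a i j p| = |(a i j p - if i = j then 1 else 0) + if i = j then 1 else 0| := by
          rw [sub_add_cancel]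
      _ ≤ _ := (abs_add_le _ _).trans (by
          have := mul_le_of_le_one_right hL he
          linarith)
  have hcx : ∀ j l, |c j * x l| ≤ N * ((1 + L) * R2) := by
    intro j l
    simp only [hc, Finset.sum_mul]
    refine abs_sum_le_card _ fun i => ?_
    rw [mul_assoc]
    exact abs_mul_le_mul (ha j i) (hxx i l)
  have hθcx : ∀ i j l, |θ i * (c j * x l)| ≤ N * ((1 + L) * R2) := by
    intro i j l
    have := abs_mul_le_mul (show |θ i| ≤ 1 by rw [abs_of_nonneg (R.θ0 i)]; exact R.θ1 i) (hcx j l)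
    rwa [one_mul] at this
  have t1 : |∑ l, ∑ j, fderiv ℝ (frY a ζ l) p (X j p) * (c j * x l)| ≤
      N * (N * (L * exp (σ p) * (N * ((1 + L) * R2)))) :=
    abs_sum_le_card _ fun l => abs_sum_le_card _ fun j => abs_mul_le_mul (R.b1 l j p hp) (hcx j l)
  have t2 : |∑ l, ∑ j, (frY a ζ l p * ω p (X j p)) * (θ l * (c j * x l))| ≤
      N * (N * (L * exp (σ p) * (N * ((1 + L) * R2)))) :=
    abs_sum_le_card _ fun l => abs_sum_le_card _ fun j => abs_mul_le_mul (R.b2 l j p hp) (hθcx l j l)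
  have t3 : |W * (∑ i, θ i * c i * x i)| ≤ (N * L * exp (σ p)) * (N * (N * ((1 + L) * R2))) := by
    refine abs_mul_le_mul (R.hωY hp) (abs_sum_le_card _ fun i => ?_)
    rw [mul_assoc]
    exact hθcx i i i
  have t4 : |∑ i, ∑ j, fderiv ℝ (a i j) p (frF a X ζ p) * ξ (X j p) * ξ (X i p)| ≤
      N * (N * (L * exp (σ p) * R2)) := by
    refine abs_sum_le_card _ fun i => abs_sum_le_card _ fun j => ?_
    rw [mul_assoc]
    exact abs_mul_le_mul (R.b3 i j p hp) (hxx j i)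
  have t5 : 0 ≤ N * (N * (L * exp (σ p) * R2)) := by positivity
  have hell : R2 ≤ ξ (frA a X p ξ) / lam := by
    rw [le_div_iff₀ hlam, mul_comm]
    refine (R.ell p hp x).trans (le_of_eq ?_)
    rw [frA_apply2]
    exact Finset.sum_congr rfl fun i _ => Finset.sum_congr rfl fun j _ => by simp only [hx]; ring
  calc _ ≤ (3 * N ^ 3 * (1 + L) * L + N ^ 2 * L) * exp (σ p) * R2 := by
        refine (abs_sub _ _).trans ((add_le_add_left (abs_sub _ _) _).trans
          ((add_le_add_left (add_le_add_left (abs_add_le _ _) _) _).trans ?_))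
        rw [abs_mul (1/2 : ℝ), abs_of_pos (show (0:ℝ) < 1 / 2 by norm_num)]
        linarith
    _ ≤ (3 * N ^ 3 * (1 + L) * L + N ^ 2 * L) * exp (σ p) * (ξ (frA a X p ξ) / lam) := by
        gcongr
    _ = _ := by rw [K6]; ring

theorem geo (R : Frame U X ω θ ζ a σ Ψ γ Q L lam) :
    ∃ K, Geo U (frA a X) σ Ψ (frF a X ζ) K Q := by
  set N : ℝ := (Fintype.card ι : ℝ) with hN
  have hL := R.L0
  have hlam := R.lam0
  have k3 := R.K3_nonneg
  have k4 := R.K4_nonneg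
  have k5 : 0 ≤ K5 ι γ L := by unfold K5; positivity
  have k6 : 0 ≤ K6 ι L lam := by unfold K6; positivity
  have k1 : 0 ≤ N * (N * L) := by positivity
  have k2 : 0 ≤ N * L := by positivity
  set K := N * (N * L) + N * L + K3 ι γ L + K5 ι γ L + K6 ι L lam with hK
  refine ⟨K, R.isOpen, by positivity, R.A_C1, R.Ψ_C1, R.F_C1, R.σ_C2, ?_, ?_, R.Ψ_pos, ?_, ?_, ?_, ?_, ?_, ?_⟩
  · intro p hp ξ η
    rw [frA_apply2, frA_apply2, Finset.sum_comm]
    refine Finset.sum_congr rfl fun i _ => Finset.sum_congr rfl fun j _ => ?_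
    rw [R.symm i j p hp]; ring
  · intro p hp ξ
    have := R.ell p hp (fun i => ξ (X i p))
    have h2 : 0 ≤ lam * ∑ i, ξ (X i p) ^ 2 := mul_nonneg hlam.le (Finset.sum_nonneg fun i _ => sq_nonneg _)
    refine (h2.trans this).trans (le_of_eq ?_)
    rw [frA_apply2]
    exact Finset.sum_congr rfl fun i _ => Finset.sum_congr rfl fun j _ => by ring
  · intro p hp
    rw [frA_apply, frF, Finset.smul_sum]
    refine Finset.sum_congr rfl fun i _ => ?_
    rw [frY_add, smul_smul, Finset.mul_sum]
    congr 1
    refine Finset.sum_congr rfl fun j _ => ?_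
    rw [R.dσ j p hp]; ring
  · intro p hp
    refine (R.hB hp).trans ?_
    gcongr
    linarith
  · intro p hp
    refine (R.hdiv hp).trans ?_
    gcongr
    linarith
  · intro p hp
    have := R.Ψ_pos p hp
    refine (R.hΨ hp).trans ?_
    gcongr
    linarith
  · intro p hp
    refine (R.hBF hp).trans ?_
    gcongr
    linarith
  · intro p hp ξ
    refine (R.hR hp ξ).trans ?_
    have h2 : 0 ≤ ξ (frA a X p ξ) := by
      have := R.ell p hp (fun i => ξ (X i p))
      have h2 : 0 ≤ lam * ∑ i, ξ (X i p) ^ 2 := mul_nonneg hlam.le (Finset.sum_nonneg fun i _ => sq_nonneg _)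
      refine (h2.trans this).trans (le_of_eq ?_)
      rw [frA_apply2]
      exact Finset.sum_congr rfl fun i _ => Finset.sum_congr rfl fun j _ => by ring
    gcongr
    linarith

end Frame
end UCP

end

section

set_option linter.unusedSectionVars false
set_option linter.unusedSimpArgs false
set_option maxSynthPendingDepth 3
namespace UCP

open BG

variable {m k : ℕ} {γ : ℝ}

lemma inner_single_one {n : ℕ} (v : EuclideanSpace ℝ (Fin n)) (i : Fin n) :
    inner ℝ v (EuclideanSpace.single i (1:ℝ)) = v i := by
  rw [EuclideanSpace.inner_single_right]; simp

/-- index of degenerate directions -/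
def gθ (l : Fin (m + k)) : ℝ := Fin.addCases (fun _ : Fin m => (0:ℝ)) (fun _ : Fin k => 1) l

/-- rescaled coordinates -/
def gζ (γ : ℝ) (l : Fin (m + k)) (p : E m k) : ℝ :=
  Fin.addCases (fun i : Fin m => p.1 i) (fun j : Fin k => (γ + 1) * (p.2 j * ‖p.1‖ ^ (-γ))) l

/-- power of the gauge -/
def nn (γ : ℝ) (p : E m k) : ℝ := ‖p.1‖ ^ (2 * (γ + 1)) + (γ + 1) ^ 2 * ‖p.2‖ ^ 2

/-- weight -/
def gΨ (γ : ℝ) (p : E m k) : ℝ := ‖p.1‖ ^ (2 * γ) * (nn γ p)⁻¹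

/-- logarithmic gauge -/
def gσ (γ : ℝ) (p : E m k) : ℝ := log (rho γ p)

/-- logarithmic derivative of |z|^γ -/
def gω (γ : ℝ) (p : E m k) : E m k →L[ℝ] ℝ :=
  (γ * (‖p.1‖ ^ 2)⁻¹) • (innerSL ℝ p.1).comp (ContinuousLinearMap.fst ℝ _ _)

/-- domain -/
def gU (γ : ℝ) : Set (E m k) := {p | p.1 ≠ 0 ∧ rho γ p < 1}

@[simp] lemma gθ_castAdd (i : Fin m) : gθ (Fin.castAdd k i) = 0 := by simp [gθ]
@[simp] lemma gθ_natAdd (j : Fin k) : gθ (Fin.natAdd m j) = 1 := by simp [gθ]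
@[simp] lemma gζ_castAdd (i : Fin m) (p : E m k) : gζ γ (Fin.castAdd k i) p = p.1 i := by simp [gζ]
@[simp] lemma gζ_natAdd (j : Fin k) (p : E m k) :
    gζ γ (Fin.natAdd m j) p = (γ + 1) * (p.2 j * ‖p.1‖ ^ (-γ)) := by simp [gζ]

@[simp] lemma X_castAdd (p : E m k) (i : Fin m) :
    Xvec γ p (Fin.castAdd k i) = (EuclideanSpace.single i 1, 0) := by
  simp [Xvec]

@[simp] lemma X_natAdd (p : E m k) (j : Fin k) :
    Xvec γ p (Fin.natAdd m j) = ‖p.1‖ ^ γ • ((0 : EuclideanSpace ℝ (Fin m)), EuclideanSpace.single j (1:ℝ)) := by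
  simp only [Xvec, Fin.addCases_right]
  refine Prod.ext ?_ ?_
  · simp
  · ext i
    simp

lemma gω_apply (p h : E m k) : gω γ p h = γ * (‖p.1‖ ^ 2)⁻¹ * inner ℝ p.1 h.1 := by
  simp [gω]

@[simp] lemma gω_X_castAdd (p : E m k) (i : Fin m) :
    gω γ p (Xvec γ p (Fin.castAdd k i)) = γ * (‖p.1‖ ^ 2)⁻¹ * p.1 i := by
  simp [gω_apply, inner_single_one]

@[simp] lemma gω_X_natAdd (p : E m k) (j : Fin k) :
    gω γ p (Xvec γ p (Fin.natAdd m j)) = 0 := by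
  simp [gω_apply]

lemma hasF_zpow {p : E m k} (hp : p.1 ≠ 0) (hγ : 0 < γ) (s : ℝ) :
    HasFDerivAt (fun q : E m k => ‖q.1‖ ^ s) ((s / γ * ‖p.1‖ ^ s) • gω γ p) p := by
  have h0 : HasFDerivAt (fun q : E m k => q.1) (ContinuousLinearMap.fst ℝ _ _) p := hasFDerivAt_fst
  have h1 := h0.norm_sq
  have hn : 0 < ‖p.1‖ := norm_pos_iff.2 hp
  have h2 := h1.rpow_const (p := s / 2) (Or.inl (by positivity))
  have h3 : (fun q : E m k => ‖q.1‖ ^ s) = fun q => (‖q.1‖ ^ 2) ^ (s / 2) := by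
    funext q
    rw [← rpow_natCast, ← rpow_mul (norm_nonneg _)]
    congr 1; push_cast; ring
  rw [h3]
  refine h2.congr_fderiv ?_
  refine ContinuousLinearMap.ext fun h => ?_
  simp only [smul_apply, ContinuousLinearMap.comp_apply, smul_eq_mul, gω_apply, innerSL_apply_apply,
    ContinuousLinearMap.coe_fst']
  have h4 : (‖p.1‖ ^ 2) ^ (s / 2 - 1) = ‖p.1‖ ^ s * (‖p.1‖ ^ 2)⁻¹ := by
    rw [rpow_sub_one (by positivity), div_eq_mul_inv]
    congr 1
    rw [← rpow_natCast, ← rpow_mul (norm_nonneg _)]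
    congr 1; push_cast; ring
  rw [h4]
  field_simp
  ring

lemma contDiffOn_zpow (s : ℝ) {n : ℕ∞} {U : Set (E m k)} (hU : ∀ p ∈ U, p.1 ≠ 0) :
    ContDiffOn ℝ n (fun q : E m k => ‖q.1‖ ^ s) U := by
  intro p hp
  have h1 : ContDiffAt ℝ n (fun q : E m k => ‖q.1‖) p := (contDiffAt_fst).norm ℝ (hU p hp)
  exact (h1.rpow_const_of_ne (norm_ne_zero_iff.2 (hU p hp))).contDiffWithinAt

lemma nn_pos (hγ : 0 < γ) {p : E m k} (hp : p.1 ≠ 0) : 0 < nn γ p := by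
  have hn : 0 < ‖p.1‖ := norm_pos_iff.2 hp
  unfold nn
  positivity

lemma nn_nonneg (p : E m k) : 0 ≤ nn γ p := by
  unfold nn
  positivity

lemma rho_nonneg (p : E m k) : 0 ≤ rho γ p := rpow_nonneg (nn_nonneg p) _

lemma rho_pos (hγ : 0 < γ) {p : E m k} (hp : p.1 ≠ 0) : 0 < rho γ p := rpow_pos_of_pos (nn_pos hγ hp) _

lemma rho_pow (hγ : 0 < γ) (p : E m k) : rho γ p ^ (2 * (γ + 1)) = nn γ p := by
  change (nn γ p ^ _) ^ _ = _
  rw [← rpow_mul (nn_nonneg p)]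
  have : 1 / (2 * (γ + 1)) * (2 * (γ + 1)) = 1 := by field_simp
  rw [this, rpow_one]

lemma gσ_eq (hγ : 0 < γ) {p : E m k} (hp : p.1 ≠ 0) :
    gσ γ p = 1 / (2 * (γ + 1)) * log (nn γ p) := by
  change log (nn γ p ^ _) = _
  rw [log_rpow (nn_pos hγ hp)]

lemma exp_gσ (hγ : 0 < γ) {p : E m k} (hp : p.1 ≠ 0) : exp (gσ γ p) = rho γ p :=
  exp_log (rho_pos hγ hp)

lemma continuous_nn (hγ : 0 < γ) : Continuous (nn γ : E m k → ℝ) := by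
  unfold nn
  have : Continuous fun p : E m k => ‖p.1‖ ^ (2 * (γ + 1)) :=
    (continuous_fst.norm).rpow_const fun _ => Or.inr (by positivity)
  fun_prop

lemma continuous_rho (hγ : 0 < γ) : Continuous (rho γ : E m k → ℝ) := by
  change Continuous fun p => nn γ p ^ _
  exact (continuous_nn hγ).rpow_const fun _ => Or.inr (by positivity)

lemma isOpen_gU (hγ : 0 < γ) : IsOpen (gU γ : Set (E m k)) :=
  (isOpen_ne_fun continuous_fst continuous_const).inter (isOpen_lt (continuous_rho hγ) continuous_const)

lemma hasF_nn (hγ : 0 < γ) {p : E m k} (hp : p.1 ≠ 0) :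
    HasFDerivAt (nn γ) ((2 * (γ + 1) * ‖p.1‖ ^ (2 * γ)) • (innerSL ℝ p.1).comp (ContinuousLinearMap.fst ℝ _ _)
      + (2 * (γ + 1) ^ 2) • (innerSL ℝ p.2).comp (ContinuousLinearMap.snd ℝ _ _)) p := by
  have h0 : HasFDerivAt (fun q : E m k => q.2) (ContinuousLinearMap.snd ℝ _ _) p := hasFDerivAt_snd
  have h1 := (hasF_zpow hp hγ (2 * (γ + 1))).fun_add (h0.norm_sq.const_mul ((γ + 1) ^ 2))
  refine h1.congr_fderiv ?_
  have hn : 0 < ‖p.1‖ := norm_pos_iff.2 hp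
  have h4 : ‖p.1‖ ^ (2 * (γ + 1)) = ‖p.1‖ ^ (2 * γ) * ‖p.1‖ ^ 2 := by
    rw [show 2 * (γ + 1) = 2 * γ + 2 by ring, rpow_add hn, rpow_two]
  refine ContinuousLinearMap.ext fun h => ?_
  simp only [add_apply, smul_apply, ContinuousLinearMap.comp_apply, smul_eq_mul, gω_apply, innerSL_apply_apply,
    ContinuousLinearMap.coe_fst', ContinuousLinearMap.coe_snd', h4]
  field_simp
  ring

lemma hasF_gσ (hγ : 0 < γ) {p : E m k} (hp : p.1 ≠ 0) :
    HasFDerivAt (gσ γ) (((nn γ p)⁻¹ * ‖p.1‖ ^ (2 * γ)) • (innerSL ℝ p.1).comp (ContinuousLinearMap.fst ℝ _ _)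
      + ((nn γ p)⁻¹ * (γ + 1)) • (innerSL ℝ p.2).comp (ContinuousLinearMap.snd ℝ _ _)) p := by
  have h1 := ((hasF_nn hγ hp).log (nn_pos hγ hp).ne').const_mul (1 / (2 * (γ + 1)))
  have hev : gσ γ =ᶠ[nhds p] fun q => 1 / (2 * (γ + 1)) * log (nn γ q) := by
    have : ∀ᶠ q : E m k in nhds p, q.1 ≠ 0 := continuous_fst.continuousAt.eventually_ne hp
    filter_upwards [this] with q hq using gσ_eq hγ hq
  refine (h1.congr_of_eventuallyEq hev).congr_fderiv ?_
  refine ContinuousLinearMap.ext fun h => ?_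
  simp only [add_apply, smul_apply, ContinuousLinearMap.comp_apply, smul_eq_mul, innerSL_apply_apply,
    ContinuousLinearMap.coe_fst', ContinuousLinearMap.coe_snd']
  field_simp

lemma hasF_gΨ (hγ : 0 < γ) {p : E m k} (hp : p.1 ≠ 0) :
    HasFDerivAt (gΨ γ) (gΨ γ p • ((2:ℝ) • gω γ p - (2 * γ + 2) • fderiv ℝ (gσ γ) p)) p := by
  have hnn := nn_pos hγ hp
  have h1 := (hasF_zpow hp hγ (2 * γ)).fun_mul
    ((hasDerivAt_inv hnn.ne').comp_hasFDerivAt p (hasF_nn hγ hp))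
  refine h1.congr_fderiv ?_
  rw [(hasF_gσ hγ hp).fderiv]
  refine ContinuousLinearMap.ext fun h => ?_
  simp only [add_apply, sub_apply, smul_apply, ContinuousLinearMap.comp_apply, smul_eq_mul, innerSL_apply_apply,
    ContinuousLinearMap.coe_fst', ContinuousLinearMap.coe_snd', gΨ, Function.comp_apply]
  field_simp
  ring

lemma norm_fst_sq (p : E m k) : ∑ i, p.1 i ^ 2 = ‖p.1‖ ^ 2 := by
  rw [EuclideanSpace.norm_sq_eq]; simp

lemma norm_snd_sq (p : E m k) : ∑ i, p.2 i ^ 2 = ‖p.2‖ ^ 2 := by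
  rw [EuclideanSpace.norm_sq_eq]; simp

lemma gΨζ (hγ : 0 < γ) {p : E m k} (hp : p.1 ≠ 0) : gΨ γ p * ∑ l, gζ γ l p ^ 2 = 1 := by
  have hn : 0 < ‖p.1‖ := norm_pos_iff.2 hp
  rw [Fin.sum_univ_add]
  simp only [gζ_castAdd, gζ_natAdd, mul_pow, ← Finset.mul_sum, ← Finset.sum_mul, norm_fst_sq, norm_snd_sq]
  have h1 : ‖p.1‖ ^ (2 * γ) * ‖p.1‖ ^ 2 = ‖p.1‖ ^ (2 * (γ + 1)) := by
    rw [← rpow_two, ← rpow_add hn]; congr 1; ring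
  have h2 : ‖p.1‖ ^ (2 * γ) * (‖p.1‖ ^ (-γ)) ^ 2 = 1 := by
    rw [← rpow_two, ← rpow_mul hn.le, ← rpow_add hn]
    rw [show 2 * γ + -γ * 2 = 0 by ring, rpow_zero]
  have hnn := nn_pos hγ hp
  unfold gΨ
  have h3 : nn γ p * (nn γ p)⁻¹ = 1 := mul_inv_cancel₀ hnn.ne'
  have h4 : nn γ p = ‖p.1‖ ^ (2 * (γ + 1)) + (γ + 1) ^ 2 * ‖p.2‖ ^ 2 := rfl
  rw [h4] at h3 ⊢
  linear_combination (‖p.1‖ ^ (2 * (γ + 1)) + (γ + 1) ^ 2 * ‖p.2‖ ^ 2)⁻¹ * h1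
    + (‖p.1‖ ^ (2 * (γ + 1)) + (γ + 1) ^ 2 * ‖p.2‖ ^ 2)⁻¹ * (γ + 1) ^ 2 * ‖p.2‖ ^ 2 * h2 + h3

lemma gdσ (hγ : 0 < γ) {p : E m k} (hp : p.1 ≠ 0) (l : Fin (m + k)) :
    fderiv ℝ (gσ γ) p (Xvec γ p l) = gΨ γ p * gζ γ l p := by
  have hn : 0 < ‖p.1‖ := norm_pos_iff.2 hp
  rw [(hasF_gσ hγ hp).fderiv]
  refine Fin.addCases (fun i => ?_) (fun j => ?_) l
  · simp [gΨ, inner_single_one, -mul_eq_mul_right_iff]; ring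
  · have h2 : ‖p.1‖ ^ (2 * γ) * ‖p.1‖ ^ (-γ) = ‖p.1‖ ^ γ := by
      rw [← rpow_add hn]; congr 1; ring
    simp [gΨ, -mul_eq_mul_left_iff, inner_smul_right, inner_single_one]
    rw [← h2]; ring

lemma hasF_gζ (hγ : 0 < γ) {p : E m k} (hp : p.1 ≠ 0) (l : Fin (m + k)) :
    ContDiffOn ℝ 1 (gζ γ l) (gU γ : Set (E m k)) ∧ ∀ j,
    fderiv ℝ (gζ γ l) p (Xvec γ p j) = (if j = l then 1 + γ * gθ l else 0)
      - gθ l * gω γ p (Xvec γ p j) * gζ γ l p := by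
  have hn : 0 < ‖p.1‖ := norm_pos_iff.2 hp
  refine Fin.addCases (fun i => ?_) (fun i => ?_) l
  · have h0 : gζ γ (Fin.castAdd k i) = fun p : E m k =>
      ((EuclideanSpace.proj i : EuclideanSpace ℝ (Fin m) →L[ℝ] ℝ).comp
        (ContinuousLinearMap.fst ℝ _ _)) p := by
      funext p; simp
    rw [h0]
    refine ⟨(ContinuousLinearMap.contDiff _).contDiffOn, fun j => ?_⟩
    rw [ContinuousLinearMap.fderiv]
    refine Fin.addCases (fun j => ?_) (fun j => ?_) j
    · simp [eq_comm]
    · have : Fin.natAdd m j ≠ Fin.castAdd k i := by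
        intro h; have := congrArg Fin.val h; simp at this; omega
      simp [this]
  · have h0 : gζ γ (Fin.natAdd m i) = fun p : E m k => (γ + 1) *
      (((EuclideanSpace.proj i : EuclideanSpace ℝ (Fin k) →L[ℝ] ℝ).comp
        (ContinuousLinearMap.snd ℝ _ _)) p * ‖p.1‖ ^ (-γ)) := by
      funext p; simp
    refine ⟨?_, fun j => ?_⟩
    · rw [h0]
      exact contDiffOn_const.mul ((ContinuousLinearMap.contDiff _).contDiffOn.mul
        (contDiffOn_zpow (n := 1) _ fun p hp => hp.1))
    have hL := ((EuclideanSpace.proj i : EuclideanSpace ℝ (Fin k) →L[ℝ] ℝ).comp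
        (ContinuousLinearMap.snd ℝ (EuclideanSpace ℝ (Fin m)) _)).hasFDerivAt (x := p)
    have hd := (hL.fun_mul (hasF_zpow hp hγ (-γ))).const_mul (γ + 1)
    rw [h0]
    have hinv : ‖p.1‖ ^ γ * ‖p.1‖ ^ (-γ) = 1 := by
      rw [← rpow_add hn, add_neg_cancel, rpow_zero]
    rw [hd.fderiv]
    simp only [smul_apply, add_apply, smul_eq_mul, gθ_natAdd, gζ_natAdd,
      ContinuousLinearMap.comp_apply, ContinuousLinearMap.coe_snd', PiLp.proj_apply]
    refine Fin.addCases (fun j => ?_) (fun j => ?_) j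
    · have : Fin.castAdd k j ≠ Fin.natAdd m i := by
        intro h; have := congrArg Fin.val h; simp at this; omega
      rw [if_neg this]
      simp only [X_castAdd, gω_X_castAdd, PiLp.zero_apply, mul_zero, add_zero, map_zero]
      field_simp
      ring
    · simp only [gω_X_natAdd, X_natAdd, Prod.smul_snd, PiLp.smul_apply, smul_eq_mul, mul_zero, zero_mul,
        zero_add, sub_zero, map_smul]
      by_cases h : i = j
      · subst h
        simp [gω_apply]
        linear_combination (γ + 1) * hinv
      · have : Fin.natAdd m j ≠ Fin.natAdd m i := by
          intro h'; exact h ((Fin.natAdd_injective k m h').symm)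
        rw [if_neg this]
        simp [h, gω_apply]

lemma X_C1 (l : Fin (m + k)) : ContDiffOn ℝ 1 (fun p => Xvec γ p l) (gU γ : Set (E m k)) := by
  refine Fin.addCases (fun i => ?_) (fun j => ?_) l
  · simp only [X_castAdd]; exact contDiffOn_const
  · simp only [X_natAdd]
    exact (contDiffOn_zpow (n := 1) _ fun p hp => hp.1).smul contDiffOn_const

lemma gdX (hγ : 0 < γ) {p : E m k} (hp : p.1 ≠ 0) (l : Fin (m + k)) (h : E m k) :
    fderiv ℝ (fun p => Xvec γ p l) p h = (gθ l * gω γ p h) • Xvec γ p l := by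
  refine Fin.addCases (fun i => ?_) (fun j => ?_) l
  · simp only [X_castAdd]; simp
  · simp only [X_natAdd]
    rw [((hasF_zpow hp hγ γ).smul_const _).fderiv]
    have : γ / γ = 1 := div_self hγ.ne'
    rw [ContinuousLinearMap.smulRight_apply, smul_smul, this]
    simp only [smul_apply, smul_eq_mul, gθ_natAdd, one_mul]
    rw [mul_comm]

lemma gωZ {p : E m k} (hp : p.1 ≠ 0) :
    ∑ l, gζ γ l p * gω γ p (Xvec γ p l) = γ := by
  have hn : 0 < ‖p.1‖ := norm_pos_iff.2 hp
  rw [Fin.sum_univ_add]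
  simp only [gζ_castAdd, gω_X_castAdd, gω_X_natAdd, mul_zero, Finset.sum_const_zero, add_zero]
  have : ∑ i, p.1 i * (γ * (‖p.1‖ ^ 2)⁻¹ * p.1 i) = γ * (‖p.1‖ ^ 2)⁻¹ * ∑ i, p.1 i ^ 2 := by
    rw [Finset.mul_sum]
    exact Finset.sum_congr rfl fun i _ => by ring
  rw [this, norm_fst_sq]
  field_simp

end UCP

end

section

set_option linter.unusedSectionVars false
set_option linter.unusedSimpArgs false
set_option maxSynthPendingDepth 3
namespace UCP

open BG

variable {m k : ℕ} {γ : ℝ}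

/-- coefficients -/
def gA (A : E m k → Matrix (Fin (m + k)) (Fin (m + k)) ℝ) (i j : Fin (m + k)) (q : E m k) : ℝ := A q i j

/-- frame -/
def gX (γ : ℝ) (l : Fin (m + k)) (p : E m k) : E m k := Xvec γ p l

/-- angle -/
def gw (γ : ℝ) (p : E m k) : ℝ := ‖p.1‖ / rho γ p

lemma norm_le_rho (hγ : 0 < γ) (p : E m k) : ‖p.1‖ ≤ rho γ p := by
  have h1 : ‖p.1‖ ^ (2 * (γ + 1)) ≤ rho γ p ^ (2 * (γ + 1)) := by
    rw [rho_pow hγ]; unfold nn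
    have : 0 ≤ (γ + 1) ^ 2 * ‖p.2‖ ^ 2 := by positivity
    linarith
  exact (rpow_le_rpow_iff (norm_nonneg _) (rho_nonneg p) (by positivity)).1 h1

lemma gw_pos (hγ : 0 < γ) {p : E m k} (hp : p.1 ≠ 0) : 0 < gw γ p :=
  div_pos (norm_pos_iff.2 hp) (rho_pos hγ hp)

lemma gw_le (hγ : 0 < γ) (p : E m k) : gw γ p ≤ 1 :=
  div_le_one_of_le₀ (norm_le_rho hγ p) (rho_nonneg p)

lemma gw_mul (hγ : 0 < γ) {p : E m k} (hp : p.1 ≠ 0) : gw γ p * rho γ p = ‖p.1‖ :=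
  div_mul_cancel₀ _ (rho_pos hγ hp).ne'

lemma psi_eq (p : E m k) : psi γ p = gw γ p ^ (2 * γ) := by
  rw [gw, div_rpow (norm_nonneg _) (rho_nonneg p), psi]

lemma psi_rpow (hγ : 0 < γ) {p : E m k} (hp : p.1 ≠ 0) (s : ℝ) : psi γ p ^ s = gw γ p ^ (2 * γ * s) := by
  rw [psi_eq, rpow_mul (gw_pos hγ hp).le (2 * γ) s]

lemma psi_eq_gΨ (hγ : 0 < γ) {p : E m k} (hp : p.1 ≠ 0) : psi γ p = gΨ γ p * rho γ p ^ 2 := by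
  have hr := rho_pos hγ hp
  rw [psi, gΨ, ← rho_pow hγ, show 2 * (γ + 1) = 2 * γ + 2 by ring, rpow_add hr, rpow_two]
  have : 0 < rho γ p ^ (2 * γ) := rpow_pos_of_pos hr _
  field_simp

lemma ζ_lt (hγ : 0 < γ) {p : E m k} (hp : p.1 ≠ 0) (l : Fin (m + k)) (hl : (l : ℕ) < m) :
    |gζ γ l p| ≤ gw γ p * rho γ p := by
  obtain ⟨i, rfl⟩ : ∃ i : Fin m, l = Fin.castAdd k i := ⟨⟨l, hl⟩, by ext; simp⟩
  rw [gζ_castAdd, gw_mul hγ hp]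
  have := PiLp.norm_apply_le p.1 i
  rwa [Real.norm_eq_abs] at this

lemma ζ_ge (hγ : 0 < γ) {p : E m k} (hp : p.1 ≠ 0) (l : Fin (m + k)) (hl : m ≤ (l : ℕ)) :
    |gζ γ l p| ≤ gw γ p ^ (-γ) * rho γ p := by
  obtain ⟨i, rfl⟩ : ∃ i : Fin k, l = Fin.natAdd m i := ⟨⟨l - m, by omega⟩, by ext; simp; omega⟩
  have hr := rho_pos hγ hp
  have hn : 0 < ‖p.1‖ := norm_pos_iff.2 hp
  rw [gζ_natAdd, gw, div_rpow hn.le hr.le, rpow_neg hr.le, div_inv_eq_mul, abs_mul, abs_mul,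
    abs_of_pos (rpow_pos_of_pos hn _), abs_of_pos (by linarith : (0:ℝ) < γ + 1)]
  have h1 := PiLp.norm_apply_le p.2 i
  rw [Real.norm_eq_abs] at h1
  have h2 : (γ + 1) * ‖p.2‖ ≤ rho γ p ^ γ * rho γ p := by
    have h3 : rho γ p ^ γ * rho γ p = rho γ p ^ (γ + 1) := by rw [rpow_add_one hr.ne']
    rw [h3]
    refine le_of_sq_le_sq ?_ (by positivity)
    rw [← rpow_mul_natCast hr.le]
    push_cast
    rw [mul_comm (γ + 1) 2, rho_pow hγ, nn]
    have : 0 ≤ ‖p.1‖ ^ (2 * (γ + 1)) := by positivity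
    nlinarith
  have h4 : (γ + 1) * |p.2 i| ≤ rho γ p ^ γ * rho γ p := le_trans (by gcongr) h2
  calc (γ + 1) * (|p.2 i| * ‖p.1‖ ^ (-γ)) = ((γ + 1) * |p.2 i|) * ‖p.1‖ ^ (-γ) := by ring
    _ ≤ (rho γ p ^ γ * rho γ p) * ‖p.1‖ ^ (-γ) := by gcongr
    _ = _ := by ring

section hyp
variable {Λ : ℝ} {A : E m k → Matrix (Fin (m + k)) (Fin (m + k)) ℝ}

lemma sub_one_eq (i j : Fin (m + k)) (q : E m k) :
    (A q - 1) i j = gA A i j q - if i = j then 1 else 0 := by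
  simp [gA, Matrix.one_apply]

lemma Xd_eq (l i j : Fin (m + k)) (p : E m k) :
    Xd γ l (fun q => (A q - 1) i j) p = fderiv ℝ (gA A i j) p (gX γ l p) := by
  simp only [sub_one_eq, Xd, fderiv_sub_const, gX]

lemma hb0 (hγ : 0 < γ) (hΛ : 0 < Λ) (hH : HypH γ Λ A) {p : E m k} (hp : p ∈ gU γ) (i j : Fin (m + k)) :
    |gA A i j p - if i = j then 1 else 0| ≤ Λ * rho γ p := by
  have h := (hH p hp.2).1 i j
  rw [sub_one_eq] at h
  refine h.trans ?_
  have hr := rho_pos hγ hp.1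
  split_ifs
  · exact le_refl _
  · rw [psi_rpow hγ hp.1]
    have : gw γ p ^ (2 * γ * (1 / 2 + 1 / (2 * γ))) ≤ 1 :=
      rpow_le_one (gw_pos hγ hp.1).le (gw_le hγ p) (by positivity)
    calc _ ≤ Λ * 1 * rho γ p := by gcongr
      _ = _ := by ring

lemma hb0' (hγ : 0 < γ) (hH : HypH γ Λ A) {p : E m k} (hp : p ∈ gU γ) (i j : Fin (m + k))
    (hj : m ≤ (i : ℕ) ∨ m ≤ (j : ℕ)) :
    |gA A i j p - if i = j then 1 else 0| ≤ Λ * gw γ p ^ (γ + 1) * rho γ p := by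
  have h := (hH p hp.2).1 i j
  rw [sub_one_eq] at h
  rw [if_neg (show ¬ ((i : ℕ) < m ∧ (j : ℕ) < m) by omega), psi_rpow hγ hp.1] at h
  have : 2 * γ * (1 / 2 + 1 / (2 * γ)) = γ + 1 := by field_simp
  rwa [this] at h

lemma hbζ (hγ : 0 < γ) (hΛ : 0 < Λ) (hH : HypH γ Λ A) {p : E m k} (hp : p ∈ gU γ) (i j : Fin (m + k)) :
    |(gA A i j p - if i = j then 1 else 0) * gζ γ j p| ≤ Λ * rho γ p * ‖p.1‖ := by
  have hr := rho_pos hγ hp.1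
  have hw := gw_pos hγ hp.1
  by_cases hj : (j : ℕ) < m
  · refine (abs_mul_le_mul (hb0 hγ hΛ hH hp i j) (ζ_lt hγ hp.1 j hj)).trans ?_
    rw [gw_mul hγ hp.1]
  · push Not at hj
    refine (abs_mul_le_mul (hb0' hγ hH hp i j (Or.inr hj)) (ζ_ge hγ hp.1 j hj)).trans ?_
    rw [← gw_mul hγ hp.1]
    have : gw γ p ^ (γ + 1) * gw γ p ^ (-γ) = gw γ p := by
      rw [← rpow_add hw]; simp
    apply le_of_eq
    linear_combination Λ * rho γ p * rho γ p * this

lemma hdb (hγ : 0 < γ) (hΛ : 0 < Λ) (hH : HypH γ Λ A) {p : E m k} (hp : p ∈ gU γ) (l i j : Fin (m + k)) :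
    |fderiv ℝ (gA A i j) p (gX γ l p)| ≤ Λ := by
  have h := (hH p hp.2).2 l i j
  rw [Xd_eq, psi_rpow hγ hp.1, psi_rpow hγ hp.1] at h
  refine h.trans ?_
  have h1 : gw γ p ^ (2 * γ * (1 + 1 / (2 * γ))) ≤ 1 :=
      rpow_le_one (gw_pos hγ hp.1).le (gw_le hγ p) (by positivity)
  have h2 : gw γ p ^ (2 * γ * (1 / 2)) ≤ 1 :=
      rpow_le_one (gw_pos hγ hp.1).le (gw_le hγ p) (by positivity)
  split_ifs
  · exact le_refl _
  · calc _ ≤ Λ * 1 := by gcongr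
      _ = _ := by ring
  · calc _ ≤ Λ * 1 := by gcongr
      _ = _ := by ring

lemma hdb' (hγ : 0 < γ) (hΛ : 0 < Λ) (hH : HypH γ Λ A) {p : E m k} (hp : p ∈ gU γ) (l i j : Fin (m + k))
    (hl : m ≤ (l : ℕ) ∨ m ≤ (j : ℕ)) :
    |fderiv ℝ (gA A i j) p (gX γ l p)| ≤ Λ * gw γ p ^ γ := by
  have h := (hH p hp.2).2 l i j
  rw [Xd_eq, psi_rpow hγ hp.1, psi_rpow hγ hp.1] at h
  refine h.trans ?_
  have h1 : gw γ p ^ (2 * γ * (1 + 1 / (2 * γ))) ≤ gw γ p ^ γ := by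
    refine rpow_le_rpow_of_exponent_ge (gw_pos hγ hp.1) (gw_le hγ p) ?_
    have : 2 * γ * (1 + 1 / (2 * γ)) = 2 * γ + 1 := by field_simp
    rw [this]; linarith
  have h2 : 2 * γ * (1 / 2) = γ := by ring
  rw [h2]
  split_ifs with h3
  · omega
  · gcongr
  · exact le_refl _

lemma hdbζ (hγ : 0 < γ) (hΛ : 0 < Λ) (hH : HypH γ Λ A) {p : E m k} (hp : p ∈ gU γ) (l i j q : Fin (m + k))
    (hq : q = l ∨ q = j) :
    |fderiv ℝ (gA A i j) p (gX γ l p) * gζ γ q p| ≤ Λ * rho γ p := by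
  have hr := rho_pos hγ hp.1
  have hw := gw_pos hγ hp.1
  by_cases hj : (q : ℕ) < m
  · refine (abs_mul_le_mul (hdb hγ hΛ hH hp l i j) (ζ_lt hγ hp.1 q hj)).trans ?_
    have := gw_le hγ p
    calc Λ * (gw γ p * rho γ p) ≤ Λ * (1 * rho γ p) := by gcongr
      _ = _ := by ring
  · push Not at hj
    have : m ≤ (l : ℕ) ∨ m ≤ (j : ℕ) := by
      rcases hq with rfl | rfl
      · exact Or.inl hj
      · exact Or.inr hj
    refine (abs_mul_le_mul (hdb' hγ hΛ hH hp l i j this) (ζ_ge hγ hp.1 q hj)).trans ?_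
    have : gw γ p ^ γ * gw γ p ^ (-γ) = 1 := by
      rw [← rpow_add hw]; simp
    apply le_of_eq
    linear_combination Λ * rho γ p * this

lemma hY (hγ : 0 < γ) (hΛ : 0 < Λ) (hH : HypH γ Λ A) {p : E m k} (hp : p ∈ gU γ) (l : Fin (m + k)) :
    |frY (gA A) (gζ γ) l p| ≤ (m + k : ℝ) * (Λ * rho γ p * ‖p.1‖) := by
  have := abs_sum_le_card _ (fun q => hbζ hγ hΛ hH hp l q)
  simpa [frY] using this

lemma gω_X_le (hγ : 0 < γ) {p : E m k} (hp : p.1 ≠ 0) (j : Fin (m + k)) :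
    ‖p.1‖ * |gω γ p (gX γ j p)| ≤ γ := by
  have hn : 0 < ‖p.1‖ := norm_pos_iff.2 hp
  unfold gX
  refine Fin.addCases (fun i => ?_) (fun i => ?_) j
  · rw [gω_X_castAdd, abs_mul, abs_of_pos (by positivity : 0 < γ * (‖p.1‖ ^ 2)⁻¹)]
    have h1 := PiLp.norm_apply_le p.1 i
    rw [Real.norm_eq_abs] at h1
    calc ‖p.1‖ * (γ * (‖p.1‖ ^ 2)⁻¹ * |p.1 i|) ≤ ‖p.1‖ * (γ * (‖p.1‖ ^ 2)⁻¹ * ‖p.1‖) := by gcongr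
      _ = γ := by field_simp
  · rw [gω_X_natAdd]; simp; exact hγ.le

lemma mul_le_of_ω {x z w c g : ℝ} (hx : |x| ≤ c * z) (hc : 0 ≤ c) (hw : z * |w| ≤ g) : |x * w| ≤ c * g := by
  rw [abs_mul]
  calc |x| * |w| ≤ c * z * |w| := by gcongr
    _ = c * (z * |w|) := by ring
    _ ≤ c * g := by gcongr

/-- constant -/
def gL (m k : ℕ) (γ Λ : ℝ) : ℝ :=
  Λ + (m + k) * (Λ + Λ * (1 + γ) + Λ * γ) + (m + k) * Λ * γ + (m + k) * (Λ + (m + k) * Λ * Λ)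

lemma hasF_Y (hγ : 0 < γ) (hA : C1coeff A) {p : E m k} (hp : p ∈ gU γ) (l : Fin (m + k)) :
    HasFDerivAt (frY (gA A) (gζ γ) l) (∑ q, ((gA A l q p - if l = q then 1 else 0) • fderiv ℝ (gζ γ q) p +
      gζ γ q p • fderiv ℝ (gA A l q) p)) p := by
  refine HasFDerivAt.fun_sum fun q _ => ?_
  have h1 : DifferentiableAt ℝ (gA A l q) p := (hA l q).differentiable one_ne_zero p
  have h2 : DifferentiableAt ℝ (gζ γ q) p :=
    ((hasF_gζ hγ hp.1 q).1.differentiableOn one_ne_zero).differentiableAt ((isOpen_gU hγ).mem_nhds hp)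
  exact (h1.hasFDerivAt.sub_const _).fun_mul h2.hasFDerivAt

lemma contDiffOn_nn {n : ℕ∞} : ContDiffOn ℝ n (nn γ) (gU γ : Set (E m k)) := by
  unfold nn
  exact (contDiffOn_zpow _ fun p hp => hp.1).add (contDiffOn_const.mul (contDiff_snd.norm_sq ℝ).contDiffOn)

theorem gframe (hγ : 0 < γ) (hΛ : 0 < Λ) {lam : ℝ} (hlam : 0 < lam) (hA1 : C1coeff A) (hA2 : Symm A)
    (hA3 : Elliptic lam A) (hH : HypH γ Λ A) :
    Frame (gU γ : Set (E m k)) (gX γ) (gω γ) gθ (gζ γ) (gA A) (gσ γ) (gΨ γ) γ (∑ l : Fin (m + k), (1 + γ * gθ l))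
      (gL m k γ Λ) lam where
  isOpen := isOpen_gU hγ
  γ0 := hγ.le
  L0 := by unfold gL; positivity
  lam0 := hlam
  θ0 l := by refine Fin.addCases (fun i => ?_) (fun j => ?_) l <;> simp
  θ1 l := by refine Fin.addCases (fun i => ?_) (fun j => ?_) l <;> simp
  X_C1 l := X_C1 l
  ζ_C1 l := by
    intro p hp
    exact (hasF_gζ hγ hp.1 l).1 p hp
  a_C1 i j := (hA1 i j).contDiffOn
  Ψ_C1 := (contDiffOn_zpow (n := 1) _ fun p hp => hp.1).mul
    ((contDiffOn_nn (n := 1)).inv fun p hp => (nn_pos hγ hp.1).ne')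
  σ_C2 := by
    have : ContDiffOn ℝ 2 (fun p => 1 / (2 * (γ + 1)) * log (nn γ p)) (gU γ : Set (E m k)) :=
      contDiffOn_const.mul ((contDiffOn_nn (n := 2)).log fun p hp => (nn_pos hγ hp.1).ne')
    exact this.congr fun p hp => gσ_eq hγ hp.1
  dX l p hp h := gdX hγ hp.1 l h
  θω l p hp := by
    unfold gX
    refine Fin.addCases (fun i => ?_) (fun j => ?_) l
    · rw [gθ_castAdd, zero_mul]
    · rw [gω_X_natAdd, mul_zero]
  dζ l j p hp := (hasF_gζ hγ hp.1 l).2 j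
  ωZ p hp := gωZ hp.1
  dσ l p hp := gdσ hγ hp.1 l
  Ψζ p hp := gΨζ hγ hp.1
  Ψ_pos p hp := by
    have := nn_pos hγ hp.1
    have hn : 0 < ‖p.1‖ := norm_pos_iff.2 hp.1
    unfold gΨ; positivity
  dΨ p hp h := by
    rw [(hasF_gΨ hγ hp.1).fderiv]
    simp only [smul_apply, sub_apply, smul_eq_mul]
  Qe := rfl
  symm i j p _ := hA2 p i j
  ell p _ η := (hA3 p η).1
  e1 p hp := by rw [exp_gσ hγ hp.1]; exact hp.2.le
  b0 i j p hp := by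
    rw [exp_gσ hγ hp.1]
    refine (hb0 hγ hΛ hH hp i j).trans ?_
    have := rho_pos hγ hp.1
    have h2 : Λ ≤ gL m k γ Λ := by
      unfold gL
      have : 0 ≤ (m + k : ℝ) * (Λ + Λ * (1 + γ) + Λ * γ) + (m + k) * Λ * γ + (m + k) * (Λ + (m + k) * Λ * Λ) := by
        positivity
      linarith
    gcongr
  b1 l j p hp := by
    rw [exp_gσ hγ hp.1, (hasF_Y hγ hA1 hp l).fderiv]
    have hr := rho_pos hγ hp.1
    simp only [sum_apply, add_apply, smul_apply, smul_eq_mul]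
    have h : ∀ q, |(gA A l q p - if l = q then 1 else 0) * fderiv ℝ (gζ γ q) p (gX γ j p) +
        gζ γ q p * fderiv ℝ (gA A l q) p (gX γ j p)| ≤ (Λ + Λ * (1 + γ) + Λ * γ) * rho γ p := by
      intro q
      have h1 := hdbζ hγ hΛ hH hp j l q q (Or.inr rfl)
      have h2 := hb0 hγ hΛ hH hp l q
      have h3 : |(if j = q then 1 + γ * gθ q else (0:ℝ))| ≤ 1 + γ := by
        split_ifs
        · refine Fin.addCases (fun i => ?_) (fun i => ?_) q
          · simp; exact hγ.le
          · simp; rw [abs_of_pos]; linarith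
        · simp; linarith
      have h4 := mul_le_of_ω (hbζ hγ hΛ hH hp l q) (by positivity) (gω_X_le hγ hp.1 j)
      have h5 : |gθ q| ≤ 1 := by refine Fin.addCases (fun i => ?_) (fun j => ?_) q <;> simp
      have h6 := abs_mul_le_mul h2 h3
      have h7 := abs_mul_le_mul h5 h4
      rw [show fderiv ℝ (gζ γ q) p (gX γ j p) = _ from (hasF_gζ hγ hp.1 q).2 j]
      change |_ * (_ - gθ q * gω γ p (gX γ j p) * gζ γ q p) + _| ≤ _
      rw [abs_le] at h1 h6 h7 ⊢
      constructor <;> nlinarith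
    have h2 := abs_sum_le_card _ h
    refine h2.trans ?_
    rw [← mul_assoc]
    refine mul_le_mul_of_nonneg_right ?_ hr.le
    rw [Fintype.card_fin]; push_cast; unfold gL
    have : 0 ≤ Λ + (m + k) * Λ * γ + (m + k) * (Λ + (m + k) * Λ * Λ) := by positivity
    linarith
  b2 l j p hp := by
    rw [exp_gσ hγ hp.1]
    have hr := rho_pos hγ hp.1
    have h1 : |frY (gA A) (gζ γ) l p| ≤ ((m + k : ℝ) * (Λ * rho γ p)) * ‖p.1‖ :=
      (hY hγ hΛ hH hp l).trans (le_of_eq (by ring))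
    refine (mul_le_of_ω h1 (by positivity) (gω_X_le hγ hp.1 j)).trans ?_
    have : 0 ≤ Λ + (m + k) * (Λ + Λ * (1 + γ) + Λ * γ) + (m + k) * (Λ + (m + k) * Λ * Λ) := by positivity
    have h3 : (m + k) * Λ * γ ≤ gL m k γ Λ := by unfold gL; linarith
    calc _ = ((m + k) * Λ * γ) * rho γ p := by ring
      _ ≤ _ := by gcongr
  b3 i j p hp := by
    rw [exp_gσ hγ hp.1]
    have hr := rho_pos hγ hp.1
    simp only [frF, map_sum, map_smul, smul_eq_mul]
    have h : ∀ l, |(gζ γ l p + frY (gA A) (gζ γ) l p) * fderiv ℝ (gA A i j) p (gX γ l p)| ≤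
        (Λ + (m + k) * Λ * Λ) * rho γ p := by
      intro l
      have h1 := hdbζ hγ hΛ hH hp l i j l (Or.inl rfl)
      have h2 : |frY (gA A) (gζ γ) l p| ≤ (m + k : ℝ) * Λ * rho γ p := by
        refine (hY hγ hΛ hH hp l).trans ?_
        have : ‖p.1‖ ≤ 1 := (norm_le_rho hγ p).trans hp.2.le
        calc (m + k : ℝ) * (Λ * rho γ p * ‖p.1‖) ≤ (m + k : ℝ) * (Λ * rho γ p * 1) := by gcongr
          _ = _ := by ring
      have h3 := abs_mul_le_mul h2 (hdb hγ hΛ hH hp l i j)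
      rw [abs_le] at h1 h3 ⊢
      constructor <;> nlinarith
    have h2 := abs_sum_le_card _ h
    refine h2.trans ?_
    rw [← mul_assoc]
    refine mul_le_mul_of_nonneg_right ?_ hr.le
    rw [Fintype.card_fin]; push_cast; unfold gL
    have : 0 ≤ Λ + (m + k) * (Λ + Λ * (1 + γ) + Λ * γ) + (m + k) * Λ * γ := by positivity
    linarith

end hyp

end UCP

end

section

set_option linter.unusedSectionVars false
set_option linter.unusedSimpArgs false
set_option maxSynthPendingDepth 3
namespace UCP

open BG

variable {m k : ℕ} {γ : ℝ}

lemma exists_phi : ∃ (φ : ℝ → ℝ) (M : ℝ), 0 ≤ M ∧ ContDiff ℝ 1 φ ∧ (∀ x, 0 ≤ φ x) ∧ (∀ x, φ x ≤ 1) ∧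
    (∀ x ≤ 0, φ x = 0) ∧ (∀ x, 1 ≤ x → φ x = 1) ∧ ∀ x, |deriv φ x| ≤ M := by
  have hc : ContDiff ℝ 1 smoothTransition := smoothTransition.contDiff
  have hd : Continuous (deriv smoothTransition) := hc.continuous_deriv le_rfl
  obtain ⟨M, hM⟩ := isCompact_Icc.exists_bound_of_continuousOn (s := Icc (0:ℝ) 1) hd.continuousOn
  have hM0 : 0 ≤ M := (norm_nonneg _).trans (hM 0 (by simp))
  refine ⟨smoothTransition, M, hM0, hc, smoothTransition.nonneg, smoothTransition.le_one,
    fun x hx => smoothTransition.zero_of_nonpos hx, fun x hx => smoothTransition.one_of_one_le hx, fun x => ?_⟩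
  by_cases h0 : x < 0
  · have : smoothTransition =ᶠ[nhds x] fun _ => 0 := by
      filter_upwards [Iio_mem_nhds h0] with y hy using smoothTransition.zero_of_nonpos (le_of_lt hy)
    rw [this.deriv_eq]; simpa using hM0
  by_cases h1 : 1 < x
  · have : smoothTransition =ᶠ[nhds x] fun _ => 1 := by
      filter_upwards [Ioi_mem_nhds h1] with y hy using smoothTransition.one_of_one_le (le_of_lt hy)
    rw [this.deriv_eq]; simpa using hM0
  · exact hM x ⟨by linarith, by linarith⟩

lemma exists_chi (m k : ℕ) : ∃ (χ : ℕ → E m k → ℝ) (M : ℝ), 0 ≤ M ∧ (∀ n, ContDiff ℝ 1 (χ n)) ∧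
    (∀ n p, 0 ≤ χ n p) ∧ (∀ n p, χ n p ≤ 1) ∧
    (∀ p, p.1 ≠ 0 → ∀ᶠ n in atTop, χ n p = 1 ∧ fderiv ℝ (χ n) p = 0) ∧
    (∀ (n : ℕ) p, ‖p.1‖ < 1 / ((n : ℝ) + 1) → χ n p = 0 ∧ fderiv ℝ (χ n) p = 0) ∧
    ∀ n p h, ‖p.1‖ * |fderiv ℝ (χ n) p h| ≤ M * ‖h.1‖ := by
  obtain ⟨φ, M, hM, hC, h0, h1, hz, ho, hd⟩ := exists_phi
  have harg : ∀ n : ℕ, ContDiff ℝ 1 (fun p : E m k => ((n : ℝ) + 1) ^ 2 * ‖p.1‖ ^ 2 - 1) := fun n =>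
    (contDiff_const.mul (contDiff_fst.norm_sq ℝ)).sub contDiff_const
  have hbig : ∀ (n : ℕ) (p : E m k), 1 < ((n : ℝ) + 1) ^ 2 * ‖p.1‖ ^ 2 - 1 →
      φ (((n : ℝ) + 1) ^ 2 * ‖p.1‖ ^ 2 - 1) = 1 ∧
      fderiv ℝ (fun p : E m k => φ (((n : ℝ) + 1) ^ 2 * ‖p.1‖ ^ 2 - 1)) p = 0 := by
    intro n p hp
    refine ⟨ho _ hp.le, ?_⟩
    have : (fun p : E m k => φ (((n : ℝ) + 1) ^ 2 * ‖p.1‖ ^ 2 - 1)) =ᶠ[nhds p] fun _ => 1 := by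
      filter_upwards [(harg n).continuous.continuousAt.eventually (Ioi_mem_nhds hp)] with q hq
      exact ho _ (le_of_lt hq)
    rw [this.fderiv_eq]; simp
  refine ⟨fun n p => φ (((n : ℝ) + 1) ^ 2 * ‖p.1‖ ^ 2 - 1), 4 * M, by positivity, fun n => hC.comp (harg n),
    fun n p => h0 _, fun n p => h1 _, ?_, ?_, ?_⟩
  · intro p hp
    have hn : 0 < ‖p.1‖ := norm_pos_iff.2 hp
    have ht : Tendsto (fun n : ℕ => ((n : ℝ) + 1) * ‖p.1‖) atTop atTop :=
      (tendsto_natCast_atTop_atTop.atTop_add tendsto_const_nhds).atTop_mul_const hn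
    filter_upwards [ht.eventually_ge_atTop 2] with n hn2
    refine hbig n p ?_
    nlinarith
  · intro n p hp
    have hn : (0:ℝ) < n + 1 := by positivity
    have hlt : ((n : ℝ) + 1) ^ 2 * ‖p.1‖ ^ 2 - 1 < 0 := by
      rw [lt_div_iff₀ hn] at hp
      have := norm_nonneg p.1
      have h2 : 0 ≤ ‖p.1‖ * (n + 1) := by positivity
      nlinarith
    refine ⟨hz _ hlt.le, ?_⟩
    have : (fun p : E m k => φ (((n : ℝ) + 1) ^ 2 * ‖p.1‖ ^ 2 - 1)) =ᶠ[nhds p] fun _ => 0 := by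
      filter_upwards [(harg n).continuous.continuousAt.eventually (Iio_mem_nhds hlt)] with q hq
      exact hz _ (le_of_lt hq)
    rw [this.fderiv_eq]; simp
  · intro n p h
    by_cases hb : 1 < ((n : ℝ) + 1) ^ 2 * ‖p.1‖ ^ 2 - 1
    · rw [(hbig n p hb).2]; simp; positivity
    · push Not at hb
      have hf : HasFDerivAt (fun q : E m k => q.1) (ContinuousLinearMap.fst ℝ _ _) p := hasFDerivAt_fst
      have hg := (hf.norm_sq.const_mul (((n : ℝ) + 1) ^ 2)).sub_const 1
      have hφ : HasDerivAt φ (deriv φ (((n : ℝ) + 1) ^ 2 * ‖p.1‖ ^ 2 - 1)) (((n : ℝ) + 1) ^ 2 * ‖p.1‖ ^ 2 - 1) :=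
        (hC.differentiable one_ne_zero _).hasDerivAt
      have hh := hφ.comp_hasFDerivAt p hg
      have he : fderiv ℝ (fun p : E m k => φ (((n : ℝ) + 1) ^ 2 * ‖p.1‖ ^ 2 - 1)) p h =
          deriv φ (((n : ℝ) + 1) ^ 2 * ‖p.1‖ ^ 2 - 1) * (((n : ℝ) + 1) ^ 2 * (2 * inner ℝ p.1 h.1)) := by
        rw [show fderiv ℝ (fun p : E m k => φ (((n : ℝ) + 1) ^ 2 * ‖p.1‖ ^ 2 - 1)) p = _ from hh.fderiv]
        simp
      rw [he]
      have hi := abs_real_inner_le_norm p.1 h.1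
      have h3 : |((n : ℝ) + 1) ^ 2 * (2 * inner ℝ p.1 h.1)| ≤ ((n : ℝ) + 1) ^ 2 * (2 * (‖p.1‖ * ‖h.1‖)) := by
        rw [abs_mul, abs_mul, abs_of_nonneg (by positivity : (0:ℝ) ≤ ((n : ℝ) + 1) ^ 2),
          abs_of_pos (by norm_num : (0:ℝ) < 2)]
        gcongr
      have h4 := abs_mul_le_mul (hd (((n : ℝ) + 1) ^ 2 * ‖p.1‖ ^ 2 - 1)) h3
      calc _ ≤ ‖p.1‖ * (M * (((n : ℝ) + 1) ^ 2 * (2 * (‖p.1‖ * ‖h.1‖)))) := by gcongr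
        _ = (((n : ℝ) + 1) ^ 2 * ‖p.1‖ ^ 2) * (2 * M * ‖h.1‖) := by ring
        _ ≤ 2 * (2 * M * ‖h.1‖) := by gcongr; linarith
        _ = _ := by ring

instance haarE : (volume : Measure (E m k)).IsAddHaarMeasure := by
  rw [Measure.volume_eq_prod]; infer_instance

lemma null_z (hm : 1 ≤ m) : volume {p : E m k | p.1 = 0} = 0 := by
  have h := Measure.addHaar_submodule (volume : Measure (E m k))
    (LinearMap.ker (LinearMap.fst ℝ (EuclideanSpace ℝ (Fin m)) (EuclideanSpace ℝ (Fin k)))) (by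
      intro h
      have : ((EuclideanSpace.single (⟨0, hm⟩ : Fin m) (1:ℝ), 0) : E m k) ∈
        LinearMap.ker (LinearMap.fst ℝ (EuclideanSpace ℝ (Fin m)) (EuclideanSpace ℝ (Fin k))) := by
        rw [h]; trivial
      simp at this)
  exact h

/-- jump lemma -/
lemma jump (hm : 1 ≤ m) {χ : ℕ → E m k → ℝ} {M : ℝ} (hM0 : 0 ≤ M) (hC : ∀ n, ContDiff ℝ 1 (χ n))
    (hχ0 : ∀ n p, 0 ≤ χ n p) (hχ1 : ∀ n p, χ n p ≤ 1)
    (hlim : ∀ p, p.1 ≠ 0 → ∀ᶠ n in atTop, χ n p = 1 ∧ fderiv ℝ (χ n) p = 0)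
    (hz : ∀ (n : ℕ) p, ‖p.1‖ < 1 / ((n : ℝ) + 1) → χ n p = 0 ∧ fderiv ℝ (χ n) p = 0)
    (hM : ∀ n p h, ‖p.1‖ * |fderiv ℝ (χ n) p h| ≤ M * ‖h.1‖)
    {U S : Set (E m k)} (hU : IsOpen U) (hU0 : ∀ p ∈ U, p.1 ≠ 0) (hS : volume S < ⊤) (hSm : MeasurableSet S)
    {W W1 : E m k → E m k} (hW : ContinuousOn W U) (hW1 : ContDiff ℝ 1 W1) (hW1c : HasCompactSupport W1)
    (hW1U : ∀ p, p.1 ≠ 0 → p ∉ U → W1 p = 0)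
    {c : ℝ} (hc : 0 ≤ c)
    (hb : ∀ p ∈ U, ‖(W p - W1 p).1‖ ≤ c * ‖p.1‖) (hbS : ∀ p ∈ U, p ∉ S → W p - W1 p = 0) :
    Tendsto (fun n => ∫ p in U, fderiv ℝ (χ n) p (W p)) atTop (nhds 0) := by
  -- part with the error
  have hcont : ∀ n, Continuous (fderiv ℝ (χ n)) := fun n => (hC n).continuous_fderiv one_ne_zero
  have hbd : ∀ n, ∀ p ∈ U, |fderiv ℝ (χ n) p (W p - W1 p)| ≤ S.indicator (fun _ => M * c) p := by
    intro n p hp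
    by_cases hpS : p ∈ S
    · rw [indicator_of_mem hpS]
      have hn : 0 < ‖p.1‖ := norm_pos_iff.2 (hU0 p hp)
      have h1 := hM n p (W p - W1 p)
      have h2 := hb p hp
      have h3 : ‖p.1‖ * |fderiv ℝ (χ n) p (W p - W1 p)| ≤ ‖p.1‖ * (M * c) :=
        h1.trans (by calc _ ≤ M * (c * ‖p.1‖) := by gcongr
                      _ = _ := by ring)
      exact le_of_mul_le_mul_left h3 hn
    · rw [indicator_of_notMem hpS, hbS p hp hpS]; simp
  have hint : Integrable (S.indicator fun _ => M * c) (volume.restrict U) :=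
    ((integrable_indicator_iff hSm).2 (integrableOn_const hS.ne)).restrict
  have hmeas : ∀ n, AEStronglyMeasurable (fun p => fderiv ℝ (χ n) p (W p - W1 p)) (volume.restrict U) := by
    intro n
    refine ContinuousOn.aestronglyMeasurable ?_ hU.measurableSet
    exact (hcont n).continuousOn.clm_apply (hW.sub hW1.continuous.continuousOn)
  have herr : Tendsto (fun n => ∫ p in U, fderiv ℝ (χ n) p (W p - W1 p)) atTop (nhds (∫ p in U, (0:ℝ))) := by
    refine tendsto_integral_of_dominated_convergence _ hmeas hint ?_ ?_
    · intro n
      exact (ae_restrict_iff' hU.measurableSet).2 (Eventually.of_forall (hbd n))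
    · refine (ae_restrict_iff' hU.measurableSet).2 (Eventually.of_forall fun p hp => ?_)
      refine tendsto_const_nhds.congr' ?_
      filter_upwards [hlim p (hU0 p hp)] with n hn
      rw [hn.2]; simp
  rw [integral_zero] at herr
  -- main part
  have hdW := continuous_divg hW1
  have hdWc : HasCompactSupport (divg W1) := by
    have : HasCompactSupport (fderiv ℝ W1) := hW1c.fderiv ℝ
    refine this.mono fun p hp => ?_
    intro h
    apply hp
    simp only [divg, h]
    exact map_zero _
  have hdWi : Integrable (divg W1) := hdW.integrable_of_hasCompactSupport hdWc
  have hmain0 : Tendsto (fun n => ∫ p, χ n p * divg W1 p) atTop (nhds (∫ p, divg W1 p)) := by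
    refine tendsto_integral_of_dominated_convergence (fun p => |divg W1 p|) ?_ hdWi.abs ?_ ?_
    · intro n; exact ((hC n).continuous.mul hdW).aestronglyMeasurable
    · intro n
      refine Eventually.of_forall fun p => ?_
      rw [norm_mul, Real.norm_eq_abs, Real.norm_eq_abs, abs_of_nonneg (hχ0 n p)]
      calc _ ≤ 1 * |divg W1 p| := by gcongr; exact hχ1 n p
        _ = _ := one_mul _
    · have : ∀ᵐ p : E m k, p.1 ≠ 0 := by
        rw [ae_iff]; simpa using null_z hm
      filter_upwards [this] with p hp
      refine tendsto_const_nhds.congr' ?_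
      filter_upwards [hlim p hp] with n hn
      rw [hn.1, one_mul]
  rw [integral_divg volume hW1 hW1c] at hmain0
  have hi1 : ∀ n, Integrable (fun p => χ n p * divg W1 p) := fun n =>
    ((hC n).continuous.mul hdW).integrable_of_hasCompactSupport hdWc.mul_left
  have hW1s : ∀ n, HasCompactSupport (fun p => fderiv ℝ (χ n) p (W1 p)) := fun n =>
    hW1c.mono fun p hp h => hp (by simp [h])
  have hW1cont : ∀ n, Continuous (fun p => fderiv ℝ (χ n) p (W1 p)) := fun n =>
    (hcont n).clm_apply hW1.continuous
  have hi2 : ∀ n, Integrable (fun p => fderiv ℝ (χ n) p (W1 p)) := fun n =>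
    (hW1cont n).integrable_of_hasCompactSupport (hW1s n)
  have hmain1 : ∀ n, ∫ p, fderiv ℝ (χ n) p (W1 p) = - ∫ p, χ n p * divg W1 p := by
    intro n
    have h1 := integral_divg (volume : Measure (E m k)) ((hC n).smul hW1) (hW1c.smul_left (f := χ n))
    have h2 : ∀ p, divg (χ n • W1) p = χ n p * divg W1 p + fderiv ℝ (χ n) p (W1 p) := fun p =>
      divg_smul ((hC n).differentiable one_ne_zero p) (hW1.differentiable one_ne_zero p)
    have h3 : ∫ p, (χ n p * divg W1 p + fderiv ℝ (χ n) p (W1 p)) = 0 := by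
      rw [← h1]; exact integral_congr_ae (Eventually.of_forall fun p => (h2 p).symm)
    rw [integral_add (hi1 n) (hi2 n)] at h3
    linarith
  have hmain2 : ∀ n, ∫ p in U, fderiv ℝ (χ n) p (W1 p) = ∫ p, fderiv ℝ (χ n) p (W1 p) := by
    intro n
    refine setIntegral_eq_integral_of_forall_compl_eq_zero fun p hp => ?_
    by_cases h0 : p.1 = 0
    · rw [(hz n p (by rw [h0, norm_zero]; positivity)).2]; simp
    · rw [hW1U p h0 hp]; simp
  have hmain : Tendsto (fun n => ∫ p in U, fderiv ℝ (χ n) p (W1 p)) atTop (nhds 0) := by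
    simp only [hmain2, hmain1]
    simpa using hmain0.neg
  have := herr.add hmain
  rw [add_zero] at this
  refine this.congr fun n => ?_
  have hie : Integrable (fun p => fderiv ℝ (χ n) p (W p - W1 p)) (volume.restrict U) :=
    hint.mono' (hmeas n) ((ae_restrict_iff' hU.measurableSet).2 (Eventually.of_forall (hbd n)))
  rw [← integral_add hie (hi2 n).restrict]
  refine integral_congr_ae (Eventually.of_forall fun p => ?_)
  simp

end UCP

end

section

set_option linter.unusedSectionVars false
set_option linter.unusedSimpArgs false
set_option linter.unusedVariables false
set_option maxSynthPendingDepth 3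
namespace UCP

open BG

variable {m k : ℕ} {γ : ℝ}

/-- punctured ball -/
def gD (γ : ℝ) : Set (E m k) := {p | 0 < rho γ p ∧ rho γ p < 1}

/-- closed gauge shell -/
def kD (γ s S : ℝ) : Set (E m k) := {p | exp s ≤ rho γ p ∧ rho γ p ≤ exp S}

lemma isOpen_gD (hγ : 0 < γ) : IsOpen (gD γ : Set (E m k)) :=
  (isOpen_lt continuous_const (continuous_rho hγ)).inter (isOpen_lt (continuous_rho hγ) continuous_const)

lemma isOpen_ball' (hγ : 0 < γ) (r : ℝ) : IsOpen (ball γ r : Set (E m k)) :=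
  isOpen_lt (continuous_rho hγ) continuous_const

lemma isClosed_kD (hγ : 0 < γ) (s S : ℝ) : IsClosed (kD γ s S : Set (E m k)) :=
  (isClosed_le continuous_const (continuous_rho hγ)).inter (isClosed_le (continuous_rho hγ) continuous_const)

lemma isCompact_kD (hγ : 0 < γ) (s S : ℝ) : IsCompact (kD γ s S : Set (E m k)) := by
  refine Metric.isCompact_of_isClosed_isBounded (isClosed_kD hγ s S) ?_
  refine (Metric.isBounded_closedBall (x := (0 : E m k)) (r := exp S + (1 + exp S ^ (2 * (γ + 1))))).subset ?_
  intro p hp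
  rw [mem_closedBall_zero_iff, Prod.norm_def]
  have h1 := (norm_le_rho hγ p).trans hp.2
  have h2 : nn γ p ≤ exp S ^ (2 * (γ + 1)) := by
    rw [← rho_pow hγ]
    exact rpow_le_rpow (rho_nonneg p) hp.2 (by positivity)
  have h3 : ‖p.2‖ ^ 2 ≤ nn γ p := by
    unfold nn
    have h4 : 0 ≤ ‖p.1‖ ^ (2 * (γ + 1)) := by positivity
    have h5 : 1 ≤ (γ + 1) ^ 2 := by nlinarith
    nlinarith [sq_nonneg ‖p.2‖]
  have h6 := exp_pos S
  have h7 : 0 < exp S ^ (2 * (γ + 1)) := by positivity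
  refine max_le (by linarith) ?_
  nlinarith [sq_nonneg (‖p.2‖ - 1)]

lemma kD_sub {s S : ℝ} (hS : S < 0) : (kD γ s S : Set (E m k)) ⊆ gD γ := fun p hp =>
  ⟨(exp_pos s).trans_le hp.1, hp.2.trans_lt (by rw [exp_lt_one_iff]; exact hS)⟩

lemma gD_sub_ball : (gD γ : Set (E m k)) ⊆ ball γ 1 := fun p hp => hp.2

lemma gU_sub_ball : (gU γ : Set (E m k)) ⊆ ball γ 1 := fun p hp => hp.2

lemma gU_sub_gD (hγ : 0 < γ) : (gU γ : Set (E m k)) ⊆ gD γ := fun p hp => ⟨rho_pos hγ hp.1, hp.2⟩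

lemma mem_kD (hγ : 0 < γ) {s S : ℝ} {p : E m k} (hp : p.1 ≠ 0) : p ∈ kD γ s S ↔ s ≤ gσ γ p ∧ gσ γ p ≤ S := by
  unfold kD
  rw [Set.mem_ofPred_eq, ← exp_gσ hγ hp, exp_le_exp, exp_le_exp]

lemma mem_kD' {s S : ℝ} {p : E m k} (hp : 0 < rho γ p) : p ∈ kD γ s S ↔ s ≤ gσ γ p ∧ gσ γ p ≤ S := by
  unfold kD gσ
  rw [Set.mem_ofPred_eq, le_log_iff_exp_le hp, log_le_iff_le_exp hp]

lemma contDiff_nn (hγ : 0 < γ) : ContDiff ℝ 1 (nn γ : E m k → ℝ) := by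
  unfold nn
  have h1 : ContDiff ℝ 1 (fun p : E m k => ‖p.1‖ ^ (2 * (γ + 1))) :=
    (contDiff_norm_rpow (by linarith)).comp contDiff_fst
  exact h1.add (contDiff_const.mul (contDiff_snd.norm_sq ℝ))

lemma contDiffOn_gσ (hγ : 0 < γ) : ContDiffOn ℝ 1 (gσ γ) (gD γ : Set (E m k)) := by
  have hpos : ∀ p ∈ (gD γ : Set (E m k)), 0 < nn γ p := fun p hp => by
    rw [← rho_pow hγ]; exact rpow_pos_of_pos hp.1 _
  have : ContDiffOn ℝ 1 (fun p => 1 / (2 * (γ + 1)) * log (nn γ p)) (gD γ : Set (E m k)) :=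
      contDiffOn_const.mul ((contDiff_nn hγ).contDiffOn.log fun p hp => (hpos p hp).ne')
  refine this.congr fun p hp => ?_
  change log (nn γ p ^ _) = _
  rw [log_rpow (hpos p hp)]

lemma continuous_X (hγ : 0 < γ) (l : Fin (m + k)) : Continuous (gX γ l : E m k → E m k) := by
  unfold gX
  refine Fin.addCases (fun i => ?_) (fun j => ?_) l
  · simp only [X_castAdd]; exact continuous_const
  · simp only [X_natAdd]
    exact ((continuous_fst.norm).rpow_const fun _ => Or.inr hγ.le).smul continuous_const

variable {A : E m k → Matrix (Fin (m + k)) (Fin (m + k)) ℝ} {u : E m k → ℝ}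

lemma continuousOn_fderiv (hγ : 0 < γ) (hu : ContDiffOn ℝ 2 u (ball γ 1)) :
    ContinuousOn (fderiv ℝ u) (ball γ 1) :=
  hu.continuousOn_fderiv_of_isOpen (isOpen_ball' hγ 1) (by norm_num)

lemma contDiffOn_fderiv (hγ : 0 < γ) (hu : ContDiffOn ℝ 2 u (ball γ 1)) :
    ContDiffOn ℝ 1 (fderiv ℝ u) (ball γ 1) :=
  hu.fderiv_of_isOpen (isOpen_ball' hγ 1) (by norm_num)

lemma continuousOn_gradA (hγ : 0 < γ) (hA1 : C1coeff A) (hu : ContDiffOn ℝ 2 u (ball γ 1)) :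
    ContinuousOn (gradA (frA (gA A) (gX γ)) u) (ball γ 1) := by
  have : gradA (frA (gA A) (gX γ)) u = fun p => ∑ i, (∑ j, gA A i j p * fderiv ℝ u p (gX γ j p)) • gX γ i p := by
    funext p; rw [gradA, frA_apply]
  rw [this]
  refine continuousOn_finsetSum _ fun i _ => ContinuousOn.fun_smul ?_ (continuous_X hγ i).continuousOn
  refine continuousOn_finsetSum _ fun j _ => ContinuousOn.mul (hA1 i j).continuous.continuousOn ?_
  exact (continuousOn_fderiv hγ hu).clm_apply (continuous_X hγ j).continuousOn

/-- principal part of the gradient near the degenerate set -/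
def gG (A : E m k → Matrix (Fin (m + k)) (Fin (m + k)) ℝ) (u : E m k → ℝ) (p : E m k) : E m k :=
  ∑ i : Fin m, (∑ j : Fin m, gA A (Fin.castAdd k i) (Fin.castAdd k j) p *
    fderiv ℝ u p (EuclideanSpace.single j (1:ℝ), 0)) • ((EuclideanSpace.single i (1:ℝ), 0) : E m k)

lemma contDiffOn_gG (hγ : 0 < γ) (hA1 : C1coeff A) (hu : ContDiffOn ℝ 2 u (ball γ 1)) :
    ContDiffOn ℝ 1 (gG A u) (ball γ 1) := by
  unfold gG
  refine ContDiffOn.sum fun i _ => ContDiffOn.fun_smul ?_ contDiffOn_const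
  refine ContDiffOn.sum fun j _ => ContDiffOn.mul (hA1 _ _).contDiffOn ?_
  exact (contDiffOn_fderiv hγ hu).clm_apply contDiffOn_const

lemma gradA_sub (p : E m k) : (gradA (frA (gA A) (gX γ)) u p - gG A u p).1 =
    ∑ i : Fin m, (∑ j : Fin k, gA A (Fin.castAdd k i) (Fin.natAdd m j) p *
      fderiv ℝ u p (gX γ (Fin.natAdd m j) p)) • EuclideanSpace.single i (1:ℝ) := by
  rw [gradA, frA_apply, Fin.sum_univ_add]
  unfold gG gX
  simp only [Fin.sum_univ_add, X_castAdd, X_natAdd, add_smul, Finset.sum_add_distrib]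
  simp [Prod.fst_sum]

lemma norm_gX_le (hγ : 0 < γ) {p : E m k} (hp : p ∈ gU γ) (l : Fin (m + k)) : ‖gX γ l p‖ ≤ 1 := by
  have h1 : ‖p.1‖ ≤ 1 := (norm_le_rho hγ p).trans hp.2.le
  have h2 : ‖p.1‖ ^ γ ≤ 1 := rpow_le_one (norm_nonneg _) h1 hγ.le
  unfold gX
  refine Fin.addCases (fun i => ?_) (fun j => ?_) l
  · rw [X_castAdd, Prod.norm_def]; simp
  · rw [X_natAdd, norm_smul, Prod.norm_def]; simp
    rwa [abs_of_nonneg (by positivity)]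

variable {Λ : ℝ}

lemma hb0z (hγ : 0 < γ) (hΛ : 0 < Λ) (hH : HypH γ Λ A) {p : E m k} (hp : p ∈ gU γ) (i : Fin m) (j : Fin k) :
    |gA A (Fin.castAdd k i) (Fin.natAdd m j) p| ≤ Λ * ‖p.1‖ := by
  have h := hb0' hγ hH hp (Fin.castAdd k i) (Fin.natAdd m j) (Or.inr (by simp))
  have hne : Fin.castAdd k i ≠ Fin.natAdd m j := by
    intro h; have := congrArg Fin.val h; simp at this; omega
  rw [if_neg hne, sub_zero] at h
  refine h.trans ?_
  have hw := gw_pos hγ hp.1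
  have hr := rho_pos hγ hp.1
  have h1 : gw γ p ^ (γ + 1) ≤ gw γ p ^ (1:ℝ) :=
    rpow_le_rpow_of_exponent_ge hw (gw_le hγ p) (by linarith)
  rw [rpow_one] at h1
  calc _ ≤ Λ * gw γ p * rho γ p := by gcongr
    _ = Λ * (gw γ p * rho γ p) := by ring
    _ = _ := by rw [gw_mul hγ hp.1]

lemma gradA_sub_le (hγ : 0 < γ) (hΛ : 0 < Λ) (hH : HypH γ Λ A) {p : E m k} (hp : p ∈ gU γ) :
    ‖(gradA (frA (gA A) (gX γ)) u p - gG A u p).1‖ ≤ (m * (k * Λ) * ‖fderiv ℝ u p‖) * ‖p.1‖ := by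
  rw [gradA_sub]
  refine (norm_sum_le _ _).trans ?_
  have h : ∀ i ∈ (Finset.univ : Finset (Fin m)), ‖(∑ j : Fin k, gA A (Fin.castAdd k i) (Fin.natAdd m j) p *
      fderiv ℝ u p (gX γ (Fin.natAdd m j) p)) • EuclideanSpace.single i (1:ℝ)‖ ≤
      k * (Λ * ‖p.1‖ * ‖fderiv ℝ u p‖) := by
    intro i _
    rw [norm_smul, PiLp.norm_single, norm_one, mul_one, Real.norm_eq_abs]
    have := abs_sum_le_card (fun j : Fin k => gA A (Fin.castAdd k i) (Fin.natAdd m j) p *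
      fderiv ℝ u p (gX γ (Fin.natAdd m j) p)) (c := Λ * ‖p.1‖ * ‖fderiv ℝ u p‖) (fun j => by
        refine abs_mul_le_mul (hb0z hγ hΛ hH hp i j) ?_
        rw [← Real.norm_eq_abs]
        exact (fderiv ℝ u p).le_of_opNorm_le_of_le le_rfl (norm_gX_le hγ hp _) |>.trans (by simp))
    simpa using this
  refine (Finset.sum_le_sum h).trans ?_
  simp
  apply le_of_eq; ring

lemma jumpF (hm : 1 ≤ m) (hγ : 0 < γ) (hΛ : 0 < Λ) (hA1 : C1coeff A) (hH : HypH γ Λ A)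
    (hu : ContDiffOn ℝ 2 u (ball γ 1)) {χ : ℕ → E m k → ℝ} {M : ℝ} (hM0 : 0 ≤ M) (hC : ∀ n, ContDiff ℝ 1 (χ n))
    (hχ0 : ∀ n p, 0 ≤ χ n p) (hχ1 : ∀ n p, χ n p ≤ 1)
    (hlim : ∀ p, p.1 ≠ 0 → ∀ᶠ n in atTop, χ n p = 1 ∧ fderiv ℝ (χ n) p = 0)
    (hz : ∀ (n : ℕ) p, ‖p.1‖ < 1 / ((n : ℝ) + 1) → χ n p = 0 ∧ fderiv ℝ (χ n) p = 0)
    (hM : ∀ n p h, ‖p.1‖ * |fderiv ℝ (χ n) p h| ≤ M * ‖h.1‖) {s S : ℝ} (hS : S < 0)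
    {f f1 : E m k → ℝ} (hf : ContinuousOn f (gU γ)) (hf1 : ContDiffOn ℝ 1 f1 (gD γ))
    (hf0 : ∀ p ∈ gU γ, p ∉ kD γ s S → f p = 0) (hf10 : ∀ p ∈ gD γ, p ∉ kD γ s S → f1 p = 0)
    {c : ℝ} (hc : 0 ≤ c) (hff : ∀ p ∈ gU γ, p ∈ kD γ s S → |f p - f1 p| ≤ c * ‖p.1‖) :
    Tendsto (fun n => ∫ p in gU γ, f p * fderiv ℝ (χ n) p (gradA (frA (gA A) (gX γ)) u p)) atTop (nhds 0) := by
  have hK := isCompact_kD (m := m) (k := k) hγ s S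
  have hKD := kD_sub (m := m) (k := k) (γ := γ) (s := s) hS
  have hKB := hKD.trans gD_sub_ball
  obtain ⟨Cu, hCu⟩ := hK.exists_bound_of_continuousOn ((continuousOn_fderiv hγ hu).mono hKB)
  obtain ⟨Cg, hCg⟩ := hK.exists_bound_of_continuousOn ((continuousOn_gradA hγ hA1 hu).mono hKB)
  obtain ⟨Cf, hCf⟩ := hK.exists_bound_of_continuousOn (hf1.continuousOn.mono hKD)
  have hW1 : ContDiffOn ℝ 1 (fun p => f1 p • gG A u p) (gD γ) :=
    hf1.smul ((contDiffOn_gG hγ hA1 hu).mono gD_sub_ball)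
  have hW10 : ∀ p ∈ gD γ, p ∉ kD γ s S → f1 p • gG A u p = 0 := fun p hp hk => by rw [hf10 p hp hk, zero_smul]
  have key := jump hm hM0 hC hχ0 hχ1 hlim hz hM (isOpen_gU hγ) (fun p hp => hp.1)
    (hK.measure_lt_top (μ := volume)) (isClosed_kD hγ s S).measurableSet
    (W := fun p => f p • gradA (frA (gA A) (gX γ)) u p)
    (W1 := (gD γ).indicator fun p => f1 p • gG A u p) (hf.smul ((continuousOn_gradA hγ hA1 hu).mono gU_sub_ball))
    (contDiff_indicator (n := 1) (isOpen_gD hγ) hK hKD hW10 hW1) (hasCompactSupport_indicator hK hW10)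
    (fun p hp hpU => by
      refine indicator_of_notMem (fun h => hpU ⟨hp, h.2⟩) _)
    (c := c * |Cg| + |Cf| * (m * (k * Λ) * |Cu|)) (by positivity)
    (fun p hp => by
      rw [indicator_of_mem (gU_sub_gD hγ hp)]
      by_cases hk : p ∈ kD γ s S
      · have he : (f p • gradA (frA (gA A) (gX γ)) u p - f1 p • gG A u p).1 =
          (f p - f1 p) • (gradA (frA (gA A) (gX γ)) u p).1 + f1 p • (gradA (frA (gA A) (gX γ)) u p - gG A u p).1 := by
          simp only [Prod.fst_sub, Prod.smul_fst, sub_smul, smul_sub]; abel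
        rw [he]
        refine (norm_add_le _ _).trans ?_
        rw [norm_smul, norm_smul, add_mul]
        have h1 : ‖(gradA (frA (gA A) (gX γ)) u p).1‖ ≤ |Cg| :=
          (norm_fst_le _).trans ((hCg p hk).trans (le_abs_self _))
        have h2 := hff p hp hk
        have h3 := (hCf p hk).trans (le_abs_self _)
        have h4 := gradA_sub_le (u := u) hγ hΛ hH hp
        have h5 := (hCu p hk).trans (le_abs_self _)
        refine add_le_add ?_ ?_
        · rw [Real.norm_eq_abs]
          calc _ ≤ c * ‖p.1‖ * |Cg| := by gcongr
            _ = _ := by ring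
        · calc _ ≤ |Cf| * ((m * (k * Λ) * |Cu|) * ‖p.1‖) := by
                refine mul_le_mul h3 (h4.trans ?_) (norm_nonneg _) (abs_nonneg _)
                gcongr
            _ = _ := by ring
      · rw [hf0 p hp hk, hf10 p (gU_sub_gD hγ hp) hk]; simp; positivity)
    (fun p hp hk => by
      rw [indicator_of_mem (gU_sub_gD hγ hp), hf0 p hp hk, hf10 p (gU_sub_gD hγ hp) hk]; simp)
  refine key.congr fun n => ?_
  refine integral_congr_ae (Eventually.of_forall fun p => ?_)
  simp

end UCP

end

section

set_option linter.unusedSectionVars false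
set_option linter.unusedSimpArgs false
set_option linter.unusedVariables false
set_option maxSynthPendingDepth 3
namespace UCP

open BG

variable {m k : ℕ} {γ : ℝ}
variable {A : E m k → Matrix (Fin (m + k)) (Fin (m + k)) ℝ} {u : E m k → ℝ} {Λ : ℝ}

lemma gZ (p : E m k) (hp : p.1 ≠ 0) : ∑ l, gζ γ l p • gX γ l p = (p.1, (γ + 1) • p.2) := by
  have hn : 0 < ‖p.1‖ := norm_pos_iff.2 hp
  have hinv : ‖p.1‖ ^ (-γ) * ‖p.1‖ ^ γ = 1 := by
    rw [← rpow_add hn, neg_add_cancel, rpow_zero]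
  unfold gX
  rw [Fin.sum_univ_add]
  simp only [gζ_castAdd, gζ_natAdd, X_castAdd, X_natAdd, smul_smul, mul_assoc, hinv, mul_one]
  refine Prod.ext ?_ ?_
  · simp only [Prod.fst_add, Prod.fst_sum, Prod.smul_fst, smul_zero, Finset.sum_const_zero, add_zero]
    ext i
    simp [Finset.sum_apply, Pi.single_apply]
  · simp only [Prod.snd_add, Prod.snd_sum, Prod.smul_snd, smul_zero, Finset.sum_const_zero, zero_add]
    ext i
    simp [Finset.sum_apply, Pi.single_apply]

lemma frF_eq (p : E m k) (hp : p.1 ≠ 0) : frF (gA A) (gX γ) (gζ γ) p =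
    (p.1, (γ + 1) • p.2) + ∑ l, frY (gA A) (gζ γ) l p • gX γ l p := by
  rw [← gZ p hp, frF, ← Finset.sum_add_distrib]
  simp only [add_smul]

/-- constant -/
def cY (m k : ℕ) (Λ : ℝ) : ℝ := (m + k) * ((m + k) * Λ)

lemma sumY_le (hγ : 0 < γ) (hΛ : 0 < Λ) (hH : HypH γ Λ A) {p : E m k} (hp : p ∈ gU γ) :
    ‖∑ l, frY (gA A) (gζ γ) l p • gX γ l p‖ ≤ cY m k Λ * ‖p.1‖ := by
  refine (norm_sum_le _ _).trans ?_
  have hr := rho_pos hγ hp.1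
  have h : ∀ l ∈ (Finset.univ : Finset (Fin (m + k))), ‖frY (gA A) (gζ γ) l p • gX γ l p‖ ≤
      (m + k : ℝ) * Λ * ‖p.1‖ := by
    intro l _
    rw [norm_smul, Real.norm_eq_abs]
    have h1 := hY hγ hΛ hH hp l
    have h2 := norm_gX_le hγ hp l
    have h3 := hp.2.le
    calc _ ≤ (m + k : ℝ) * (Λ * rho γ p * ‖p.1‖) * 1 := by gcongr
      _ ≤ (m + k : ℝ) * (Λ * 1 * ‖p.1‖) * 1 := by gcongr
      _ = _ := by ring
  refine (Finset.sum_le_sum h).trans ?_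
  simp [cY]
  apply le_of_eq; ring

lemma psi_le_one (hγ : 0 < γ) (p : E m k) : psi γ p ≤ 1 := by
  rw [psi_eq]
  exact rpow_le_one (div_nonneg (norm_nonneg _) (rho_nonneg p)) (gw_le hγ p) (by positivity)

lemma psi_nonneg (p : E m k) : 0 ≤ psi γ p :=
  div_nonneg (by positivity) (rpow_nonneg (rho_nonneg p) _)

lemma gΨ_le (hγ : 0 < γ) {s S : ℝ} {p : E m k} (hp : p.1 ≠ 0) (hk : p ∈ kD γ s S) :
    gΨ γ p ≤ psi γ p * exp (-s) ^ 2 := by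
  have hr := rho_pos hγ hp
  have h1 := psi_eq_gΨ hγ hp
  have h2 := hk.1
  have h3 : 1 ≤ exp (-s) * rho γ p := by
    have : exp (-s) * exp s = 1 := by rw [← exp_add]; simp
    rw [← this]; gcongr
  have h4 : 0 ≤ gΨ γ p := by
    have := nn_pos hγ hp
    unfold gΨ; positivity
  rw [h1]
  have : 1 ≤ (exp (-s) * rho γ p) ^ 2 := one_le_pow₀ h3
  nlinarith

lemma beta_le {lam Q L : ℝ} (hγ : 0 < γ) (hΛ : 0 < Λ) (hH : HypH γ Λ A)
    (R : Frame (gU γ : Set (E m k)) (gX γ) (gω γ) gθ (gζ γ) (gA A) (gσ γ) (gΨ γ) γ Q L lam)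
    {s S : ℝ} {p : E m k} (hp : p ∈ gU γ) (hk : p ∈ kD γ s S) :
    |fderiv ℝ (gσ γ) p (frF (gA A) (gX γ) (gζ γ) p) - 1| ≤ ((m + k) * ((m + k) * (Λ * exp (-s)))) * ‖p.1‖ := by
  rw [R.σF hp, add_sub_cancel_left, Finset.mul_sum]
  have hΨ := (R.Ψ_pos p hp)
  have hz : ∀ l, |gΨ γ p * gζ γ l p| ≤ exp (-s) := by
    intro l
    have h1 : gΨ γ p ≤ exp (-s) ^ 2 := (gΨ_le hγ hp.1 hk).trans (by
      calc _ ≤ 1 * exp (-s) ^ 2 := by gcongr; exact psi_le_one hγ p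
        _ = _ := one_mul _)
    have h2 := R.Ψζ p hp
    have h3 : gζ γ l p ^ 2 ≤ ∑ l, gζ γ l p ^ 2 :=
      Finset.single_le_sum (f := fun l => gζ γ l p ^ 2) (fun i _ => sq_nonneg _) (Finset.mem_univ l)
    refine abs_le_of_sq_le_sq ?_ (exp_pos _).le
    have h4 : gΨ γ p * gζ γ l p ^ 2 ≤ 1 := by rw [← h2]; gcongr
    calc _ = gΨ γ p * (gΨ γ p * gζ γ l p ^ 2) := by ring
      _ ≤ gΨ γ p * 1 := by gcongr
      _ ≤ _ := by rw [mul_one]; exact h1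
  have hr := rho_pos hγ hp.1
  have h : ∀ l, |gΨ γ p * ∑ q, (gA A l q p - if l = q then 1 else 0) * gζ γ q p * gζ γ l p| ≤
      (m + k) * (Λ * ‖p.1‖ * exp (-s)) := by
    intro l
    rw [Finset.mul_sum]
    have := abs_sum_le_card (fun q => gΨ γ p * ((gA A l q p - if l = q then 1 else 0) * gζ γ q p * gζ γ l p))
      (c := Λ * ‖p.1‖ * exp (-s)) (fun q => by
        have h1 : |(gA A l q p - if l = q then 1 else 0) * gζ γ q p| ≤ Λ * ‖p.1‖ :=
          (hbζ hγ hΛ hH hp l q).trans (by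
            have := hp.2.le
            calc _ ≤ Λ * 1 * ‖p.1‖ := by gcongr
              _ = _ := by ring)
        have h2 := abs_mul_le_mul h1 (hz l)
        rwa [show gΨ γ p * ((gA A l q p - if l = q then 1 else 0) * gζ γ q p * gζ γ l p) =
          (gA A l q p - if l = q then 1 else 0) * gζ γ q p * (gΨ γ p * gζ γ l p) by ring])
    simpa using this
  have := abs_sum_le_card _ h
  refine this.trans ?_
  rw [Fintype.card_fin]
  push_cast
  apply le_of_eq; ring

theorem gcut {lam Q L : ℝ} (hm : 1 ≤ m) (hγ : 0 < γ) (hΛ : 0 < Λ) (hA1 : C1coeff A) (hH : HypH γ Λ A)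
    (R : Frame (gU γ : Set (E m k)) (gX γ) (gω γ) gθ (gζ γ) (gA A) (gσ γ) (gΨ γ) γ Q L lam)
    (hu : ContDiffOn ℝ 2 u (ball γ 1)) (hub : ∀ p ∈ ball γ 1, |u p| ≤ 1) :
    ∃ χ, Cut volume (gU γ) (frA (gA A) (gX γ)) (gσ γ) (gΨ γ) (frF (gA A) (gX γ) (gζ γ)) u χ 0 := by
  obtain ⟨χ, M, hM0, hC, hχ0, hχ1, hlim, hz, hM⟩ := exists_chi m k
  have hK := isCompact_kD (m := m) (k := k) hγ
  have hKD := fun s S hS => kD_sub (m := m) (k := k) (γ := γ) (s := s) (S := S) hS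
  have hmem : ∀ {q : ℝ → ℝ} {s S : ℝ}, (∀ x, q x ≠ 0 → s ≤ x ∧ x ≤ S) → ∀ p ∈ gD γ, p ∉ kD γ s S →
      q (gσ (m := m) (k := k) γ p) = 0 := by
    intro q s S hq p hp hk
    by_contra h
    exact hk ((mem_kD' hp.1).2 (hq _ h))
  have hqσ : ∀ {q : ℝ → ℝ}, ContDiff ℝ 1 q → ContDiffOn ℝ 1 (fun p : E m k => q (gσ γ p)) (gD γ) :=
    fun hq => hq.comp_contDiffOn (contDiffOn_gσ hγ)
  have hu1 : ContDiffOn ℝ 1 u (gD γ) := (hu.of_le (by norm_num)).mono gD_sub_ball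
  have hUD := gU_sub_gD (m := m) (k := k) hγ
  refine ⟨χ, ⟨fun n => (hC n).contDiffOn, fun n p _ => hχ0 n p, fun n p _ => hχ1 n p,
    fun p hp => hlim p hp.1, ?_, ?_, ?_, ?_, ?_, ?_⟩⟩
  · intro n s S hS
    refine ⟨kD γ s S ∩ {p | 1 / ((n : ℝ) + 1) ≤ ‖p.1‖}, (hK s S).inter_right
      (isClosed_le continuous_const continuous_fst.norm), ?_, ?_⟩
    · intro p hp
      refine ⟨norm_pos_iff.1 (lt_of_lt_of_le (by positivity) hp.2), (hKD s S hS hp.1).2⟩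
    · intro p hp h1 h2 hC
      refine hz n p ?_
      by_contra h
      exact hC ⟨(mem_kD hγ hp.1).2 ⟨h1, h2⟩, not_lt.1 h⟩
  · intro s S hS
    have hen : ContinuousOn (enA (frA (gA A) (gX γ)) u) (kD γ s S) :=
      ((continuousOn_fderiv hγ hu).clm_apply (continuousOn_gradA hγ hA1 hu)).mono ((hKD s S hS).trans gD_sub_ball)
    obtain ⟨Ce, hCe⟩ := (hK s S).exists_bound_of_continuousOn hen
    refine ⟨exp (-s) ^ 2 + |Ce| + M * (1 + cY m k Λ), fun p hp h1 h2 => ?_⟩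
    have hk := (mem_kD hγ hp.1).2 ⟨h1, h2⟩
    have hcY : 0 ≤ cY m k Λ := by unfold cY; positivity
    have e1 : 0 ≤ exp (-s) ^ 2 := by positivity
    have e2 : 0 ≤ M * (1 + cY m k Λ) := by positivity
    have e3 := abs_nonneg Ce
    refine ⟨?_, ?_, fun n => ?_⟩
    · have : gΨ γ p ≤ exp (-s) ^ 2 := (gΨ_le hγ hp.1 hk).trans (by
        calc _ ≤ 1 * exp (-s) ^ 2 := by gcongr; exact psi_le_one hγ p
          _ = _ := one_mul _)
      linarith
    · have := (le_abs_self _).trans ((hCe p hk).trans (le_abs_self _))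
      linarith
    · have hn : 0 < ‖p.1‖ := norm_pos_iff.2 hp.1
      have h3 := hM n p (frF (gA A) (gX γ) (gζ γ) p)
      have h4 : ‖(frF (gA A) (gX γ) (gζ γ) p).1‖ ≤ (1 + cY m k Λ) * ‖p.1‖ := by
        rw [frF_eq p hp.1]
        refine (norm_add_le _ _).trans ?_
        have := (norm_fst_le _).trans (sumY_le hγ hΛ hH hp)
        rw [add_mul, one_mul]
        exact add_le_add (le_refl ‖p.1‖) this
      have h5 : ‖p.1‖ * |fderiv ℝ (χ n) p (frF (gA A) (gX γ) (gζ γ) p)| ≤ ‖p.1‖ * (M * (1 + cY m k Λ)) :=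
        h3.trans (by calc _ ≤ M * ((1 + cY m k Λ) * ‖p.1‖) := by gcongr
                      _ = _ := by ring)
      have := le_of_mul_le_mul_left h5 hn
      linarith
  · intro s S hS
    refine lt_of_le_of_lt (measure_mono ?_) ((hK s S).measure_lt_top (μ := volume))
    intro p hp
    exact (mem_kD hγ hp.1.1).2 hp.2
  · rintro q hq ⟨s, S, hS, h0⟩
    have hf : ContDiffOn ℝ 1 (fun p => q (gσ γ p) * u p) (gD γ) := (hqσ hq).mul hu1
    refine jumpF hm hγ hΛ hA1 hH hu hM0 hC hχ0 hχ1 hlim hz hM (s := s) hS (hf.continuousOn.mono hUD) hf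
      (fun p hp hk => ?_) (fun p hp hk => ?_) (c := 0) le_rfl (fun p _ _ => by simp)
    · rw [hmem h0 p (hUD hp) hk, zero_mul]
    · rw [hmem h0 p hp hk, zero_mul]
  · rintro q hq ⟨s, S, hS, h0⟩
    have hZ : ContDiff ℝ 1 (fun p : E m k => ((p.1, (γ + 1) • p.2) : E m k)) := by fun_prop
    have hf : ContDiffOn ℝ 1 (fun p => q (gσ γ p) * fderiv ℝ u p (p.1, (γ + 1) • p.2)) (gD γ) :=
      (hqσ hq).mul (((contDiffOn_fderiv hγ hu).mono gD_sub_ball).clm_apply hZ.contDiffOn)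
    have hfc : ContinuousOn (fun p => q (gσ γ p) * fderiv ℝ u p (frF (gA A) (gX γ) (gζ γ) p)) (gU γ) :=
      ((hqσ hq).continuousOn.mono hUD).mul (((continuousOn_fderiv hγ hu).mono gU_sub_ball).clm_apply
        R.F_C1.continuousOn)
    obtain ⟨Cu, hCu⟩ := (hK s S).exists_bound_of_continuousOn ((continuousOn_fderiv hγ hu).mono
      ((hKD s S hS).trans gD_sub_ball))
    obtain ⟨Cq, hCq⟩ := (hK s S).exists_bound_of_continuousOn ((hqσ hq).continuousOn.mono (hKD s S hS))
    have hcY : 0 ≤ cY m k Λ := by unfold cY; positivity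
    refine jumpF hm hγ hΛ hA1 hH hu hM0 hC hχ0 hχ1 hlim hz hM (s := s) hS hfc hf
      (fun p hp hk => ?_) (fun p hp hk => ?_) (c := |Cq| * (|Cu| * cY m k Λ)) (by positivity) (fun p hp hk => ?_)
    · rw [hmem h0 p (hUD hp) hk, zero_mul]
    · rw [hmem h0 p hp hk, zero_mul]
    · rw [frF_eq p hp.1, map_add, mul_add, add_sub_cancel_left]
      have h1 := (fderiv ℝ u p).le_of_opNorm_le_of_le ((hCu p hk).trans (le_abs_self _)) (sumY_le hγ hΛ hH hp)
      have h2 := abs_mul_le_mul ((hCq p hk).trans (le_abs_self _)) h1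
      refine h2.trans (le_of_eq (by ring))
  · rintro q hq ⟨s, S, hS, h0⟩
    have hf : ContDiffOn ℝ 1 (fun p => q (gσ γ p) * u p) (gD γ) := (hqσ hq).mul hu1
    have hfc : ContinuousOn (fun p => q (gσ γ p) * (fderiv ℝ (gσ γ) p (frF (gA A) (gX γ) (gζ γ) p) * u p)) (gU γ) :=
      ((hqσ hq).continuousOn.mono hUD).mul ((ContinuousOn.clm_apply
        (R.σ_C2.continuousOn_fderiv_of_isOpen R.isOpen (by norm_num)) R.F_C1.continuousOn).mul
          (hu1.continuousOn.mono hUD))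
    obtain ⟨Cq, hCq⟩ := (hK s S).exists_bound_of_continuousOn ((hqσ hq).continuousOn.mono (hKD s S hS))
    refine jumpF hm hγ hΛ hA1 hH hu hM0 hC hχ0 hχ1 hlim hz hM (s := s) hS hfc hf
      (fun p hp hk => ?_) (fun p hp hk => ?_) (c := |Cq| * (((m + k) * ((m + k) * (Λ * exp (-s)))))) (by positivity)
      (fun p hp hk => ?_)
    · rw [hmem h0 p (hUD hp) hk, zero_mul]
    · rw [hmem h0 p hp hk, zero_mul]
    · have h1 := beta_le hγ hΛ hH R hp hk
      have h2 := abs_mul_le_mul ((hCq p hk).trans (le_abs_self _)) (abs_mul_le_mul h1 (hub p hp.2))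
      rw [show q (gσ γ p) * (fderiv ℝ (gσ γ) p (frF (gA A) (gX γ) (gζ γ) p) * u p) - q (gσ γ p) * u p =
        q (gσ γ p) * ((fderiv ℝ (gσ γ) p (frF (gA A) (gX γ) (gζ γ) p) - 1) * u p) by ring]
      exact h2.trans (le_of_eq (by ring))

end UCP

end

section

set_option linter.unusedSectionVars false
set_option linter.unusedSimpArgs false
set_option linter.unusedVariables false
set_option maxSynthPendingDepth 3
namespace UCP

open BG

variable {m k : ℕ} {γ : ℝ}
variable {A : E m k → Matrix (Fin (m + k)) (Fin (m + k)) ℝ} {u V : E m k → ℝ} {Λ : ℝ}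

lemma Lop_eq {lam Q L : ℝ} (hγ : 0 < γ) (hA1 : C1coeff A)
    (R : Frame (gU γ : Set (E m k)) (gX γ) (gω γ) gθ (gζ γ) (gA A) (gσ γ) (gΨ γ) γ Q L lam)
    (hu : ContDiffOn ℝ 2 u (ball γ 1)) {p : E m k} (hp : p ∈ gU γ) :
    divg (gradA (frA (gA A) (gX γ)) u) p = Lop γ A u p := by
  have hfu : DifferentiableAt ℝ (fderiv ℝ u) p :=
    ((contDiffOn_fderiv hγ hu).differentiableOn one_ne_zero).differentiableAt
      ((isOpen_ball' hγ 1).mem_nhds (gU_sub_ball hp))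
  have hX : ∀ j, DifferentiableAt ℝ (gX γ j) p := fun j =>
    ((R.X_C1 j).differentiableOn one_ne_zero).differentiableAt (R.isOpen.mem_nhds hp)
  have ht : ∀ i j, DifferentiableAt ℝ (fun q => gA A i j q * fderiv ℝ u q (gX γ j q)) p := by
    intro i j
    have h1 : DifferentiableAt ℝ (gA A i j) p := (hA1 i j).differentiable one_ne_zero p
    exact h1.fun_mul (hfu.clm_apply (hX j))
  have e : gradA (frA (gA A) (gX γ)) u =
      fun q => ∑ i, (∑ j, gA A i j q * fderiv ℝ u q (gX γ j q)) • gX γ i q := by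
    funext q
    rw [gradA, frA_apply]
  rw [e, R.divg_comb hp (fun i q => ∑ j, gA A i j q * fderiv ℝ u q (gX γ j q))
    (fun i => DifferentiableAt.fun_sum fun j _ => ht i j)]
  unfold Lop Xd
  refine Finset.sum_congr rfl fun i _ => ?_
  rw [fderiv_fun_sum fun j _ => ht i j, sum_apply]
  rfl

lemma V_le (hγ : 0 < γ) {C₀ : ℝ} (hV : ∀ p ∈ ball γ 1, |V p| ≤ C₀ * psi γ p / rho γ p ^ 2)
    {p : E m k} (hp : p ∈ gU γ) : |V p| ≤ C₀ * gΨ γ p := by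
  refine (hV p hp.2).trans_eq ?_
  have := rho_pos hγ hp.1
  rw [psi_eq_gΨ hγ hp.1]
  field_simp

lemma vol_ball (hγ : 0 < γ) : volume (ball γ 1 : Set (E m k)) < ⊤ := by
  refine Bornology.IsBounded.measure_lt_top ?_
  refine (Metric.isBounded_closedBall (x := (0 : E m k)) (r := 2)).subset ?_
  intro p hp
  have hp' : rho γ p ≤ 1 := le_of_lt hp
  rw [mem_closedBall_zero_iff, Prod.norm_def]
  have h1 := (norm_le_rho hγ p).trans hp'
  have h2 : nn γ p ≤ 1 := by
    rw [← rho_pow hγ]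
    exact rpow_le_one (rho_nonneg p) hp' (by positivity)
  have h3 : ‖p.2‖ ^ 2 ≤ nn γ p := by
    unfold nn
    have h4 : 0 ≤ ‖p.1‖ ^ (2 * (γ + 1)) := by positivity
    have h5 : 1 ≤ (γ + 1) ^ 2 := by nlinarith
    nlinarith [sq_nonneg ‖p.2‖]
  refine max_le (by linarith) ?_
  nlinarith [sq_nonneg (‖p.2‖ - 1)]

lemma meas_psi (hγ : 0 < γ) : Measurable (psi γ : E m k → ℝ) := by
  unfold psi
  exact (continuous_fst.norm.measurable.pow_const _).div ((continuous_rho hγ).measurable.pow_const _)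

lemma int_upsi (hγ : 0 < γ) (hu : ContDiffOn ℝ 2 u (ball γ 1)) (hub : ∀ p ∈ ball γ 1, |u p| ≤ 1) :
    IntegrableOn (fun p : E m k => u p ^ 2 * psi γ p) (ball γ 1) := by
  have hm := (isOpen_ball' (m := m) (k := k) hγ 1).measurableSet
  have : IsFiniteMeasure (volume.restrict (ball γ 1 : Set (E m k))) :=
    ⟨by rw [Measure.restrict_apply_univ]; exact vol_ball hγ⟩
  refine Integrable.of_bound ?_ 1 ?_
  · exact ((hu.continuousOn.pow 2).aestronglyMeasurable hm).mul (meas_psi hγ).aestronglyMeasurable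
  · refine (ae_restrict_iff' hm).2 (ae_of_all _ fun p hp => ?_)
    rw [Real.norm_eq_abs, abs_mul, abs_of_nonneg (psi_nonneg p), abs_of_nonneg (sq_nonneg _)]
    have h1 : u p ^ 2 ≤ 1 := by
      rw [← sq_abs]; exact pow_le_one₀ (abs_nonneg _) (hub p hp)
    exact mul_le_one₀ h1 (psi_nonneg p) (psi_le_one hγ p)

lemma shell_int {lam Q L : ℝ} (hγ : 0 < γ)
    (R : Frame (gU γ : Set (E m k)) (gX γ) (gω γ) gθ (gζ γ) (gA A) (gσ γ) (gΨ γ) γ Q L lam)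
    (hu : ContDiffOn ℝ 2 u (ball γ 1)) (hub : ∀ p ∈ ball γ 1, |u p| ≤ 1) {s : ℝ} (hs : s ≤ -1) :
    0 ≤ ∫ p in shell (gU γ) (gσ γ) (s - 3) s, gΨ γ p * u p ^ 2 ∧
    ∫ p in shell (gU γ) (gσ γ) (s - 3) s, gΨ γ p * u p ^ 2 ≤
      exp (6 - 2 * s) * ∫ p in ball γ (exp (s + 1)), u p ^ 2 * psi γ p := by
  have hms := meas_shell R.isOpen R.σ_C2.continuousOn (s - 3) s
  have hsub : shell (gU γ : Set (E m k)) (gσ γ) (s - 3) s ⊆ ball γ (exp (s + 1)) := by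
    intro p hp
    have h1 := exp_gσ hγ hp.1.1
    show rho γ p < _
    rw [← h1, exp_lt_exp]
    linarith [hp.2.2]
  have hsub2 : (ball γ (exp (s + 1)) : Set (E m k)) ⊆ ball γ 1 := by
    intro p hp
    refine lt_of_lt_of_le (show rho γ p < exp (s + 1) from hp) ?_
    rw [exp_le_one_iff]; linarith
  have hi := (int_upsi hγ hu hub).mono_set hsub2
  have hnn : ∀ p ∈ shell (gU γ : Set (E m k)) (gσ γ) (s - 3) s, 0 ≤ gΨ γ p * u p ^ 2 := fun p hp =>
    mul_nonneg (R.Ψ_pos p hp.1).le (sq_nonneg _)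
  refine ⟨setIntegral_nonneg hms hnn, ?_⟩
  rw [← integral_const_mul]
  have hle : ∀ p ∈ shell (gU γ : Set (E m k)) (gσ γ) (s - 3) s, gΨ γ p * u p ^ 2 ≤
      exp (6 - 2 * s) * (u p ^ 2 * psi γ p) := by
    intro p hp
    have h1 := gΨ_le hγ hp.1.1 ((mem_kD hγ hp.1.1).2 hp.2)
    have h2 : exp (-(s - 3)) ^ 2 = exp (6 - 2 * s) := by
      rw [← exp_nat_mul]; congr 1; push_cast; ring
    rw [h2] at h1
    calc _ ≤ psi γ p * exp (6 - 2 * s) * u p ^ 2 := by gcongr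
      _ = _ := by ring
  have hi2 : IntegrableOn (fun p => exp (6 - 2 * s) * (u p ^ 2 * psi γ p)) (ball γ (exp (s + 1))) :=
    hi.const_mul _
  calc _ ≤ ∫ p in shell (gU γ) (gσ γ) (s - 3) s, exp (6 - 2 * s) * (u p ^ 2 * psi γ p) := by
        refine integral_mono_of_nonneg ((ae_restrict_iff' hms).2 (ae_of_all _ hnn)) (hi2.mono_set hsub)
          ((ae_restrict_iff' hms).2 (ae_of_all _ hle))
    _ ≤ _ := by
        refine setIntegral_mono_set hi2 (ae_of_all _ fun p => ?_) hsub.eventuallyLE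
        exact mul_nonneg (exp_pos _).le (mul_nonneg (sq_nonneg _) (psi_nonneg p))

lemma gvan {lam Q L : ℝ} (hγ : 0 < γ)
    (R : Frame (gU γ : Set (E m k)) (gX γ) (gω γ) gθ (gζ γ) (gA A) (gσ γ) (gΨ γ) γ Q L lam)
    (hu : ContDiffOn ℝ 2 u (ball γ 1)) (hub : ∀ p ∈ ball γ 1, |u p| ≤ 1)
    (hvanish : ∀ κ : ℝ, 0 < κ →
      (fun r : ℝ => ∫ p in ball γ r, u p ^ 2 * psi γ p)
        =O[nhdsWithin (0 : ℝ) (Set.Ioi 0)]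
          fun r : ℝ => Real.exp (-κ * Real.log r ^ 2)) (κ : ℝ) (hκ : 0 < κ) :
    Tendsto (fun s => exp (κ * s ^ 2) *
      ∫ p in shell (gU γ) (gσ γ) (s - 3) s, gΨ γ p * u p ^ 2) atBot (nhds 0) := by
  obtain ⟨c, hc, hb⟩ := (hvanish (4 * (κ + 1)) (by linarith)).exists_pos
  have ht : Tendsto (fun s : ℝ => exp (s + 1)) atBot (nhdsWithin (0 : ℝ) (Set.Ioi 0)) :=
    tendsto_exp_atBot_nhdsGT.comp (tendsto_atBot_add_const_right _ 1 tendsto_id)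
  have hb' := ht.eventually hb.bound
  have hlim : Tendsto (fun s => c * exp s) atBot (nhds 0) := by
    simpa using tendsto_exp_atBot.const_mul c
  refine squeeze_zero' ?_ ?_ hlim
  · filter_upwards [eventually_le_atBot (-5)] with s hs
    exact mul_nonneg (exp_pos _).le (shell_int hγ R hu hub (by linarith)).1
  · filter_upwards [eventually_le_atBot (-5), hb'] with s hs h
    have h1 := (shell_int hγ R hu hub (s := s) (by linarith)).2
    rw [log_exp, Real.norm_eq_abs, Real.norm_eq_abs, abs_of_pos (exp_pos _)] at h
    have h2 := (le_abs_self _).trans h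
    calc _ ≤ exp (κ * s ^ 2) * (exp (6 - 2 * s) * (c * exp (-(4 * (κ + 1)) * (s + 1) ^ 2))) := by
          refine mul_le_mul_of_nonneg_left (h1.trans ?_) (exp_pos _).le
          exact mul_le_mul_of_nonneg_left h2 (exp_pos _).le
      _ = c * exp (κ * s ^ 2 + (6 - 2 * s) + -(4 * (κ + 1)) * (s + 1) ^ 2) := by
          rw [exp_add, exp_add]; ring
      _ ≤ c * exp s := by
          refine mul_le_mul_of_nonneg_left (exp_le_exp.2 ?_) hc.le
          have h3 : s ^ 2 ≤ 4 * (s + 1) ^ 2 := by nlinarith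
          have h4 : (κ + 1) * s ^ 2 ≤ (κ + 1) * (4 * (s + 1) ^ 2) := by gcongr
          nlinarith

theorem local_zero {lam C₀ : ℝ} (hm : 1 ≤ m) (hγ : 0 < γ) (hlam : 0 < lam) (hΛ : 0 < Λ)
    (hA1 : C1coeff A) (hA2 : Symm A) (hA3 : Elliptic lam A) (hA5 : HypH γ Λ A) (hC₀ : 0 < C₀)
    (hu : ContDiffOn ℝ 2 u (ball γ 1))
    (hub : ∀ p ∈ ball γ 1, |u p| ≤ 1)
    (heq : ∀ p ∈ ball γ 1, Lop γ A u p = V p * u p)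
    (hV : ∀ p ∈ ball γ 1, |V p| ≤ C₀ * psi γ p / rho γ p ^ 2)
    (hvanish : ∀ κ : ℝ, 0 < κ →
      (fun r : ℝ => ∫ p in ball γ r, u p ^ 2 * psi γ p)
        =O[nhdsWithin (0 : ℝ) (Set.Ioi 0)]
          fun r : ℝ => Real.exp (-κ * Real.log r ^ 2)) :
    ∃ S : ℝ, ∀ p ∈ gU γ, gσ γ p < S → u p = 0 := by
  have R := gframe hγ hΛ hlam hA1 hA2 hA3 hA5
  obtain ⟨K, G⟩ := R.geo
  obtain ⟨χ, C⟩ := gcut hm hγ hΛ hA1 hA5 R hu hub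
  obtain ⟨S0, h0, h1, hK⟩ := exists_S0 K 0
  refine ⟨S0 - 2, core C G (hu.mono gU_sub_ball) (fun p hp => ?_) hC₀.le (fun p hp => V_le hγ hV hp)
    (fun p hp => hub p (gU_sub_ball hp)) h0 h1 hK (gvan hγ R hu hub hvanish)⟩
  rw [Lop_eq hγ hA1 R hu hp, heq p (gU_sub_ball hp)]

end UCP

end

section

set_option linter.unusedSectionVars false
set_option linter.unusedSimpArgs false
set_option linter.unusedVariables false
set_option maxSynthPendingDepth 3
namespace UCP

open BG

variable {m k : ℕ} {γ : ℝ}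
variable {A : E m k → Matrix (Fin (m + k)) (Fin (m + k)) ℝ} {u V : E m k → ℝ} {Λ : ℝ}

lemma norm_xi_le {p : E m k} (hp : p.1 ≠ 0) (ξ : E m k →L[ℝ] ℝ) :
    ‖ξ‖ ≤ (1 + ‖p.1‖ ^ (-γ)) * ∑ l, |ξ (gX γ l p)| := by
  have hn : 0 < ‖p.1‖ := norm_pos_iff.2 hp
  have hinv : ‖p.1‖ ^ (-γ) * ‖p.1‖ ^ γ = 1 := by
    rw [← rpow_add hn, neg_add_cancel, rpow_zero]
  have hB : 0 ≤ ‖p.1‖ ^ (-γ) := by positivity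
  refine ContinuousLinearMap.opNorm_le_bound _ (mul_nonneg (by positivity)
    (Finset.sum_nonneg fun _ _ => abs_nonneg _)) fun h => ?_
  have hh : h = ∑ i : Fin m, h.1 i • gX γ (Fin.castAdd k i) p +
      ∑ j : Fin k, (h.2 j * ‖p.1‖ ^ (-γ)) • gX γ (Fin.natAdd m j) p := by
    unfold gX
    simp only [X_castAdd, X_natAdd, smul_smul, mul_assoc, hinv, mul_one]
    refine Prod.ext ?_ ?_
    · simp only [Prod.fst_add, Prod.fst_sum, Prod.smul_fst, smul_zero, Finset.sum_const_zero, add_zero]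
      ext i
      simp [Finset.sum_apply, Pi.single_apply]
    · simp only [Prod.snd_add, Prod.snd_sum, Prod.smul_snd, smul_zero, Finset.sum_const_zero, zero_add]
      ext i
      simp [Finset.sum_apply, Pi.single_apply]
  have h1 : ∀ i, |h.1 i| ≤ ‖h‖ := fun i => (PiLp.norm_apply_le h.1 i).trans (norm_fst_le h)
  have h2 : ∀ i, |h.2 i| ≤ ‖h‖ := fun i => (PiLp.norm_apply_le h.2 i).trans (norm_snd_le h)
  have h3 : ξ h = ∑ i : Fin m, h.1 i * ξ (gX γ (Fin.castAdd k i) p) +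
      ∑ j : Fin k, (h.2 j * ‖p.1‖ ^ (-γ)) * ξ (gX γ (Fin.natAdd m j) p) := by
    conv_lhs => rw [hh]
    simp only [map_add, map_sum, map_smul, smul_eq_mul]
  rw [h3, Fin.sum_univ_add, Real.norm_eq_abs]
  refine (abs_add_le _ _).trans ?_
  have e1 : |∑ i : Fin m, h.1 i * ξ (gX γ (Fin.castAdd k i) p)| ≤
      ∑ i : Fin m, (1 + ‖p.1‖ ^ (-γ)) * |ξ (gX γ (Fin.castAdd k i) p)| * ‖h‖ := by
    refine (Finset.abs_sum_le_sum_abs _ _).trans (Finset.sum_le_sum fun i _ => ?_)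
    rw [abs_mul]
    calc _ ≤ ‖h‖ * (1 * |ξ (gX γ (Fin.castAdd k i) p)|) := by rw [one_mul]; gcongr; exact h1 i
      _ ≤ ‖h‖ * ((1 + ‖p.1‖ ^ (-γ)) * |ξ (gX γ (Fin.castAdd k i) p)|) := by gcongr; linarith
      _ = _ := by ring
  have e2 : |∑ j : Fin k, (h.2 j * ‖p.1‖ ^ (-γ)) * ξ (gX γ (Fin.natAdd m j) p)| ≤
      ∑ i : Fin k, (1 + ‖p.1‖ ^ (-γ)) * |ξ (gX γ (Fin.natAdd m i) p)| * ‖h‖ := by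
    refine (Finset.abs_sum_le_sum_abs _ _).trans (Finset.sum_le_sum fun i _ => ?_)
    rw [abs_mul, abs_mul, abs_of_nonneg hB]
    calc _ ≤ ‖h‖ * (1 + ‖p.1‖ ^ (-γ)) * |ξ (gX γ (Fin.natAdd m i) p)| := by
          gcongr
          · exact h2 i
          · linarith
      _ = _ := by ring
  refine (add_le_add e1 e2).trans_eq ?_
  rw [← Finset.sum_mul, ← Finset.sum_mul, ← Finset.mul_sum, ← Finset.mul_sum]
  ring

lemma gcoer {lam Q L : ℝ} (hm : 1 ≤ m) (hγ : 0 < γ) (hlam : 0 < lam)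
    (R : Frame (gU γ : Set (E m k)) (gX γ) (gω γ) gθ (gζ γ) (gA A) (gσ γ) (gΨ γ) γ Q L lam)
    (p : E m k) (hp : p ∈ gU γ) :
    ∃ c > 0, ∀ᶠ x in nhds p, ∀ ξ : E m k →L[ℝ] ℝ, c * ‖ξ‖ ^ 2 ≤ ξ (frA (gA A) (gX γ) x ξ) := by
  have hn : 0 < ‖p.1‖ := norm_pos_iff.2 hp.1
  have hB : 0 ≤ ‖p.1‖ ^ (-γ) := by positivity
  set D := 1 + ‖p.1‖ ^ (-γ) + 1 with hD
  have hDp : 0 < D := by positivity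
  have hN : (0:ℝ) < (m + k : ℕ) := by exact_mod_cast (by omega : 0 < m + k)
  refine ⟨lam / (D ^ 2 * (m + k : ℕ)), by positivity, ?_⟩
  have hc : ContinuousAt (fun x : E m k => 1 + ‖x.1‖ ^ (-γ)) p :=
    continuousAt_const.add (continuous_fst.norm.continuousAt.rpow_const (Or.inl hn.ne'))
  filter_upwards [R.isOpen.mem_nhds hp, hc.eventually_lt_const (show 1 + ‖p.1‖ ^ (-γ) < D by linarith)]
    with x hx hxD ξ
  have h1 := norm_xi_le (γ := γ) hx.1 ξ
  have h2 := R.ell x hx (fun l => ξ (gX γ l x))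
  have h3 : ξ (frA (gA A) (gX γ) x ξ) =
      ∑ i, ∑ j, gA A i j x * ξ (gX γ i x) * ξ (gX γ j x) := by
    rw [frA_apply2]
    refine Finset.sum_congr rfl fun i _ => Finset.sum_congr rfl fun j _ => by ring
  rw [h3]
  refine h2.trans' ?_
  have h4 : (∑ l, |ξ (gX γ l x)|) ^ 2 ≤ (m + k : ℕ) * ∑ l, ξ (gX γ l x) ^ 2 := by
    have := sq_sum_le_card_mul_sum_sq (s := (Finset.univ : Finset (Fin (m + k)))) (f := fun l => |ξ (gX γ l x)|)
    simpa using this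
  have h5 : ‖ξ‖ ≤ D * ∑ l, |ξ (gX γ l x)| := h1.trans (by gcongr)
  have h6 : ‖ξ‖ ^ 2 ≤ D ^ 2 * ((m + k : ℕ) * ∑ l, ξ (gX γ l x) ^ 2) :=
    calc _ ≤ (D * ∑ l, |ξ (gX γ l x)|) ^ 2 := by gcongr
      _ = D ^ 2 * (∑ l, |ξ (gX γ l x)|) ^ 2 := by ring
      _ ≤ _ := by gcongr
  calc _ ≤ lam / (D ^ 2 * (m + k : ℕ)) * (D ^ 2 * ((m + k : ℕ) * ∑ l, ξ (gX γ l x) ^ 2)) := by gcongr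
    _ = _ := by field_simp

lemma rho_dil (hγ : 0 < γ) (p : E m k) {r : ℝ} (hr : 0 < r) :
    rho γ ((r • p.1, r ^ (γ + 1) • p.2) : E m k) = r * rho γ p := by
  have h1 : nn γ ((r • p.1, r ^ (γ + 1) • p.2) : E m k) = r ^ (2 * (γ + 1)) * nn γ p := by
    unfold nn
    have h2 : (r ^ (γ + 1)) ^ 2 = r ^ (2 * (γ + 1)) := by
      rw [← rpow_natCast, ← rpow_mul hr.le]; congr 1; push_cast; ring
    have h3 : 0 ≤ r ^ (γ + 1) := by positivity
    simp only [norm_smul, Real.norm_eq_abs, abs_of_pos hr, abs_of_nonneg h3]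
    rw [mul_rpow hr.le (norm_nonneg _), mul_pow, h2]
    ring
  have e : ∀ q : E m k, rho γ q = nn γ q ^ (1 / (2 * (γ + 1))) := fun q => rfl
  rw [e, e, h1, mul_rpow (by positivity) (nn_nonneg p), ← rpow_mul hr.le,
    mul_one_div_cancel (by positivity), rpow_one]

theorem global_zero {lam C₀ : ℝ} (hm : 1 ≤ m) (hγ : 0 < γ) (hlam : 0 < lam) (hΛ : 0 < Λ)
    (hA1 : C1coeff A) (hA2 : Symm A) (hA3 : Elliptic lam A) (hA5 : HypH γ Λ A) (hC₀ : 0 < C₀)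
    (hu : ContDiffOn ℝ 2 u (ball γ 1))
    (hub : ∀ p ∈ ball γ 1, |u p| ≤ 1)
    (heq : ∀ p ∈ ball γ 1, Lop γ A u p = V p * u p)
    (hV : ∀ p ∈ ball γ 1, |V p| ≤ C₀ * psi γ p / rho γ p ^ 2)
    {S : ℝ} (hS : ∀ p ∈ gU γ, gσ γ p < S → u p = 0) : ∀ p ∈ gU γ, u p = 0 := by
  have R := gframe hγ hΛ hlam hA1 hA2 hA3 hA5
  intro p hp
  set δ : ℝ → E m k := fun r => (r • p.1, r ^ (γ + 1) • p.2) with hδ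
  have hcont : Continuous δ := by
    have h1 : Continuous fun r : ℝ => r ^ (γ + 1) :=
      continuous_id.rpow_const fun _ => Or.inr (by positivity)
    exact (continuous_id.smul continuous_const).prodMk (h1.smul continuous_const)
  have hδU : ∀ r ∈ Ioc (0:ℝ) 1, δ r ∈ gU γ := by
    intro r hr
    refine ⟨smul_ne_zero hr.1.ne' hp.1, ?_⟩
    rw [hδ, rho_dil hγ p hr.1]
    have := rho_nonneg (γ := γ) p
    nlinarith [hp.2, hr.1, hr.2]
  have hr0 : min 1 (exp (S - 1)) ∈ Ioc (0:ℝ) 1 := ⟨lt_min one_pos (exp_pos _), min_le_left _ _⟩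
  set r0 := min 1 (exp (S - 1)) with hr0d
  have hσ0 : gσ γ (δ r0) < S := by
    rw [gσ, log_lt_iff_lt_exp (rho_pos hγ (hδU _ hr0).1), hδ, rho_dil hγ p hr0.1]
    have h1 : r0 ≤ exp (S - 1) := min_le_right _ _
    have h2 : exp (S - 1) < exp S := exp_lt_exp.2 (by linarith)
    have := rho_nonneg (γ := γ) p
    nlinarith [hp.2, hr0.1]
  have hp1 : δ 1 = p := by simp [hδ]
  rw [← hp1]
  refine ell_path (volume : Measure (E m k)) R.isOpen (frA (gA A) (gX γ)) R.A_C1 ?_ (gcoer hm hγ hlam R) u V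
    (hu.mono gU_sub_ball) (fun p hp => hub p (gU_sub_ball hp)) ?_ ?_
    (P := δ '' Ioc 0 1) (isPreconnected_Ioc.image _ hcont.continuousOn) ?_ (δ r0) (mem_image_of_mem _ hr0)
    ?_ (δ 1) (mem_image_of_mem _ ⟨one_pos, le_rfl⟩)
  · intro x hx ξ η
    rw [frA_apply2, frA_apply2, Finset.sum_comm]
    refine Finset.sum_congr rfl fun i _ => Finset.sum_congr rfl fun j _ => ?_
    rw [R.symm i j x hx]; ring
  · intro q hq
    rw [Lop_eq hγ hA1 R hu hq, heq q (gU_sub_ball hq)]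
  · intro q hq
    refine ⟨C₀ * (gΨ γ q + 1), ?_⟩
    have hc : ContinuousAt (gΨ γ) q := R.Ψ_C1.continuousOn.continuousAt (R.isOpen.mem_nhds hq)
    filter_upwards [R.isOpen.mem_nhds hq, hc.eventually_lt_const (show gΨ γ q < gΨ γ q + 1 by linarith)] with x hx h
    refine (V_le hγ hV hx).trans ?_
    gcongr
  · rintro _ ⟨r, hr, rfl⟩
    exact hδU r hr
  · have hq := hδU _ hr0
    have hc : ContinuousAt (gσ γ) (δ r0) := R.σ_C2.continuousOn.continuousAt (R.isOpen.mem_nhds hq)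
    filter_upwards [R.isOpen.mem_nhds hq, hc.eventually_lt_const hσ0] with x hx h using hS x hx h

theorem final_zero (hm : 1 ≤ m) (hγ : 0 < γ) (hu : ContDiffOn ℝ 2 u (ball γ 1))
    (h0 : ∀ p ∈ gU γ, u p = 0) : ∀ p ∈ ball γ 1, u p = 0 := by
  intro p hp
  have hd : Dense {q : E m k | ¬ q.1 = 0} := by
    refine Measure.dense_of_ae (μ := volume) (p := fun q : E m k => ¬ q.1 = 0) ?_
    rw [ae_iff]
    simpa using null_z (k := k) hm
  have hcl : p ∈ closure (gU γ) := by
    refine closure_mono ?_ (hd.open_subset_closure_inter (isOpen_ball' hγ 1) hp)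
    exact fun q hq => ⟨hq.2, hq.1⟩
  have hc : ContinuousWithinAt u (gU γ) p := (hu.continuousOn p hp).mono gU_sub_ball
  have : (nhdsWithin p (gU γ)).NeBot := mem_closure_iff_nhdsWithin_neBot.1 hcl
  refine tendsto_nhds_unique hc ?_
  refine tendsto_const_nhds.congr' ?_
  filter_upwards [self_mem_nhdsWithin] with q hq using (h0 q hq).symm

end UCP

end

open BG in
/-- unique continuation for Hardy type potentials
(Theorem `hardy1` of the paper). -/
theorem ucp_hardy_potential
    (m k : ℕ) (hm : 1 ≤ m) (hk : 1 ≤ k) (γ : ℝ) (hγ : 0 < γ)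
    (lam Λ : ℝ) (hlam : 0 < lam) (hΛ : 0 < Λ)
    (A : E m k → Matrix (Fin (m + k)) (Fin (m + k)) ℝ)
    (hA1 : C1coeff A) (hA2 : Symm A) (hA3 : Elliptic lam A)
    (hA4 : A 0 = 1) (hA5 : HypH γ Λ A)
    (C₀ : ℝ) (hC₀ : 0 < C₀) (V u : E m k → ℝ)
    (hu : ContDiffOn ℝ 2 u (ball γ 1))
    (hub : ∀ p ∈ ball γ 1, |u p| ≤ 1)
    (heq : ∀ p ∈ ball γ 1, Lop γ A u p = V p * u p)
    (hV : ∀ p ∈ ball γ 1, |V p| ≤ C₀ * psi γ p / rho γ p ^ 2)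
    (hvanish : ∀ κ : ℝ, 0 < κ →
      (fun r : ℝ => ∫ p in ball γ r, u p ^ 2 * psi γ p)
        =O[nhdsWithin (0 : ℝ) (Set.Ioi 0)]
          fun r : ℝ => Real.exp (-κ * Real.log r ^ 2)) :
    ∀ p ∈ ball γ 1, u p = 0 := by
  obtain ⟨S, hS⟩ := UCP.local_zero hm hγ hlam hΛ hA1 hA2 hA3 hA5 hC₀ hu hub heq hV hvanish
  exact UCP.final_zero hm hγ hu
    (UCP.global_zero hm hγ hlam hΛ hA1 hA2 hA3 hA5 hC₀ hu hub heq hV hS)
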